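/- arXiv:1205.2812 — 2 statements merged into one kernel-verified Lean document; each statement's English description precedes it below -/
import Mathlib

section
/- There exist constants c₁, C₂ > 0, depending only on n, such that for every λ > 0 and every torus eigenfunction φ with frequency λ, c₁ λ ≤ H^{n−1}(Z_φ) ≤ C₂ λ. -/
open MeasureTheory
open scoped ENNReal

/-- The Euclidean Laplacian, as the sum of second partial derivatives. -/
noncomputable def lap {n : ℕ} (φ : EuclideanSpace ℝ (Fin n) → ℝ)
    (x : EuclideanSpace ℝ (Fin n)) : ℝ :=
  ∑ i, fderiv ℝ (fun y => fderiv ℝ φ y (EuclideanSpace.single i 1)) x (EuclideanSpace.single i 1)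

/-- A function on ℝⁿ is ℤⁿ-periodic if it is invariant under translation by
every integer vector. -/
def ZnPeriodic {n : ℕ} (φ : EuclideanSpace ℝ (Fin n) → ℝ) : Prop :=
  ∀ (x : EuclideanSpace ℝ (Fin n)) (k : Fin n → ℤ),
    φ (x + (WithLp.equiv 2 (Fin n → ℝ)).symm fun i => (k i : ℝ)) = φ x

/-- The fundamental domain [0,1)ⁿ of the torus ℝⁿ/ℤⁿ. -/
def fund (n : ℕ) : Set (EuclideanSpace ℝ (Fin n)) := {x | ∀ i, x i ∈ Set.Ico (0:ℝ) 1}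

/-- φ is a torus eigenfunction with frequency λ: smooth, ℤⁿ-periodic, not
identically zero, with Δφ = -λ²φ. -/
def IsTorusEigenfunction {n : ℕ} (lam : ℝ) (φ : EuclideanSpace ℝ (Fin n) → ℝ) : Prop :=
  ContDiff ℝ (⊤ : ℕ∞) φ ∧ ZnPeriodic φ ∧ φ ≠ 0 ∧ ∀ x, lap φ x = -lam ^ 2 * φ x

open scoped NNReal Topology

/-- The character `t ↦ exp (2 π i t)` of the circle. -/
noncomputable def ee (t : ℝ) : ℂ := Complex.exp (2 * Real.pi * t * Complex.I)

lemma norm_ee (t : ℝ) : ‖ee t‖ = 1 := by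
  have := Complex.norm_exp_ofReal_mul_I (2 * Real.pi * t)
  simpa [ee] using this

lemma ee_ne_zero (t : ℝ) : ee t ≠ 0 := Complex.exp_ne_zero _

lemma ee_add (s t : ℝ) : ee (s + t) = ee s * ee t := by
  rw [ee, ee, ee, ← Complex.exp_add]; push_cast; ring_nf

lemma continuous_ee : Continuous ee := by unfold ee; fun_prop

lemma ee_eq_circleMap (t : ℝ) : ee t = circleMap 0 1 (2 * Real.pi * t) := by
  simp [ee, circleMap]

lemma norm_ee_sub_one_le (s : ℝ) : ‖ee s - 1‖ ≤ 2 * Real.pi * |s| := by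
  have := Real.norm_exp_I_mul_ofReal_sub_one_le (x := 2 * Real.pi * s)
  rw [Real.norm_eq_abs, abs_mul, abs_of_pos Real.two_pi_pos] at this
  rw [ee]
  convert this using 3
  push_cast; ring_nf

lemma ee_inj_Ico {s t : ℝ} (hs : s ∈ Set.Ico (0 : ℝ) 1) (ht : t ∈ Set.Ico (0 : ℝ) 1)
    (h : ee s = ee t) : s = t := by
  rw [ee, ee, Complex.exp_eq_exp_iff_exists_int] at h
  obtain ⟨n, hn⟩ := h
  have h1 : (2 * Real.pi * s : ℝ) = 2 * Real.pi * t + n * (2 * Real.pi) := by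
    have := congrArg Complex.im hn
    simpa using this
  have h2 : s = t + n := by
    have : (2 * Real.pi) * s = (2 * Real.pi) * (t + n) := by linarith
    exact mul_left_cancel₀ Real.two_pi_pos.ne' this
  have h3 : (n : ℝ) < 1 := by linarith [hs.2, ht.1]
  have h4 : (-1 : ℝ) < n := by linarith [hs.1, ht.2]
  have h5 : n = 0 := by
    have h3' : n < 1 := by exact_mod_cast h3
    have h4' : -1 < n := by exact_mod_cast h4
    omega
  simpa [h5] using h2

lemma circleAverage_eq_integral_ee (f : ℂ → ℝ) :
    Real.circleAverage f 0 1 = ∫ t in Set.Ico (0 : ℝ) 1, f (ee t) := by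
  rw [Real.circleAverage_def, integral_Ico_eq_integral_Ioc , ← intervalIntegral.integral_of_le zero_le_one]
  simp_rw [ee_eq_circleMap]
  rw [intervalIntegral.integral_comp_mul_left (fun t => f (circleMap 0 1 t)) Real.two_pi_pos.ne']
  simp

lemma circleIntegrable_iff_ee (f : ℂ → ℝ) (hf : CircleIntegrable f 0 1) :
    IntegrableOn (fun t => f (ee t)) (Set.Ico (0 : ℝ) 1) := by
  rw [CircleIntegrable] at hf
  have := hf.comp_mul_left (c := 2 * Real.pi)
  simp only [zero_div, div_self Real.two_pi_pos.ne'] at this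
  rw [intervalIntegrable_iff_integrableOn_Ico_of_le zero_le_one] at this
  simpa [ee_eq_circleMap] using this

lemma circleAverage_log_norm_one_sub_mul {ζ : ℂ} (h : ‖ζ‖ ≤ 1) :
    Real.circleAverage (fun v => Real.log ‖1 - ζ * v‖) 0 1 = 0 := by
  rcases eq_or_ne ζ 0 with rfl | h0
  · simp [Real.circleAverage_const]
  have h1 : Set.EqOn (fun v => Real.log ‖1 - ζ * v‖)
      (fun v => Real.log ‖ζ‖ + Real.log ‖v - ζ⁻¹‖) (Metric.sphere (0:ℂ) |1|) := by
    intro v hv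
    simp only [abs_one, mem_sphere_iff_norm, sub_zero] at hv
    have e : 1 - ζ * v = -(ζ * (v - ζ⁻¹)) := by field_simp; ring
    simp only
    rcases eq_or_ne v ζ⁻¹ with hv' | hv'
    · have : ‖ζ‖ = 1 := by
        rw [hv', norm_inv] at hv
        simpa using hv
      simp [hv', this, h0]
    · rw [e, norm_neg, norm_mul, Real.log_mul (norm_ne_zero_iff.2 h0)
        (norm_ne_zero_iff.2 (sub_ne_zero.2 hv'))]
  rw [Real.circleAverage_congr_sphere h1, Real.circleAverage_fun_add (circleIntegrable_const _ _ _)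
    (circleIntegrable_log_norm_sub_const _), Real.circleAverage_const]
  have := circleAverage_log_norm_sub_const_eq_posLog (a := ζ⁻¹)
  simp only [this, Real.posLog, norm_inv, Real.log_inv]
  rw [max_eq_right]
  · ring
  · have := Real.log_nonpos (norm_nonneg ζ) h
    linarith

lemma circleIntegrable_log_norm_one_sub_mul (ζ : ℂ) :
    CircleIntegrable (fun v => Real.log ‖1 - ζ * v‖) 0 1 := by
  apply MeromorphicOn.circleIntegrable_log_norm
  intro x _
  fun_prop

lemma re_inv_one_sub {u : ℂ} (hu : 1 - u ≠ 0) :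
    (1 - ‖u‖ ^ 2) * ‖(1 - u)⁻¹‖ ^ 2 = 2 * ((1 - u)⁻¹).re - 1 := by
  have h : Complex.normSq (1 - u) ≠ 0 := by simpa [Complex.normSq_eq_zero] using hu
  rw [norm_inv, inv_pow, ← Complex.normSq_eq_norm_sq, ← Complex.normSq_eq_norm_sq, Complex.inv_re]
  field_simp
  simp only [Complex.normSq_apply, Complex.sub_re, Complex.sub_im, Complex.one_re, Complex.one_im]
  ring

lemma norm_sq_one_sub_le {u : ℂ} (hu : ‖u‖ ≤ 1) {ρ : ℝ} (h0 : 0 ≤ ρ) (h1 : ρ ≤ 1) :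
    ρ * ‖1 - u‖ ^ 2 ≤ ‖1 - ρ * u‖ ^ 2 := by
  have h2 : Complex.normSq u ≤ 1 := by
    rw [Complex.normSq_eq_norm_sq]; exact pow_le_one₀ (norm_nonneg _) hu
  rw [← Complex.normSq_eq_norm_sq, ← Complex.normSq_eq_norm_sq]
  have h3 : 0 ≤ (1 - ρ) * (1 - ρ * Complex.normSq u) := by
    apply mul_nonneg <;> nlinarith [Complex.normSq_nonneg u]
  simp only [Complex.normSq_apply, Complex.sub_re, Complex.sub_im, Complex.one_re, Complex.one_im,
    Complex.mul_re, Complex.mul_im, Complex.ofReal_re, Complex.ofReal_im] at h3 ⊢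
  nlinarith

/-- A weak-type estimate in the style of Kolmogorov. -/
lemma volume_norm_sum_inv_ge_le {ι : Type*} [Fintype ι] (ζ : ι → ℂ) (hζ : ∀ j, ‖ζ j‖ < 1)
    {K : ℝ} (hK : 0 < K) :
    volume {t ∈ Set.Ico (0 : ℝ) 1 | K ≤ ‖∑ j, (1 - ζ j * ee t)⁻¹‖} ≤
      ENNReal.ofReal (2 * Fintype.card ι / K) := by
  set F : ℂ → ℂ := fun v => ∑ j, (1 - ζ j * v)⁻¹ with hF
  set H : ℂ → ℂ := fun v => F v / (F v + K) with hH
  have hlt : ∀ v ∈ Metric.closedBall (0:ℂ) 1, ∀ j, ‖ζ j * v‖ < 1 := by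
    intro v hv j
    rw [mem_closedBall_zero_iff] at hv
    rw [norm_mul]
    nlinarith [hζ j, norm_nonneg (ζ j), norm_nonneg v]
  have hne : ∀ v ∈ Metric.closedBall (0:ℂ) 1, ∀ j, 1 - ζ j * v ≠ 0 := by
    intro v hv j h
    have := hlt v hv j
    rw [← sub_eq_zero.1 h] at this
    simp at this
  have hre : ∀ v ∈ Metric.closedBall (0:ℂ) 1, 0 ≤ (F v).re := by
    intro v hv
    rw [hF, Complex.re_sum]
    refine Finset.sum_nonneg fun j _ => ?_
    have h1 := re_inv_one_sub (hne v hv j)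
    have h2 : 0 ≤ 1 - ‖ζ j * v‖ ^ 2 := by
      nlinarith [hlt v hv j, norm_nonneg (ζ j * v)]
    nlinarith [mul_nonneg h2 (sq_nonneg ‖(1 - ζ j * v)⁻¹‖)]
  have hne2 : ∀ v ∈ Metric.closedBall (0:ℂ) 1, F v + K ≠ 0 := by
    intro v hv h
    have := congrArg Complex.re h
    simp at this
    linarith [hre v hv]
  have hdF : ∀ v ∈ Metric.closedBall (0:ℂ) 1, DifferentiableAt ℂ F v := by
    intro v hv
    rw [hF]
    refine DifferentiableAt.fun_sum fun j _ => ?_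
    exact (by fun_prop : DifferentiableAt ℂ (fun v => 1 - ζ j * v) v).inv (hne v hv j)
  have hdH : ∀ v ∈ Metric.closedBall (0:ℂ) 1, DifferentiableAt ℂ H v := fun v hv =>
    (hdF v hv).div ((hdF v hv).add_const _) (hne2 v hv)
  have hHre : ∀ v ∈ Metric.closedBall (0:ℂ) 1,
      (H v).re = (‖F v‖ ^ 2 + K * (F v).re) / (‖F v‖ ^ 2 + 2 * K * (F v).re + K ^ 2) := by
    intro v hv
    have : Complex.normSq (F v + K) = ‖F v‖ ^ 2 + 2 * K * (F v).re + K ^ 2 := by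
      rw [← Complex.normSq_eq_norm_sq]; simp [Complex.normSq_apply]; ring
    rw [hH]
    simp only
    rw [Complex.div_re, this, ← Complex.normSq_eq_norm_sq, Complex.normSq_apply]
    simp only [Complex.add_re, Complex.add_im, Complex.ofReal_re, Complex.ofReal_im]
    ring
  have havg : Real.circleAverage (fun v => (H v).re) 0 1 =
      Fintype.card ι / (Fintype.card ι + K) := by
    have hd : DiffContOnCl ℂ H (Metric.ball 0 |1|) := by
      rw [abs_one]
      refine ⟨fun v hv => (hdH v (Metric.ball_subset_closedBall hv)).differentiableWithinAt, ?_⟩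
      rw [closure_ball _ one_ne_zero]
      exact fun v hv => (hdH v hv).continuousAt.continuousWithinAt
    have h1 := hd.circleAverage
    have hci : CircleIntegrable H 0 1 := by
      refine ContinuousOn.circleIntegrable zero_le_one fun v hv => ?_
      exact (hdH v (Metric.sphere_subset_closedBall hv)).continuousAt.continuousWithinAt
    have h2 := Complex.reCLM.circleAverage_comp_comm hci
    rw [h1] at h2
    have h3 : (Complex.reCLM ∘ H) = fun v => (H v).re := rfl
    rw [h3] at h2
    rw [h2, hH, hF]
    simp only [mul_zero, sub_zero, inv_one, Finset.sum_const, Finset.card_univ, nsmul_eq_mul, mul_one]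
    rw [Complex.reCLM_apply]
    norm_cast
  rw [circleAverage_eq_integral_ee] at havg
  have hmem : ∀ t, ee t ∈ Metric.closedBall (0:ℂ) 1 := fun t => by simp [norm_ee]
  have hint : IntegrableOn (fun t => (H (ee t)).re) (Set.Ico 0 1) := by
    refine (Continuous.integrableOn_Icc (a := 0) (b := 1) ?_).mono_set Set.Ico_subset_Icc_self
    refine Complex.continuous_re.comp ?_
    rw [continuous_iff_continuousAt]
    exact fun t => (hdH _ (hmem t)).continuousAt.comp continuous_ee.continuousAt
  have hnn : ∀ t, 0 ≤ (H (ee t)).re := by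
    intro t
    rw [hHre _ (hmem t)]
    have := hre _ (hmem t)
    positivity
  have hM := mul_meas_ge_le_integral_of_nonneg (μ := volume.restrict (Set.Ico (0:ℝ) 1))
    (Filter.Eventually.of_forall hnn) hint (1 / 2)
  rw [havg] at hM
  have hsub : {t ∈ Set.Ico (0 : ℝ) 1 | K ≤ ‖∑ j, (1 - ζ j * ee t)⁻¹‖} ⊆
      {t | 1 / 2 ≤ (H (ee t)).re} ∩ Set.Ico 0 1 := by
    rintro t ⟨ht, htK⟩
    refine ⟨?_, ht⟩
    have h1 := hre _ (hmem t)
    have h2 : K ≤ ‖F (ee t)‖ := htK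
    simp only [Set.mem_ofPred_eq]
    rw [hHre _ (hmem t), div_le_div_iff₀ (by norm_num) (by positivity)]
    nlinarith
  have hfin : volume ({t | 1 / 2 ≤ (H (ee t)).re} ∩ Set.Ico 0 1) ≠ ⊤ :=
    ((measure_mono Set.inter_subset_right).trans_lt (by simp)).ne
  refine (measure_mono hsub).trans ?_
  rw [← ENNReal.ofReal_toReal hfin]
  refine ENNReal.ofReal_le_ofReal ?_
  rw [measureReal_def, Measure.restrict_apply' measurableSet_Ico] at hM
  have h5 : (Fintype.card ι : ℝ) / (Fintype.card ι + K) ≤ Fintype.card ι / K := by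
    gcongr; simp
  rw [mul_div_assoc]
  linarith

lemma volume_log_ratio_ge_le {ι : Type*} [Fintype ι] (ζ : ι → ℂ) (hζ : ∀ j, ‖ζ j‖ ≤ 1)
    {ρ K : ℝ} (h0 : 0 < ρ) (h1 : ρ < 1) (hK : 0 < K) :
    volume {t ∈ Set.Ico (0 : ℝ) 1 | K ≤ ∑ j, (Real.log ‖1 - ρ * ζ j * ee t‖ -
        Real.log ‖1 - ζ j * ee t‖ - Real.log ρ / 2)} ≤
      ENNReal.ofReal (Fintype.card ι * (-Real.log ρ) / (2 * K)) := by
  set L : ℝ → ℝ := fun t => ∑ j, (Real.log ‖1 - ρ * ζ j * ee t‖ -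
        Real.log ‖1 - ζ j * ee t‖ - Real.log ρ / 2) with hL
  have hi1 : ∀ j, IntegrableOn (fun t => Real.log ‖1 - ρ * ζ j * ee t‖) (Set.Ico (0:ℝ) 1) :=
    fun j => circleIntegrable_iff_ee _ (circleIntegrable_log_norm_one_sub_mul (ρ * ζ j))
  have hi2 : ∀ j, IntegrableOn (fun t => Real.log ‖1 - ζ j * ee t‖) (Set.Ico (0:ℝ) 1) :=
    fun j => circleIntegrable_iff_ee _ (circleIntegrable_log_norm_one_sub_mul (ζ j))
  have hi3 : ∀ j, IntegrableOn (fun t => Real.log ‖1 - ρ * ζ j * ee t‖ -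
        Real.log ‖1 - ζ j * ee t‖ - Real.log ρ / 2) (Set.Ico (0:ℝ) 1) := fun j =>
    ((hi1 j).sub (hi2 j)).sub (by simp)
  have hint : IntegrableOn L (Set.Ico 0 1) := integrable_finsetSum _ fun j _ => hi3 j
  have hval : ∫ t in Set.Ico (0:ℝ) 1, L t = Fintype.card ι * (-Real.log ρ) / 2 := by
    rw [hL, integral_finsetSum _ fun j _ => hi3 j]
    have : ∀ j, ∫ t in Set.Ico (0:ℝ) 1, (Real.log ‖1 - ρ * ζ j * ee t‖ -
        Real.log ‖1 - ζ j * ee t‖ - Real.log ρ / 2) = - Real.log ρ / 2 := by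
      intro j
      have hs : IntegrableOn (fun t => Real.log ‖1 - ρ * ζ j * ee t‖ -
        Real.log ‖1 - ζ j * ee t‖) (Set.Ico (0:ℝ) 1) := (hi1 j).sub (hi2 j)
      have hc : IntegrableOn (fun _ : ℝ => Real.log ρ / 2) (Set.Ico (0:ℝ) 1) := by simp
      rw [integral_sub hs hc, integral_sub (hi1 j) (hi2 j)]
      have h2 := circleAverage_log_norm_one_sub_mul (hζ j)
      have h3 : ‖(ρ : ℂ) * ζ j‖ ≤ 1 := by
        rw [norm_mul, Complex.norm_real, Real.norm_of_nonneg h0.le]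
        exact mul_le_one₀ h1.le (norm_nonneg _) (hζ j)
      have h4 := circleAverage_log_norm_one_sub_mul h3
      rw [circleAverage_eq_integral_ee] at h2 h4
      rw [h2, h4]
      simp
      ring
    simp_rw [this]
    simp
    ring
  have hae : ∀ᵐ t ∂(volume.restrict (Set.Ico (0:ℝ) 1)), 0 ≤ L t := by
    have hz : ∀ j, volume {t ∈ Set.Ico (0:ℝ) 1 | 1 - ζ j * ee t = 0} = 0 := by
      intro j
      refine Set.Subsingleton.measure_zero ?_ _
      rintro s ⟨hs, hs'⟩ t ⟨ht, ht'⟩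
      refine ee_inj_Ico hs ht ?_
      have : ζ j ≠ 0 := by
        rintro h; simp [h] at hs'
      exact mul_left_cancel₀ this (by linear_combination ht' - hs')
    have hz2 : ∀ᵐ t ∂volume, ∀ j, t ∉ {t ∈ Set.Ico (0:ℝ) 1 | 1 - ζ j * ee t = 0} :=
      ae_all_iff.2 fun j => measure_eq_zero_iff_ae_notMem.1 (hz j)
    rw [ae_restrict_iff' measurableSet_Ico]
    filter_upwards [hz2] with t ht htI
    refine Finset.sum_nonneg fun j _ => ?_
    have h2 : 1 - ζ j * ee t ≠ 0 := fun h => ht j ⟨htI, h⟩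
    have h3 : ‖ζ j * ee t‖ ≤ 1 := by rw [norm_mul, norm_ee, mul_one]; exact hζ j
    have h4 := norm_sq_one_sub_le h3 h0.le h1.le
    have h5 : 0 < ‖1 - ζ j * ee t‖ := norm_pos_iff.2 h2
    have h6 := Real.log_le_log (by positivity) h4
    rw [Real.log_mul h0.ne' (by positivity), Real.log_pow, Real.log_pow, ← mul_assoc] at h6
    push_cast at h6
    linarith
  have hM := mul_meas_ge_le_integral_of_nonneg hae hint K
  rw [hval] at hM
  have hfin : volume ({t | K ≤ L t} ∩ Set.Ico 0 1) ≠ ⊤ :=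
    ((measure_mono Set.inter_subset_right).trans_lt (by simp)).ne
  have hsub : {t ∈ Set.Ico (0 : ℝ) 1 | K ≤ L t} ⊆ {t | K ≤ L t} ∩ Set.Ico 0 1 :=
    fun t ht => ⟨ht.2, ht.1⟩
  refine (measure_mono hsub).trans ?_
  rw [← ENNReal.ofReal_toReal hfin]
  refine ENNReal.ofReal_le_ofReal ?_
  rw [measureReal_def, Measure.restrict_apply' measurableSet_Ico] at hM
  rw [le_div_iff₀ (by positivity)]
  linarith

lemma norm_one_add_sq_le (x : ℂ) : ‖1 + x‖ ^ 2 ≤ Real.exp (2 * x.re + ‖x‖ ^ 2) := by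
  have : ‖1 + x‖ ^ 2 = (2 * x.re + ‖x‖ ^ 2) + 1 := by
    rw [← Complex.normSq_eq_norm_sq, ← Complex.normSq_eq_norm_sq, Complex.normSq_apply,
      Complex.normSq_apply]
    simp
    ring
  rw [this]
  exact Real.add_one_le_exp _

/-- Pointwise comparison, on nearby points of the unit circle, of a product of linear factors
whose zeros all lie outside the closed unit disc. -/
lemma norm_prod_sq_le_of_norm_lt_one {ι : Type*} [Fintype ι] (ξ : ι → ℂ) {ρ : ℝ} (h1 : ρ < 1)
    (hξ : ∀ j, ‖ξ j‖ ≤ ρ) (t s : ℝ) :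
    ‖∏ j, (1 - ξ j * ee (t + s))‖ ^ 2 ≤
      Real.exp (2 * (2 * Real.pi * |s|) * (‖∑ j, (1 - ξ j * ee t)⁻¹‖ + Fintype.card ι) +
        (2 * Real.pi * |s|) ^ 2 * (2 * ‖∑ j, (1 - ξ j * ee t)⁻¹‖ / (1 - ρ))) *
      ‖∏ j, (1 - ξ j * ee t)‖ ^ 2 := by
  set f : ι → ℂ := fun j => (1 - ξ j * ee t)⁻¹ with hf
  set x : ι → ℂ := fun j => -(ee s - 1) * (f j - 1) with hx
  have hu : ∀ j, ‖ξ j * ee t‖ ≤ ρ := fun j => by rw [norm_mul, norm_ee, mul_one]; exact hξ j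
  have hne : ∀ j, 1 - ξ j * ee t ≠ 0 := by
    intro j h
    have := hu j
    rw [← sub_eq_zero.1 h, norm_one] at this
    linarith
  have hfac : ∀ j, 1 - ξ j * ee (t + s) = (1 + x j) * (1 - ξ j * ee t) := by
    intro j
    simp only [hx, hf, ee_add]
    field_simp [hne j]
    ring
  have hS2 : ∑ j, ‖f j - 1‖ ^ 2 ≤ 2 * ‖∑ j, f j‖ / (1 - ρ) := by
    rw [le_div_iff₀ (by linarith), Finset.sum_mul]
    calc ∑ j, ‖f j - 1‖ ^ 2 * (1 - ρ) ≤ ∑ j, 2 * (f j).re := by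
          refine Finset.sum_le_sum fun j _ => ?_
          have e1 : f j - 1 = (ξ j * ee t) * f j := by
            simp only [hf]; field_simp [hne j]; ring
          have e2 := re_inv_one_sub (hne j)
          have e3 : ‖f j - 1‖ ≤ ‖f j‖ := by
            rw [e1, norm_mul]
            exact mul_le_of_le_one_left (norm_nonneg _) ((hu j).trans h1.le)
          have e4 : ‖f j - 1‖ ^ 2 ≤ ‖f j‖ ^ 2 := by gcongr
          have e5 : 1 - ρ ≤ 1 - ‖ξ j * ee t‖ ^ 2 := by
            nlinarith [hu j, norm_nonneg (ξ j * ee t)]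
          calc ‖f j - 1‖ ^ 2 * (1 - ρ) ≤ ‖f j‖ ^ 2 * (1 - ‖ξ j * ee t‖ ^ 2) := by
                gcongr
            _ ≤ 2 * (f j).re := by simp only [hf]; linarith
      _ = 2 * (∑ j, f j).re := by rw [Complex.re_sum, Finset.mul_sum]
      _ ≤ 2 * ‖∑ j, f j‖ := by gcongr; exact Complex.re_le_norm _
  have hs := norm_ee_sub_one_le s
  have hre : ∑ j, (x j).re ≤ (2 * Real.pi * |s|) * (‖∑ j, f j‖ + Fintype.card ι) := by
    rw [← Complex.re_sum, ← Finset.mul_sum]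
    refine (Complex.re_le_norm _).trans ?_
    rw [norm_mul, norm_neg, Finset.sum_sub_distrib]
    gcongr
    refine (norm_sub_le _ _).trans ?_
    simp
  have hsq : ∑ j, ‖x j‖ ^ 2 ≤ (2 * Real.pi * |s|) ^ 2 * (2 * ‖∑ j, f j‖ / (1 - ρ)) := by
    simp only [hx, norm_mul, norm_neg, mul_pow]
    rw [← Finset.mul_sum, ← mul_pow, ← mul_pow]
    gcongr
  simp_rw [hfac]
  rw [Finset.prod_mul_distrib, norm_mul, mul_pow]
  gcongr
  rw [norm_prod, ← Finset.prod_pow]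
  calc ∏ j, ‖1 + x j‖ ^ 2 ≤ ∏ j, Real.exp (2 * (x j).re + ‖x j‖ ^ 2) :=
        Finset.prod_le_prod (fun j _ => by positivity) fun j _ => by
          exact norm_one_add_sq_le (x j)
    _ = Real.exp (2 * ∑ j, (x j).re + ∑ j, ‖x j‖ ^ 2) := by
        rw [← Real.exp_sum, Finset.sum_add_distrib, Finset.mul_sum]
    _ ≤ _ := by
        apply Real.exp_le_exp.2
        linarith

lemma neg_log_div_add_one_le {D : ℝ} (hD : 1 ≤ D) : -Real.log (D / (D + 1)) ≤ 1 / D := by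
  rw [← Real.log_inv, inv_div]
  have := Real.log_le_sub_one_of_pos (x := (D + 1) / D) (by positivity)
  have e : (D + 1) / D - 1 = 1 / D := by field_simp; ring
  linarith

/-- Off a set of small measure, a product of at most `D` linear factors without zeros in the open
unit disc is comparable on the arc of length `ρ₀ / D` around a point to its value at the point. -/
lemma exists_volume_prod_lt_le {ε ρ₀ : ℝ} (hε : 0 < ε) (hρ₀ : 0 < ρ₀) :
    ∃ A > (0 : ℝ), ∀ (ι : Type) [Fintype ι] (ζ : ι → ℂ) (_ : ∀ j, ‖ζ j‖ ≤ 1) (D : ℝ) (_ : 1 ≤ D)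
      (_ : (Fintype.card ι : ℝ) ≤ D),
      volume {t ∈ Set.Ico (0 : ℝ) 1 | ∃ s, |s| ≤ ρ₀ / D ∧
        A * ‖∏ j, (1 - ζ j * ee t)‖ < ‖∏ j, (1 - ζ j * ee (t + s))‖} ≤ ENNReal.ofReal ε := by
  set K₁ : ℝ := 4 / ε with hK₁
  set K₂ : ℝ := 1 / ε with hK₂
  have hK₁0 : 0 < K₁ := by positivity
  have hK₂0 : 0 < K₂ := by positivity
  set P : ℝ := 2 * Real.pi * ρ₀ with hP
  have hP0 : 0 < P := by positivity
  set E : ℝ := 2 * P * (K₁ + 1) + P ^ 2 * (4 * K₁) with hE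
  refine ⟨Real.exp ((1 + E + 2 * K₂) / 2), Real.exp_pos _, ?_⟩
  intro ι _ ζ hζ D hD hm
  set m : ℝ := (Fintype.card ι : ℝ) with hmdef
  have hm0 : 0 ≤ m := by positivity
  have hD0 : 0 < D := by linarith
  set ρ : ℝ := D / (D + 1) with hρ
  have hρ0 : 0 < ρ := by positivity
  have hρ1 : ρ < 1 := by rw [hρ, div_lt_one (by positivity)]; linarith
  have hρ2 : 1 - ρ = 1 / (D + 1) := by rw [hρ]; field_simp; ring
  have hlog0 : 0 ≤ -Real.log ρ := by
    have := Real.log_nonpos hρ0.le hρ1.le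
    linarith
  have hlog : m * (-Real.log ρ) ≤ 1 := by
    calc m * (-Real.log ρ) ≤ D * (1 / D) := by
          gcongr
          exact neg_log_div_add_one_le hD
      _ = 1 := by field_simp
  have hξ : ∀ j, ‖(ρ : ℂ) * ζ j‖ ≤ ρ := by
    intro j
    rw [norm_mul, Complex.norm_real, Real.norm_of_nonneg hρ0.le]
    exact mul_le_of_le_one_right hρ0.le (hζ j)
  have hB1 := volume_norm_sum_inv_ge_le (fun j => (ρ : ℂ) * ζ j) (fun j => (hξ j).trans_lt hρ1)
    (K := K₁ * D) (by positivity)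
  have hB2 := volume_log_ratio_ge_le ζ hζ hρ0 hρ1 hK₂0
  have hB3 : volume {t ∈ Set.Ico (0 : ℝ) 1 | ∃ j, 1 - ζ j * ee t = 0} = 0 := by
    have : {t ∈ Set.Ico (0 : ℝ) 1 | ∃ j, 1 - ζ j * ee t = 0} =
        ⋃ j, {t ∈ Set.Ico (0 : ℝ) 1 | 1 - ζ j * ee t = 0} := by
      ext t; simp
    rw [this, measure_iUnion_null_iff]
    intro j
    refine Set.Subsingleton.measure_zero ?_ _
    rintro s ⟨hs, hs'⟩ t ⟨ht, ht'⟩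
    refine ee_inj_Ico hs ht ?_
    have : ζ j ≠ 0 := by
      rintro h; simp [h] at hs'
    exact mul_left_cancel₀ this (by linear_combination ht' - hs')
  have hsub : {t ∈ Set.Ico (0 : ℝ) 1 | ∃ s, |s| ≤ ρ₀ / D ∧
        Real.exp ((1 + E + 2 * K₂) / 2) * ‖∏ j, (1 - ζ j * ee t)‖ <
          ‖∏ j, (1 - ζ j * ee (t + s))‖} ⊆
      ({t ∈ Set.Ico (0 : ℝ) 1 | K₁ * D ≤ ‖∑ j, (1 - (ρ : ℂ) * ζ j * ee t)⁻¹‖} ∪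
      {t ∈ Set.Ico (0 : ℝ) 1 | K₂ ≤ ∑ j, (Real.log ‖1 - ρ * ζ j * ee t‖ -
        Real.log ‖1 - ζ j * ee t‖ - Real.log ρ / 2)}) ∪
      {t ∈ Set.Ico (0 : ℝ) 1 | ∃ j, 1 - ζ j * ee t = 0} := by
    rintro t ⟨htI, s, hs, hlt⟩
    by_contra hcon
    simp only [Set.mem_union, Set.mem_ofPred_eq, not_or, not_and, not_le, not_exists] at hcon
    obtain ⟨⟨h1, h2⟩, h3⟩ := hcon
    replace h1 := h1 htI
    replace h2 := h2 htI
    replace h3 := h3 htI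
    refine absurd hlt (not_lt.2 ?_)
    set F : ℝ := ‖∑ j, (1 - (ρ : ℂ) * ζ j * ee t)⁻¹‖ with hF
    set σ : ℝ := 2 * Real.pi * |s| with hσ
    have hσ0 : 0 ≤ σ := by positivity
    have hσD : σ * D ≤ P := by
      rw [le_div_iff₀ hD0] at hs
      calc σ * D = 2 * Real.pi * (|s| * D) := by rw [hσ]; ring
        _ ≤ 2 * Real.pi * ρ₀ := by gcongr
    have hcmp := norm_prod_sq_le_of_norm_lt_one (fun j => (ρ : ℂ) * ζ j) hρ1 hξ t s
    have hexp : 2 * σ * (F + m) + σ ^ 2 * (2 * F / (1 - ρ)) ≤ E := by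
      have e1 : 2 * σ * (F + m) ≤ 2 * P * (K₁ + 1) := by
        calc 2 * σ * (F + m) ≤ 2 * σ * (K₁ * D + D) := by gcongr
          _ = 2 * (σ * D) * (K₁ + 1) := by ring
          _ ≤ _ := by gcongr
      have e2 : σ ^ 2 * (2 * F / (1 - ρ)) ≤ P ^ 2 * (4 * K₁) := by
        rw [hρ2, div_div_eq_mul_div, div_one]
        calc σ ^ 2 * (2 * F * (D + 1)) ≤ σ ^ 2 * (2 * (K₁ * D) * (D + D)) := by gcongr
          _ = (σ * D) ^ 2 * (4 * K₁) := by ring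
          _ ≤ _ := by gcongr
      linarith
    have hq1 : ρ ^ Fintype.card ι * ‖∏ j, (1 - ζ j * ee (t + s))‖ ^ 2 ≤
        ‖∏ j, (1 - (ρ : ℂ) * ζ j * ee (t + s))‖ ^ 2 := by
      rw [norm_prod, norm_prod, ← Finset.prod_pow, ← Finset.prod_pow, ← Finset.card_univ,
        ← Finset.prod_const, ← Finset.prod_mul_distrib]
      refine Finset.prod_le_prod (fun j _ => by positivity) fun j _ => ?_
      have := norm_sq_one_sub_le (u := ζ j * ee (t + s))
        (by rw [norm_mul, norm_ee, mul_one]; exact hζ j) hρ0.le hρ1.le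
      rwa [← mul_assoc] at this
    have hρm : Real.exp (-1) ≤ ρ ^ Fintype.card ι := by
      rw [← Real.exp_log (pow_pos hρ0 _), Real.log_pow]
      apply Real.exp_le_exp.2
      linarith
    have hq2 : ‖∏ j, (1 - (ρ : ℂ) * ζ j * ee t)‖ ≤ Real.exp K₂ * ‖∏ j, (1 - ζ j * ee t)‖ := by
      have hp : ∀ j, 0 < ‖1 - ζ j * ee t‖ := fun j => norm_pos_iff.2 (h3 j)
      have hp' : ∀ j, 0 < ‖1 - (ρ : ℂ) * ζ j * ee t‖ := by
        intro j
        have := norm_sq_one_sub_le (u := ζ j * ee t)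
          (by rw [norm_mul, norm_ee, mul_one]; exact hζ j) hρ0.le hρ1.le
        rw [← mul_assoc] at this
        have h4 : 0 < ‖1 - (ρ : ℂ) * ζ j * ee t‖ ^ 2 :=
          lt_of_lt_of_le (mul_pos hρ0 (pow_pos (hp j) 2)) this
        exact (norm_nonneg _).lt_of_ne fun h => by simp [← h] at h4
      rw [norm_prod, norm_prod, ← Real.exp_log (Finset.prod_pos fun j _ => hp j),
        ← Real.exp_log (Finset.prod_pos fun j _ => hp' j), ← Real.exp_add]
      apply Real.exp_le_exp.2
      rw [Real.log_prod fun j _ => (hp j).ne', Real.log_prod fun j _ => (hp' j).ne']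
      rw [Finset.sum_sub_distrib, Finset.sum_sub_distrib, Finset.sum_const, Finset.card_univ,
        nsmul_eq_mul] at h2
      have : (Fintype.card ι : ℝ) * (Real.log ρ / 2) ≤ 0 := by
        apply mul_nonpos_of_nonneg_of_nonpos hm0
        linarith
      linarith
    refine le_of_sq_le_sq ?_ (by positivity)
    have hfin : Real.exp (-1) * ‖∏ j, (1 - ζ j * ee (t + s))‖ ^ 2 ≤
        Real.exp E * (Real.exp K₂ * ‖∏ j, (1 - ζ j * ee t)‖) ^ 2 := by
      calc _ ≤ ρ ^ Fintype.card ι * ‖∏ j, (1 - ζ j * ee (t + s))‖ ^ 2 := by gcongr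
        _ ≤ _ := hq1
        _ ≤ _ := hcmp
        _ ≤ _ := by gcongr
    calc ‖∏ j, (1 - ζ j * ee (t + s))‖ ^ 2
        = Real.exp 1 * (Real.exp (-1) * ‖∏ j, (1 - ζ j * ee (t + s))‖ ^ 2) := by
          rw [← mul_assoc, ← Real.exp_add]; simp
      _ ≤ Real.exp 1 * (Real.exp E * (Real.exp K₂ * ‖∏ j, (1 - ζ j * ee t)‖) ^ 2) := by gcongr
      _ = (Real.exp ((1 + E + 2 * K₂) / 2) * ‖∏ j, (1 - ζ j * ee t)‖) ^ 2 := by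
          rw [mul_pow, mul_pow, ← Real.exp_nat_mul, ← Real.exp_nat_mul]
          rw [← mul_assoc, ← mul_assoc, ← Real.exp_add, ← Real.exp_add]
          congr 2
          push_cast
          ring
  refine (measure_mono hsub).trans ((measure_union_le _ _).trans ?_)
  rw [hB3, add_zero]
  refine (measure_union_le _ _).trans ?_
  refine (add_le_add hB1 hB2).trans ?_
  rw [← ENNReal.ofReal_add (by positivity) (by positivity)]
  refine ENNReal.ofReal_le_ofReal ?_
  have e1 : 2 * m / (K₁ * D) ≤ ε / 2 := by
    rw [div_le_iff₀ (by positivity), hK₁]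
    have : ε / 2 * (4 / ε * D) = 2 * D := by field_simp; ring
    linarith
  have e2 : m * (-Real.log ρ) / (2 * K₂) ≤ ε / 2 := by
    rw [div_le_iff₀ (by positivity), hK₂]
    have : ε / 2 * (2 * (1 / ε)) = 1 := by field_simp
    linarith
  linarith

lemma exists_norm_sub_eq (z : ℂ) : ∃ c : ℝ, 0 ≤ c ∧ ∃ ζ : ℂ, ‖ζ‖ ≤ 1 ∧
    ∀ w : ℂ, ‖w‖ = 1 → ‖w - z‖ = c * ‖1 - ζ * w‖ := by
  rcases le_or_gt ‖z‖ 1 with hz | hz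
  · refine ⟨1, zero_le_one, starRingEnd ℂ z, by simpa using hz, fun w hw => ?_⟩
    have h1 : (starRingEnd ℂ w) * w = 1 := by
      rw [mul_comm, Complex.mul_conj, Complex.normSq_eq_norm_sq, hw]; simp
    have h2 : 1 - starRingEnd ℂ z * w = starRingEnd ℂ (w - z) * w := by
      rw [map_sub, sub_mul, h1]
    rw [h2, norm_mul, hw, RCLike.norm_conj]; ring
  · have h0 : z ≠ 0 := by rintro rfl; simp at hz; linarith
    refine ⟨‖z‖, norm_nonneg _, z⁻¹, ?_, fun w _ => ?_⟩
    · rw [norm_inv]; exact inv_le_one_of_one_le₀ hz.le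
    · rw [← norm_mul, mul_sub, mul_inv_cancel_left₀ h0, mul_one, norm_sub_rev]

lemma Polynomial.exists_norm_eval_eq_prod (g : Polynomial ℂ) : ∃ (m : ℕ) (_ : m ≤ g.natDegree)
    (c : ℝ) (_ : 0 ≤ c) (ζ : Fin m → ℂ) (_ : ∀ j, ‖ζ j‖ ≤ 1),
    ∀ w : ℂ, ‖w‖ = 1 → ‖g.eval w‖ = c * ‖∏ j, (1 - ζ j * w)‖ := by
  choose c hc ζ hζ h using exists_norm_sub_eq
  have hlen : g.roots.toList.length ≤ g.natDegree := by
    simpa using g.card_roots'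
  refine ⟨g.roots.toList.length, hlen, ‖g.leadingCoeff‖ * ∏ j, c (g.roots.toList.get j), ?_,
    fun j => ζ (g.roots.toList.get j), fun j => hζ _, fun w hw => ?_⟩
  · exact mul_nonneg (norm_nonneg _) (Finset.prod_nonneg fun j _ => hc _)
  · have h1 := (IsAlgClosed.splits g).eval_eq_prod_roots w
    have h2 : (g.roots.map fun a => w - a).prod = ∏ j, (w - g.roots.toList.get j) := by
      conv_lhs => rw [← Multiset.coe_toList g.roots, Multiset.map_coe, Multiset.prod_coe]
      simp [← Fin.prod_univ_fun_getElem]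
    rw [h1, h2, norm_mul, norm_prod, norm_prod, mul_assoc, ← Finset.prod_mul_distrib]
    simp_rw [h _ w hw]

lemma exists_volume_polynomial_lt_le {ε ρ₀ : ℝ} (hε : 0 < ε) (hρ₀ : 0 < ρ₀) :
    ∃ A > (0 : ℝ), ∀ (g : Polynomial ℂ) (D : ℝ) (_ : 1 ≤ D) (_ : (g.natDegree : ℝ) ≤ D),
      volume {t ∈ Set.Ico (0 : ℝ) 1 | ∃ s, |s| ≤ ρ₀ / D ∧
        A * ‖g.eval (ee t)‖ < ‖g.eval (ee (t + s))‖} ≤ ENNReal.ofReal ε := by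
  obtain ⟨A, hA, h⟩ := exists_volume_prod_lt_le hε hρ₀
  refine ⟨A, hA, fun g D hD hg => ?_⟩
  obtain ⟨m, hm, c, hc, ζ, hζ, hgm⟩ := g.exists_norm_eval_eq_prod
  have hmD : (Fintype.card (Fin m) : ℝ) ≤ D := by
    rw [Fintype.card_fin]
    exact le_trans (by exact_mod_cast hm) hg
  refine (measure_mono ?_).trans (h (Fin m) ζ hζ D hD hmD)
  rintro t ⟨ht, s, hs, hlt⟩
  refine ⟨ht, s, hs, ?_⟩
  rw [hgm _ (norm_ee _), hgm _ (norm_ee _), mul_left_comm] at hlt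
  exact lt_of_mul_lt_mul_left hlt hc

lemma ee_int_mul (k : ℤ) (t : ℝ) : ee (k * t) = ee t ^ k := by
  rw [ee, ee, ← Complex.exp_int_mul]
  congr 1
  push_cast
  ring

/-- A trigonometric polynomial in one variable agrees in absolute value with a polynomial on the
unit circle. -/
lemma exists_polynomial_norm_eval_ee {ι : Type*} (s : Finset ι) (b : ι → ℂ) (k : ι → ℤ) (d : ℕ)
    (hk : ∀ j ∈ s, |k j| ≤ d) : ∃ g : Polynomial ℂ, g.natDegree ≤ 2 * d ∧
      ∀ t : ℝ, ‖∑ j ∈ s, b j * ee (k j * t)‖ = ‖g.eval (ee t)‖ := by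
  refine ⟨∑ j ∈ s, Polynomial.C (b j) * Polynomial.X ^ (k j + d).toNat, ?_, fun t => ?_⟩
  · refine Polynomial.natDegree_sum_le_of_forall_le _ _ fun j hj => ?_
    refine (Polynomial.natDegree_C_mul_X_pow_le _ _).trans ?_
    have := abs_le.1 (hk j hj)
    omega
  · have : (∑ j ∈ s, Polynomial.C (b j) * Polynomial.X ^ (k j + d).toNat).eval (ee t) =
        ee t ^ d * ∑ j ∈ s, b j * ee (k j * t) := by
      rw [Polynomial.eval_finsetSum, Finset.mul_sum]
      refine Finset.sum_congr rfl fun j hj => ?_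
      have h0 := abs_le.1 (hk j hj)
      have h1 : (((k j + d).toNat : ℕ) : ℤ) = k j + d := Int.toNat_of_nonneg (by omega)
      rw [Polynomial.eval_mul, Polynomial.eval_C, Polynomial.eval_pow, Polynomial.eval_X,
        ee_int_mul, ← zpow_natCast, ← zpow_natCast, h1, zpow_add₀ (ee_ne_zero t)]
      ring
    rw [this, norm_mul, norm_pow, norm_ee, one_pow, one_mul]

lemma exists_volume_trig_lt_le {ε ρ₀ : ℝ} (hε : 0 < ε) (hρ₀ : 0 < ρ₀) :
    ∃ A > (0 : ℝ), ∀ {ι : Type} (s : Finset ι) (b : ι → ℂ) (k : ι → ℤ) (d : ℕ) (_ : 1 ≤ d)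
      (_ : ∀ j ∈ s, |k j| ≤ d),
      volume {t ∈ Set.Ico (0 : ℝ) 1 | ∃ σ, |σ| ≤ ρ₀ / d ∧
        A * ‖∑ j ∈ s, b j * ee (k j * t)‖ < ‖∑ j ∈ s, b j * ee (k j * (t + σ))‖} ≤
          ENNReal.ofReal ε := by
  obtain ⟨A, hA, h⟩ := exists_volume_polynomial_lt_le hε (mul_pos two_pos hρ₀)
  refine ⟨A, hA, fun s b k d hd hk => ?_⟩
  obtain ⟨g, hg, hgs⟩ := exists_polynomial_norm_eval_ee s b k d hk
  have hd' : (1 : ℝ) ≤ d := by exact_mod_cast hd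
  have := h g (2 * d) (by linarith) (by exact_mod_cast hg)
  rw [mul_div_mul_left _ _ two_ne_zero] at this
  simpa only [hgs] using this

lemma encard_zeros_trig_le {ι : Type*} (s : Finset ι) (b : ι → ℂ) (k : ι → ℤ) (d : ℕ)
    (hk : ∀ j ∈ s, |k j| ≤ d) (hne : ∃ t : ℝ, ∑ j ∈ s, b j * ee (k j * t) ≠ 0) :
    {t ∈ Set.Ico (0 : ℝ) 1 | ∑ j ∈ s, b j * ee (k j * t) = 0}.encard ≤ 2 * d := by
  obtain ⟨g, hg, hgs⟩ := exists_polynomial_norm_eval_ee s b k d hk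
  have hz : ∀ t : ℝ, ∑ j ∈ s, b j * ee (k j * t) = 0 ↔ g.eval (ee t) = 0 := fun t => by
    rw [← norm_eq_zero, hgs, norm_eq_zero]
  obtain ⟨t₀, ht₀⟩ := hne
  have hg0 : g ≠ 0 := by
    rintro rfl
    exact ht₀ ((hz t₀).2 (by simp))
  have h1 : {t ∈ Set.Ico (0 : ℝ) 1 | ∑ j ∈ s, b j * ee (k j * t) = 0}.encard ≤
      (g.roots.toFinset : Set ℂ).encard := by
    refine Set.encard_le_encard_of_injOn (f := ee) ?_ fun x hx y hy h => ee_inj_Ico hx.1 hy.1 h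
    rintro t ⟨_, ht⟩
    simpa [hg0] using (hz t).1 ht
  refine h1.trans ?_
  rw [Set.encard_coe_eq_coe_finsetCard]
  exact_mod_cast (Multiset.toFinset_card_le _).trans (g.card_roots'.trans hg)

/-- The half-open unit cube in coordinate space. -/
def unitCube (n : ℕ) : Set (Fin n → ℝ) := Set.univ.pi fun _ => Set.Ico (0 : ℝ) 1

lemma measurableSet_unitCube (n : ℕ) : MeasurableSet (unitCube n) :=
  MeasurableSet.univ_pi fun _ => measurableSet_Ico

lemma volume_unitCube (n : ℕ) : volume (unitCube n) = 1 := by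
  simp [unitCube, Real.volume_pi_Ico]

/-- Invariance under translation by integer vectors, in coordinate space. -/
def PiPeriodic {n : ℕ} {E : Type*} (F : (Fin n → ℝ) → E) : Prop :=
  ∀ (x : Fin n → ℝ) (k : Fin n → ℤ), F (x + fun i => (k i : ℝ)) = F x

/-- The function on the torus induced by a periodic function. -/
noncomputable def torusLift {n : ℕ} {E : Type*} (F : (Fin n → ℝ) → E) (y : UnitAddTorus (Fin n)) : E :=
  F fun i => (y i).out

lemma PiPeriodic.torusLift_coe {n : ℕ} {E : Type*} {F : (Fin n → ℝ) → E} (hF : PiPeriodic F)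
    (x : Fin n → ℝ) : torusLift F (fun i => (x i : UnitAddCircle)) = F x := by
  have : ∀ i, ∃ k : ℤ, ((x i : UnitAddCircle)).out = x i + k := by
    intro i
    have h : (((x i : UnitAddCircle)).out : UnitAddCircle) = (x i : UnitAddCircle) :=
      Quotient.out_eq _
    rw [← sub_eq_zero, ← AddCircle.coe_sub, AddCircle.coe_eq_zero_iff] at h
    obtain ⟨k, hk⟩ := h
    refine ⟨k, ?_⟩
    rw [zsmul_one] at hk
    linarith
  choose k hk using this
  rw [torusLift, ← hF x k]
  congr 1
  ext i
  exact hk i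

lemma ae_eq_unitCube (n : ℕ) :
    ({x : Fin n → ℝ | ∀ i, x i ∈ Set.Ioc ((0 : Fin n → ℝ) i) ((0 : Fin n → ℝ) i + 1)} : Set _)
      =ᵐ[volume] unitCube n := by
  have e1 : ({x : Fin n → ℝ | ∀ i, x i ∈ Set.Ioc ((0 : Fin n → ℝ) i) ((0 : Fin n → ℝ) i + 1)} : Set _)
      = Set.univ.pi fun i => Set.Ioc ((0 : Fin n → ℝ) i) ((1 : Fin n → ℝ) i) := by
    ext x; simp
  rw [e1]
  exact Measure.univ_pi_Ioc_ae_eq_Icc.trans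
    (Measure.univ_pi_Ico_ae_eq_Icc (f := (0 : Fin n → ℝ)) (g := 1)).symm

lemma preimage_add_Ioc_cube {n : ℕ} (h : Fin n → ℝ) :
    (fun x => x + h) ⁻¹' {x : Fin n → ℝ | ∀ i, x i ∈ Set.Ioc (h i) (h i + 1)} =
      {x : Fin n → ℝ | ∀ i, x i ∈ Set.Ioc ((0 : Fin n → ℝ) i) ((0 : Fin n → ℝ) i + 1)} := by
  ext x
  simp only [Set.mem_preimage, Set.mem_ofPred_eq, Set.mem_Ioc, Pi.add_apply, Pi.zero_apply]
  refine forall_congr' fun i => ⟨fun H => ⟨?_, ?_⟩, fun H => ⟨?_, ?_⟩⟩ <;> linarith [H.1, H.2]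

lemma PiPeriodic.setLIntegral_add {n : ℕ} {F : (Fin n → ℝ) → ℝ≥0∞} (hF : PiPeriodic F)
    (h : Fin n → ℝ) : ∫⁻ x in unitCube n, F (x + h) = ∫⁻ x in unitCube n, F x := by
  have h1 := (UnitAddTorus.lintegral_preimage (torusLift F) h).symm.trans
    (UnitAddTorus.lintegral_preimage (torusLift F) 0)
  simp only [hF.torusLift_coe] at h1
  rw [setLIntegral_congr (ae_eq_unitCube n)] at h1
  rw [← h1, ← setLIntegral_congr (ae_eq_unitCube n), ← preimage_add_Ioc_cube h]
  exact (measurePreserving_add_right volume h).setLIntegral_comp_preimage_emb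
    (MeasurableEquiv.addRight h).measurableEmbedding F _

lemma PiPeriodic.setIntegral_add {n : ℕ} {E : Type*} [NormedAddCommGroup E] [NormedSpace ℝ E]
    {F : (Fin n → ℝ) → E} (hF : PiPeriodic F)
    (h : Fin n → ℝ) : ∫ x in unitCube n, F (x + h) = ∫ x in unitCube n, F x := by
  have h1 := (UnitAddTorus.integral_preimage (torusLift F) h).symm.trans
    (UnitAddTorus.integral_preimage (torusLift F) 0)
  simp only [hF.torusLift_coe] at h1
  rw [setIntegral_congr_set (ae_eq_unitCube n)] at h1
  rw [← h1, ← setIntegral_congr_set (ae_eq_unitCube n), ← preimage_add_Ioc_cube h]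
  exact (measurePreserving_add_right volume h).setIntegral_preimage_emb
    (MeasurableEquiv.addRight h).measurableEmbedding F _

lemma PiPeriodic.continuous_torusLift {n : ℕ} {E : Type*} [TopologicalSpace E]
    {F : (Fin n → ℝ) → E} (hF : PiPeriodic F) (hc : Continuous F) : Continuous (torusLift F) := by
  have hq : IsOpenQuotientMap (fun (x : Fin n → ℝ) (i : Fin n) => (x i : UnitAddCircle)) :=
    IsOpenQuotientMap.piMap fun i => QuotientAddGroup.isOpenQuotientMap_mk
  rw [hq.isQuotientMap.continuous_iff]
  convert hc using 1
  ext x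
  exact hF.torusLift_coe x

lemma unitCube_subset_Icc (n : ℕ) : unitCube n ⊆ Set.Icc 0 1 := fun _ hx =>
  ⟨fun i => (hx i trivial).1, fun i => (hx i trivial).2.le⟩

lemma Continuous.integrableOn_unitCube {n : ℕ} {E : Type*} [NormedAddCommGroup E]
    {F : (Fin n → ℝ) → E} (hF : Continuous F) : IntegrableOn F (unitCube n) :=
  (hF.continuousOn.integrableOn_compact isCompact_Icc).mono_set (unitCube_subset_Icc n)

/-- The partial derivative along the `i`-th coordinate. -/
noncomputable def pd {n : ℕ} {E : Type*} [NormedAddCommGroup E] [NormedSpace ℝ E] (i : Fin n)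
    (F : (Fin n → ℝ) → E) (x : Fin n → ℝ) : E := fderiv ℝ F x (Pi.single i 1)

lemma ContDiff.continuous_pd {n : ℕ} {E : Type*} [NormedAddCommGroup E] [NormedSpace ℝ E]
    {F : (Fin n → ℝ) → E} (hF : ContDiff ℝ 1 F) (i : Fin n) : Continuous (pd i F) :=
  (hF.continuous_fderiv one_ne_zero).clm_apply continuous_const

lemma ContDiff.hasDerivAt_add_single {n : ℕ} {E : Type*} [NormedAddCommGroup E] [NormedSpace ℝ E]
    {F : (Fin n → ℝ) → E} (hF : ContDiff ℝ 1 F) (i : Fin n) (x : Fin n → ℝ) (s : ℝ) :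
    HasDerivAt (fun s : ℝ => F (x + s • Pi.single i 1)) (pd i F (x + s • Pi.single i 1)) s := by
  have h1 : HasDerivAt (fun s : ℝ => x + s • (Pi.single i 1 : Fin n → ℝ)) (Pi.single i 1) s := by
    simpa using ((hasDerivAt_id s).smul_const (Pi.single i 1 : Fin n → ℝ)).const_add x
  exact (hF.differentiable one_ne_zero _).hasFDerivAt.comp_hasDerivAt s h1

lemma PiPeriodic.integral_pd_eq_zero {n : ℕ} {F : (Fin n → ℝ) → ℂ} (hF : PiPeriodic F)
    (hd : ContDiff ℝ 1 F) (i : Fin n) : ∫ x in unitCube n, pd i F x = 0 := by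
  have hc : Continuous (fun p : (Fin n → ℝ) × ℝ => pd i F (p.1 + p.2 • Pi.single i 1)) :=
    (hd.continuous_pd i).comp (by fun_prop)
  obtain ⟨B, hB⟩ := ((isCompact_Icc (a := (0 : Fin n → ℝ)) (b := 1)).prod
    (isCompact_Icc (a := (-1:ℝ)) (b := 1))).exists_bound_of_continuousOn hc.continuousOn
  have key := hasDerivAt_integral_of_dominated_loc_of_deriv_le
    (μ := volume.restrict (unitCube n)) (x₀ := (0:ℝ)) (s := Metric.ball 0 1) (bound := fun _ => B)
    (F := fun s x => F (x + s • Pi.single i 1))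
    (F' := fun s x => pd i F (x + s • Pi.single i 1))
    (Metric.ball_mem_nhds _ one_pos)
    (Filter.Eventually.of_forall fun s =>
      (hd.continuous.comp (by fun_prop : Continuous fun x : Fin n → ℝ =>
        x + s • (Pi.single i 1 : Fin n → ℝ))).aestronglyMeasurable)
    (Continuous.integrableOn_unitCube (hd.continuous.comp (by fun_prop)))
    (by
      simp only [zero_smul, add_zero]
      exact (hd.continuous_pd i).aestronglyMeasurable)
    ((ae_restrict_iff' (measurableSet_unitCube n)).2 (Filter.Eventually.of_forall
      fun x hx s hs => by
        rw [Metric.mem_ball, dist_zero_right, Real.norm_eq_abs, abs_lt] at hs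
        exact hB (x, s) ⟨unitCube_subset_Icc n hx, ⟨hs.1.le, hs.2.le⟩⟩))
    (by
      refine integrableOn_const (hs := ?_)
      simp [volume_unitCube])
    (Filter.Eventually.of_forall fun x s _ => hd.hasDerivAt_add_single i x s)
  have h2 := key.2
  simp only [hF.setIntegral_add, zero_smul, add_zero] at h2
  exact h2.unique (hasDerivAt_const _ _)

/-- The pairing of an integer frequency with a point. -/
noncomputable def freq {n : ℕ} (k : Fin n → ℤ) (x : Fin n → ℝ) : ℝ := ∑ i, k i * x i

lemma contDiff_ee : ContDiff ℝ (⊤ : ℕ∞) ee := by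
  unfold ee
  have : ContDiff ℝ (⊤ : ℕ∞) (fun t : ℝ => (t : ℂ)) := Complex.ofRealCLM.contDiff
  fun_prop

lemma hasDerivAt_ee (t : ℝ) : HasDerivAt ee (2 * Real.pi * Complex.I * ee t) t := by
  have h1 : HasDerivAt (fun t : ℝ => 2 * Real.pi * (t : ℂ) * Complex.I)
      (2 * Real.pi * Complex.I) t := by
    simpa using ((Complex.ofRealCLM.hasDerivAt (x := t)).const_mul (2 * Real.pi : ℂ)).mul_const
      Complex.I
  have := h1.cexp
  have e : 2 * Real.pi * Complex.I * ee t =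
      Complex.exp (2 * Real.pi * t * Complex.I) * (2 * Real.pi * Complex.I) := mul_comm _ _
  rw [e]
  exact this

lemma contDiff_freq {n : ℕ} (k : Fin n → ℤ) : ContDiff ℝ (⊤ : ℕ∞) (freq k) := by
  unfold freq; fun_prop

lemma freq_add {n : ℕ} (k : Fin n → ℤ) (x y : Fin n → ℝ) : freq k (x + y) = freq k x + freq k y := by
  simp [freq, mul_add, Finset.sum_add_distrib]

lemma freq_smul_single {n : ℕ} (k : Fin n → ℤ) (s : ℝ) (i : Fin n) :
    freq k (s • Pi.single i 1) = k i * s := by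
  simp [freq, Pi.single_apply]

lemma ee_intCast (k : ℤ) : ee k = 1 := by
  have := ee_int_mul k 1
  rw [mul_one] at this
  rw [this]
  simp [ee]

lemma ee_freq_int {n : ℕ} (k m : Fin n → ℤ) : ee (freq k fun i => (m i : ℝ)) = 1 := by
  have : freq k (fun i => (m i : ℝ)) = ((∑ i, k i * m i : ℤ) : ℝ) := by simp [freq]
  rw [this, ee_intCast]

lemma piPeriodic_ee_freq {n : ℕ} (k : Fin n → ℤ) : PiPeriodic fun x => ee (freq k x) := fun x m => by
  simp only [freq_add, ee_add, ee_freq_int, mul_one]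

lemma pd_ee_freq {n : ℕ} (k : Fin n → ℤ) (i : Fin n) (x : Fin n → ℝ) :
    pd i (fun x => ee (freq k x)) x = 2 * Real.pi * Complex.I * k i * ee (freq k x) := by
  have h : ContDiff ℝ 1 (fun x => ee (freq k x)) :=
    (contDiff_ee.comp (contDiff_freq k)).of_le (by exact_mod_cast le_top)
  have h1 := h.hasDerivAt_add_single i x 0
  simp only [freq_add, freq_smul_single, zero_smul, add_zero] at h1
  have h2 : HasDerivAt (fun s : ℝ => ee (freq k x + k i * s))
      ((k i : ℝ) • (2 * Real.pi * Complex.I * ee (freq k x + k i * 0))) 0 := by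
    refine HasDerivAt.scomp (h := fun s : ℝ => freq k x + k i * s) (0:ℝ) (hasDerivAt_ee _) ?_
    simpa using ((hasDerivAt_id (0:ℝ)).const_mul (k i : ℝ)).const_add (freq k x)
  rw [h1.unique h2, mul_zero, add_zero, Complex.real_smul]
  push_cast
  ring

lemma pd_mul {n : ℕ} (i : Fin n) {F G : (Fin n → ℝ) → ℂ} {x : Fin n → ℝ}
    (hF : DifferentiableAt ℝ F x) (hG : DifferentiableAt ℝ G x) :
    pd i (fun x => F x * G x) x = pd i F x * G x + F x * pd i G x := by
  simp only [pd]
  rw [fderiv_fun_mul hF hG]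
  simp
  ring

lemma PiPeriodic.integral_ee_mul_pd {n : ℕ} {F : (Fin n → ℝ) → ℂ} (hF : PiPeriodic F)
    (hd : ContDiff ℝ 1 F) (i : Fin n) (k : Fin n → ℤ) :
    ∫ x in unitCube n, ee (freq k x) * pd i F x =
      -(2 * Real.pi * Complex.I * k i) * ∫ x in unitCube n, ee (freq k x) * F x := by
  have h : ContDiff ℝ 1 (fun x => ee (freq k x)) :=
    (contDiff_ee.comp (contDiff_freq k)).of_le (by exact_mod_cast le_top)
  have hp : PiPeriodic (fun x => ee (freq k x) * F x) := fun x m => by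
    have := piPeriodic_ee_freq k x m
    simp only at this ⊢
    rw [this, hF]
  have h0 := hp.integral_pd_eq_zero (h.mul hd) i
  have h1 : ∀ x, pd i (fun x => ee (freq k x) * F x) x =
      (2 * Real.pi * Complex.I * k i) * (ee (freq k x) * F x) + ee (freq k x) * pd i F x := by
    intro x
    rw [pd_mul i (h.differentiable one_ne_zero x) (hd.differentiable one_ne_zero x), pd_ee_freq]
    ring
  simp only [h1] at h0
  rw [integral_add, integral_const_mul] at h0
  · linear_combination h0
  · exact (continuous_const.mul (h.continuous.mul hd.continuous)).integrableOn_unitCube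
  · exact (h.continuous.mul (hd.continuous_pd i)).integrableOn_unitCube

lemma PiPeriodic.partialDeriv {n : ℕ} {F : (Fin n → ℝ) → ℂ} (hF : PiPeriodic F) (i : Fin n) :
    PiPeriodic (pd i F) := fun x k => by
  have : (fun x => F (x + fun i => (k i : ℝ))) = F := funext fun x => hF x k
  simp only [pd]
  conv_rhs => rw [← this]
  rw [fderiv_comp_add_right]

/-- A trigonometric polynomial on coordinate space. -/
noncomputable def trig {n : ℕ} {ι : Type*} (s : Finset ι) (κ : ι → Fin n → ℤ) (a : ι → ℂ)
    (x : Fin n → ℝ) : ℂ := ∑ j ∈ s, a j * ee (freq (κ j) x)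

lemma mFourier_coe_eq {n : ℕ} (k : Fin n → ℤ) (x : Fin n → ℝ) :
    UnitAddTorus.mFourier k (fun i => (x i : UnitAddCircle)) = ee (freq k x) := by
  simp only [UnitAddTorus.mFourier, ContinuousMap.coe_mk, fourier_coe_apply, freq, ee]
  rw [← Complex.exp_sum]
  congr 1
  push_cast
  rw [Finset.mul_sum, Finset.sum_mul]
  refine Finset.sum_congr rfl fun i _ => ?_
  simp
  ring

lemma finite_freq (n : ℕ) (B : ℝ) :
    {k : Fin n → ℤ | ∑ i, (k i : ℝ) ^ 2 ≤ B}.Finite := by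
  refine (Set.finite_Icc (fun _ : Fin n => -⌈B⌉) (fun _ => ⌈B⌉)).subset fun k hk => ?_
  have h : ∀ i, |k i| ≤ ⌈B⌉ := by
    intro i
    have h1 : (k i : ℝ) ^ 2 ≤ B :=
      (Finset.single_le_sum (f := fun i => (k i : ℝ) ^ 2) (fun i _ => sq_nonneg _)
        (Finset.mem_univ i)).trans hk
    have h2 : |k i| ≤ (k i) ^ 2 := by
      rw [← sq_abs]
      nlinarith [abs_nonneg (k i), Int.le_self_sq (|k i|)]
    have h3 : ((|k i| : ℤ) : ℝ) ≤ ⌈B⌉ := by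
      calc ((|k i| : ℤ) : ℝ) ≤ ((k i ^ 2 : ℤ) : ℝ) := by exact_mod_cast h2
        _ ≤ B := by push_cast; exact h1
        _ ≤ _ := Int.le_ceil B
    exact_mod_cast h3
  exact ⟨fun i => (abs_le.1 (h i)).1, fun i => (abs_le.1 (h i)).2⟩

/-- A smooth periodic eigenfunction of the Laplacian is a trigonometric polynomial. -/
lemma PiPeriodic.exists_eq_trig {n : ℕ} {F : (Fin n → ℝ) → ℂ} (hF : PiPeriodic F)
    (hd : ContDiff ℝ 2 F) {lam : ℝ} (he : ∀ x, ∑ i, pd i (pd i F) x = -lam ^ 2 * F x) :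
    ∃ (s : Finset (Fin n → ℤ)) (a : (Fin n → ℤ) → ℂ),
      (∀ k ∈ s, 4 * Real.pi ^ 2 * ∑ i, (k i : ℝ) ^ 2 = lam ^ 2) ∧
      ∀ x, F x = trig s id a x := by
  have hd1 : ContDiff ℝ 1 F := hd.of_le (by norm_num)
  have hpd : ∀ i, ContDiff ℝ 1 (pd i F) := fun i =>
    (hd.fderiv_right (m := 1) (by norm_num)).clm_apply contDiff_const
  set c : (Fin n → ℤ) → ℂ := fun k => ∫ x in unitCube n, ee (freq (-k) x) * F x with hc
  have hck : ∀ k : Fin n → ℤ, 4 * Real.pi ^ 2 * ∑ i, (k i : ℝ) ^ 2 ≠ lam ^ 2 → c k = 0 := by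
    intro k hk
    have h1 : ∫ x in unitCube n, ee (freq (-k) x) * ∑ i, pd i (pd i F) x =
        (∑ i, (2 * Real.pi * Complex.I * (-k) i) ^ 2) * c k := by
      simp_rw [Finset.mul_sum]
      rw [integral_finsetSum, Finset.sum_mul]
      · refine Finset.sum_congr rfl fun i _ => ?_
        rw [(hF.partialDeriv i).integral_ee_mul_pd (hpd i), hF.integral_ee_mul_pd hd1]
        simp only [hc]
        ring
      · exact fun i _ => ((continuous_ee.comp (contDiff_freq _).continuous).mul
          ((hpd i).continuous_pd i)).integrableOn_unitCube
    simp_rw [he] at h1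
    have h2 : ∫ x in unitCube n, ee (freq (-k) x) * (-(lam : ℂ) ^ 2 * F x) =
        -(lam : ℂ) ^ 2 * c k := by
      rw [hc, ← integral_const_mul]
      congr 1
      ext x
      ring
    rw [h2] at h1
    have h3 : (∑ i, (2 * Real.pi * Complex.I * (-k) i) ^ 2 : ℂ) =
        -((4 * Real.pi ^ 2 * ∑ i, (k i : ℝ) ^ 2 : ℝ) : ℂ) := by
      push_cast
      rw [Finset.mul_sum, ← Finset.sum_neg_distrib]
      refine Finset.sum_congr rfl fun i _ => ?_
      simp only [Pi.neg_apply, Int.cast_neg, mul_pow, Complex.I_sq]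
      ring
    rw [h3] at h1
    have h4 : (((4 * Real.pi ^ 2 * ∑ i, (k i : ℝ) ^ 2 - lam ^ 2 : ℝ)) : ℂ) * c k = 0 := by
      push_cast at h1 ⊢
      linear_combination h1
    rcases mul_eq_zero.1 h4 with h5 | h5
    · exact absurd (sub_eq_zero.1 (Complex.ofReal_eq_zero.1 h5)) hk
    · exact h5
  set g : C(UnitAddTorus (Fin n), ℂ) := ⟨torusLift F, hF.continuous_torusLift hd.continuous⟩ with hg
  have hcoef : ∀ k, UnitAddTorus.mFourierCoeff g k = c k := by
    intro k
    rw [UnitAddTorus.mFourierCoeff_eq_integral g k 0, hc, setIntegral_congr_set (ae_eq_unitCube n)]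
    simp only [mFourier_coe_eq, hg, ContinuousMap.coe_mk, hF.torusLift_coe, smul_eq_mul]
  have hfin : {k : Fin n → ℤ | 4 * Real.pi ^ 2 * ∑ i, (k i : ℝ) ^ 2 = lam ^ 2}.Finite := by
    refine (finite_freq n (lam ^ 2)).subset fun k hk => ?_
    simp only [Set.mem_ofPred_eq] at hk ⊢
    have h1 : 0 ≤ ∑ i, (k i : ℝ) ^ 2 := Finset.sum_nonneg fun i _ => sq_nonneg _
    have h2 : 1 ≤ 4 * Real.pi ^ 2 := by nlinarith [Real.pi_gt_three]
    rw [← hk]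
    exact le_mul_of_one_le_left h1 h2
  set s := hfin.toFinset with hs
  have hcs : ∀ k ∉ s, c k = 0 := fun k hk => hck k (by simpa [hs] using hk)
  have hsum : Summable (UnitAddTorus.mFourierCoeff g) :=
    summable_of_ne_finset_zero (s := s) fun k hk => by rw [hcoef, hcs k hk]
  refine ⟨s, c, fun k hk => by simpa [hs] using hk, fun x => ?_⟩
  have h := UnitAddTorus.hasSum_mFourier_series_apply_of_summable hsum
    (fun i => (x i : UnitAddCircle))
  have h2 : g (fun i => (x i : UnitAddCircle)) = F x := by
    simp only [hg, ContinuousMap.coe_mk, hF.torusLift_coe]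
  rw [h2] at h
  refine h.unique ?_
  simp only [hcoef, mFourier_coe_eq, smul_eq_mul]
  rw [trig]
  exact hasSum_sum_of_ne_finset_zero fun k hk => by rw [hcs k hk, zero_mul]

lemma pd_ofReal {n : ℕ} (i : Fin n) {f : (Fin n → ℝ) → ℝ} (hf : Differentiable ℝ f) (x : Fin n → ℝ) :
    pd i (fun x => (f x : ℂ)) x = ((pd i f x : ℝ) : ℂ) := by
  have := (Complex.ofRealCLM.hasFDerivAt (x := f x)).comp x (hf x).hasFDerivAt
  have h2 := this.fderiv
  simp only [pd]
  have e : (Complex.ofRealCLM ∘ f) = fun x => (f x : ℂ) := rfl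
  rw [e] at h2
  rw [h2]
  simp

lemma pd_comp_toLp {n : ℕ} (i : Fin n) {φ : EuclideanSpace ℝ (Fin n) → ℝ} (hφ : Differentiable ℝ φ)
    (x : Fin n → ℝ) : pd i (fun x => φ (WithLp.toLp 2 x)) x =
      fderiv ℝ φ (WithLp.toLp 2 x) (EuclideanSpace.single i 1) := by
  have := (hφ (WithLp.toLp 2 x)).hasFDerivAt.comp x
    ((PiLp.continuousLinearEquiv 2 ℝ (fun _ : Fin n => ℝ)).symm.toContinuousLinearMap.hasFDerivAt (x := x))
  have h2 := this.fderiv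
  simp only [pd]
  have e : (φ ∘ WithLp.toLp 2) =
      fun x => φ (WithLp.toLp 2 x) := rfl
  rw [e] at h2
  rw [h2]
  rfl

lemma IsTorusEigenfunction.exists_eq_trig {n : ℕ} {lam : ℝ} {φ : EuclideanSpace ℝ (Fin n) → ℝ}
    (h : IsTorusEigenfunction lam φ) :
    ∃ (s : Finset (Fin n → ℤ)) (a : (Fin n → ℤ) → ℂ),
      (∀ k ∈ s, 4 * Real.pi ^ 2 * ∑ i, (k i : ℝ) ^ 2 = lam ^ 2) ∧
      ∀ x, (φ (WithLp.toLp 2 x) : ℂ) = trig s id a x := by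
  obtain ⟨hd, hp, -, he⟩ := h
  have hd' : Differentiable ℝ φ := hd.differentiable (by simp)
  set f : (Fin n → ℝ) → ℝ := fun x => φ (WithLp.toLp 2 x) with hf
  have hfd : ContDiff ℝ (⊤ : ℕ∞) f :=
    hd.comp (PiLp.continuousLinearEquiv 2 ℝ (fun _ : Fin n => ℝ)).symm.contDiff
  have hf1 : Differentiable ℝ f := hfd.differentiable (by simp)
  have hpf : ∀ i, pd i f = fun x => fderiv ℝ φ (WithLp.toLp 2 x) (EuclideanSpace.single i 1) :=
    fun i => funext fun x => pd_comp_toLp i hd' x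
  have hd2 : ∀ i, Differentiable ℝ fun y => fderiv ℝ φ y (EuclideanSpace.single i 1) := fun i =>
    ((hd.fderiv_right (m := 1) (WithTop.coe_le_coe.2 (le_top : (1 + 1 : ℕ∞) ≤ ⊤))).clm_apply contDiff_const).differentiable
      one_ne_zero
  have hf2 : ∀ i, Differentiable ℝ (pd i f) := fun i =>
    ((hfd.fderiv_right (m := 1) (WithTop.coe_le_coe.2 (le_top : (1 + 1 : ℕ∞) ≤ ⊤))).clm_apply contDiff_const).differentiable
      one_ne_zero
  refine PiPeriodic.exists_eq_trig (F := fun x => (f x : ℂ)) (fun x k => ?_)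
    (Complex.ofRealCLM.contDiff.comp (hfd.of_le (WithTop.coe_le_coe.2 (le_top : (2 : ℕ∞) ≤ ⊤)))) fun x => ?_
  · have := hp (WithLp.toLp 2 x) k
    simp only [hf]
    rw [← this]
    rfl
  · have e1 : ∀ i, pd i (fun x => (f x : ℂ)) = fun x => ((pd i f x : ℝ) : ℂ) :=
      fun i => funext fun x => pd_ofReal i hf1 x
    simp_rw [e1, pd_ofReal _ (hf2 _), hpf, pd_comp_toLp _ (hd2 _)]
    have := he (WithLp.toLp 2 x)
    rw [lap] at this
    rw [← Complex.ofReal_sum, this]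
    push_cast
    rfl

lemma contDiff_trig {n : ℕ} {ι : Type*} (s : Finset ι) (κ : ι → Fin n → ℤ) (a : ι → ℂ) :
    ContDiff ℝ (⊤ : ℕ∞) (trig s κ a) :=
  ContDiff.sum fun j _ => contDiff_const.mul (contDiff_ee.comp (contDiff_freq (κ j)))

lemma pd_trig {n : ℕ} {ι : Type*} (s : Finset ι) (κ : ι → Fin n → ℤ) (a : ι → ℂ) (i : Fin n)
    (x : Fin n → ℝ) :
    pd i (trig s κ a) x = trig s κ (fun j => 2 * Real.pi * Complex.I * κ j i * a j) x := by
  have hd : ∀ j, DifferentiableAt ℝ (fun x => ee (freq (κ j) x)) x := fun j =>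
    ((contDiff_ee.comp (contDiff_freq (κ j))).differentiable (by simp)) x
  have e : trig s κ a = fun x => ∑ j ∈ s, a j * ee (freq (κ j) x) := rfl
  rw [pd, e, fderiv_fun_sum fun j _ => (hd j).const_mul (a j), sum_apply, trig]
  refine Finset.sum_congr rfl fun j _ => ?_
  rw [fderiv_const_mul (hd j)]
  have := pd_ee_freq (κ j) i x
  rw [pd] at this
  simp only [smul_apply, this, smul_eq_mul]
  ring

/-- `g` is the real function represented by the trigonometric polynomial with frequencies in `s`
and coefficients `a`. -/
def IsTrig {n : ℕ} (s : Finset (Fin n → ℤ)) (a : (Fin n → ℤ) → ℂ) (g : (Fin n → ℝ) → ℝ) : Prop :=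
  ∀ x, (g x : ℂ) = trig s id a x

namespace IsTrig

variable {n : ℕ} {s : Finset (Fin n → ℤ)} {a : (Fin n → ℤ) → ℂ} {g : (Fin n → ℝ) → ℝ}

lemma contDiff (h : IsTrig s a g) : ContDiff ℝ (⊤ : ℕ∞) g := by
  have : g = fun x => (trig s id a x).re := funext fun x => by rw [← h x, Complex.ofReal_re]
  rw [this]
  exact Complex.reCLM.contDiff.comp (contDiff_trig s id a)

lemma contDiff_one (h : IsTrig s a g) : ContDiff ℝ 1 g := h.contDiff.of_le (by exact_mod_cast le_top)

lemma differentiable (h : IsTrig s a g) : Differentiable ℝ g := h.contDiff.differentiable (by simp)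

lemma partialDeriv (h : IsTrig s a g) (i : Fin n) :
    IsTrig s (fun k => 2 * Real.pi * Complex.I * k i * a k) (pd i g) := fun x => by
  have e : (fun x => (g x : ℂ)) = trig s id a := funext h
  rw [← pd_ofReal i h.differentiable, e, pd_trig]
  rfl

lemma sum_pd_pd (h : IsTrig s a g) {lam : ℝ}
    (hs : ∀ k ∈ s, 4 * Real.pi ^ 2 * ∑ i, (k i : ℝ) ^ 2 = lam ^ 2) (x : Fin n → ℝ) :
    ∑ i, pd i (pd i g) x = -lam ^ 2 * g x := by
  have : ((∑ i, pd i (pd i g) x : ℝ) : ℂ) = ((-lam ^ 2 * g x : ℝ) : ℂ) := by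
    push_cast
    simp_rw [((h.partialDeriv _).partialDeriv _) x, h x, trig]
    rw [Finset.sum_comm, Finset.mul_sum]
    refine Finset.sum_congr rfl fun k hk => ?_
    have h1 : ((4 * Real.pi ^ 2 * ∑ i, (k i : ℝ) ^ 2 : ℝ) : ℂ) = ((lam ^ 2 : ℝ) : ℂ) := by
      rw [hs k hk]
    push_cast at h1
    rw [← h1, Finset.mul_sum, ← Finset.sum_neg_distrib, Finset.sum_mul]
    refine Finset.sum_congr rfl fun i _ => ?_
    linear_combination (4 * Real.pi ^ 2 * (k i : ℂ) ^ 2 * a k * ee (freq (id k) x)) * Complex.I_sq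
  exact_mod_cast this

lemma periodic (h : IsTrig s a g) : PiPeriodic g := fun x m => by
  have : ((g (x + fun i => (m i : ℝ)) : ℝ) : ℂ) = g x := by
    rw [h, h, trig, trig]
    simp only [freq_add, ee_add, ee_freq_int, mul_one]
  exact_mod_cast this

/-- A trigonometric polynomial all of whose derivatives vanish at a point is zero. -/
lemma eq_zero_of_moments (h : IsTrig s a g) (x : Fin n → ℝ)
    (hx : ∀ l : List (Fin n), ∑ k ∈ s, (l.map fun i => (k i : ℂ)).prod * (a k * ee (freq k x)) = 0) :
    g = 0 := by
  have hP : ∀ P : MvPolynomial (Fin n) ℂ, ∀ l : List (Fin n),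
      ∑ k ∈ s, MvPolynomial.eval (fun i => (k i : ℂ)) P *
        ((l.map fun i => (k i : ℂ)).prod * (a k * ee (freq k x))) = 0 := by
    intro P
    induction P using MvPolynomial.induction_on with
    | C c =>
      intro l
      simp only [MvPolynomial.eval_C]
      rw [← Finset.mul_sum, hx, mul_zero]
    | add p q hp hq =>
      intro l
      simp only [map_add, add_mul, Finset.sum_add_distrib, hp, hq, add_zero]
    | mul_X p i hp =>
      intro l
      rw [← hp (i :: l)]
      refine Finset.sum_congr rfl fun k _ => ?_
      simp only [map_mul, MvPolynomial.eval_X, List.map_cons, List.prod_cons]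
      ring
  have ha : ∀ k ∈ s, a k = 0 := by
    intro k₀ hk₀
    classical
    have h1 := hP (∏ k' ∈ s.erase k₀, ∑ i, (MvPolynomial.X i - MvPolynomial.C (k' i : ℂ)) *
      MvPolynomial.C ((k₀ i : ℂ) - k' i)) []
    simp only [map_prod, map_sum, map_mul, map_sub, MvPolynomial.eval_X, MvPolynomial.eval_C,
      List.map_nil, List.prod_nil, one_mul] at h1
    rw [Finset.sum_eq_single_of_mem k₀ hk₀] at h1
    · have h2 : ∏ k' ∈ s.erase k₀, ∑ i, ((k₀ i : ℂ) - k' i) * ((k₀ i : ℂ) - k' i) ≠ 0 := by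
        refine Finset.prod_ne_zero_iff.2 fun k' hk' => ?_
        have hne : k' ≠ k₀ := Finset.ne_of_mem_erase hk'
        have : (∑ i, ((k₀ i : ℂ) - k' i) * ((k₀ i : ℂ) - k' i)) =
            ((∑ i, (k₀ i - k' i) * (k₀ i - k' i) : ℤ) : ℂ) := by push_cast; rfl
        rw [this, Int.cast_ne_zero]
        intro h0
        rw [Finset.sum_eq_zero_iff_of_nonneg fun i _ => mul_self_nonneg _] at h0
        refine hne (funext fun i => ?_)
        have := mul_self_eq_zero.1 (h0 i (Finset.mem_univ i))
        omega
      rcases mul_eq_zero.1 h1 with h3 | h3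
      · exact absurd h3 h2
      · rcases mul_eq_zero.1 h3 with h4 | h4
        · exact h4
        · exact absurd h4 (ee_ne_zero _)
    · intro k hk hne
      rw [Finset.prod_eq_zero (Finset.mem_erase.2 ⟨hne, hk⟩), zero_mul]
      exact Finset.sum_eq_zero fun i _ => by simp
  ext y
  have : ((g y : ℝ) : ℂ) = 0 := by
    rw [h y, trig]
    exact Finset.sum_eq_zero fun k hk => by rw [ha k hk, zero_mul]
  exact_mod_cast this

end IsTrig

lemma hausdorffMeasure_le_of_edist_le {X Y : Type*} [EMetricSpace X] [MeasurableSpace X] [BorelSpace X]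
    [EMetricSpace Y] [MeasurableSpace Y] [BorelSpace Y] (p : X → Y) (C : ℝ≥0) {S : Set X}
    (h : ∀ y ∈ S, ∀ z ∈ S, edist y z ≤ C * edist (p y) (p z)) {d : ℝ} (hd : 0 ≤ d) :
    μH[d] S ≤ (C : ℝ≥0∞) ^ d * μH[d] (p '' S) := by
  rcases isEmpty_or_nonempty X with hX | hX
  · rw [Set.eq_empty_of_isEmpty S]; simp
  have hg : LipschitzOnWith C (Function.invFunOn p S) (p '' S) := by
    intro y hy z hz
    have := h _ (Function.invFunOn_mem hy) _ (Function.invFunOn_mem hz)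
    rwa [Function.invFunOn_eq hy, Function.invFunOn_eq hz] at this
  have hS : S ⊆ Function.invFunOn p S '' (p '' S) := by
    intro y hy
    refine ⟨p y, ⟨y, hy, rfl⟩, ?_⟩
    have hy' : ∃ a ∈ S, p a = p y := ⟨y, hy, rfl⟩
    have := h _ (Function.invFunOn_mem hy') _ hy
    rw [Function.invFunOn_eq hy', edist_self, mul_zero] at this
    exact edist_le_zero.1 this
  exact (measure_mono hS).trans (hg.hausdorffMeasure_image_le hd)

lemma hausdorffMeasure_le_of_locally_edist_le {n m : ℕ} (p : (Fin n → ℝ) → (Fin m → ℝ))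
    (hp : Continuous p) (C : ℝ≥0) (N : ℕ) {R : Set (Fin n → ℝ)} (hR : MeasurableSet R)
    {Q : Set (Fin m → ℝ)} (hQ : MeasurableSet Q)
    (h : ∀ x ∈ R, ∃ U ∈ 𝓝 x, ∀ y ∈ U ∩ R, ∀ z ∈ U ∩ R, edist y z ≤ C * edist (p y) (p z))
    (hfib : ∀ y, (R ∩ p ⁻¹' {y}).encard ≤ N) (hRQ : p '' R ⊆ Q) :
    μH[m] R ≤ (C : ℝ≥0∞) ^ (m : ℝ) * (N * volume Q) := by
  rcases R.eq_empty_or_nonempty with rfl | hne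
  · simp
  choose! U hU hUR using h
  obtain ⟨T, hTR, hTc, hTcov⟩ := TopologicalSpace.countable_cover_nhdsWithin
    (s := R) (f := fun x => interior (U x))
    (fun x hx => mem_nhdsWithin_of_mem_nhds (interior_mem_nhds.2 (hU x hx)))
  have hTne : T.Nonempty := by
    obtain ⟨x, hx⟩ := hne
    obtain ⟨i, hi, -⟩ := Set.mem_iUnion₂.1 (hTcov hx)
    exact ⟨i, hi⟩
  obtain ⟨t, rfl⟩ := hTc.exists_eq_range hTne
  set V : ℕ → Set (Fin n → ℝ) := fun k => R ∩ disjointed (fun k => interior (U (t k))) k with hV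
  have hVm : ∀ k, MeasurableSet (V k) := fun k =>
    hR.inter (MeasurableSet.disjointed (fun k => isOpen_interior.measurableSet) k)
  have hVd : Pairwise (Function.onFun Disjoint V) := fun i j hij =>
    (disjoint_disjointed _ hij).mono Set.inter_subset_right Set.inter_subset_right
  have hVU : ⋃ k, V k = R := by
    rw [hV, ← Set.inter_iUnion, iUnion_disjointed, Set.inter_eq_left]
    intro x hx
    obtain ⟨_, ⟨k, rfl⟩, hi⟩ := Set.mem_iUnion₂.1 (hTcov hx)
    exact Set.mem_iUnion.2 ⟨k, hi⟩
  have hVexp : ∀ k, ∀ y ∈ V k, ∀ z ∈ V k, edist y z ≤ C * edist (p y) (p z) := by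
    have key : ∀ k, ∀ y ∈ V k, y ∈ U (t k) ∩ R := fun k y hy =>
      ⟨interior_subset (disjointed_subset _ k hy.2), hy.1⟩
    exact fun k y hy z hz => hUR _ (hTR ⟨k, rfl⟩) y (key k y hy) z (key k z hz)
  have hinj : ∀ k, Set.InjOn p (V k) := fun k y hy z hz hyz => by
    have := hVexp k y hy z hz
    rw [hyz, edist_self, mul_zero] at this
    exact edist_le_zero.1 this
  have him : ∀ k, MeasurableSet (p '' V k) := fun k =>
    (hVm k).image_of_continuousOn_injOn hp.continuousOn (hinj k)
  have hsum : ∀ y, ∑' k, (p '' V k).indicator (fun _ => (1 : ℝ≥0∞)) y ≤ Q.indicator (fun _ => (N : ℝ≥0∞)) y := by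
    intro y
    by_cases hy : y ∈ Q
    · rw [Set.indicator_of_mem hy]
      have hfm : MeasurableSet (p ⁻¹' {y}) := hp.measurable (measurableSet_singleton y)
      calc ∑' k, (p '' V k).indicator (fun _ => (1 : ℝ≥0∞)) y
          ≤ ∑' k, Measure.count (V k ∩ p ⁻¹' {y}) := by
            refine ENNReal.tsum_le_tsum fun k => ?_
            refine Set.indicator_apply_le' (fun hyk => ?_) fun _ => zero_le
            obtain ⟨x, hx, hxy⟩ := hyk
            have : ({x} : Set (Fin n → ℝ)) ⊆ V k ∩ p ⁻¹' {y} := by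
              simp [hx, hxy]
            calc (1 : ℝ≥0∞) = Measure.count ({x} : Set (Fin n → ℝ)) := by simp
              _ ≤ _ := measure_mono this
        _ = Measure.count (⋃ k, V k ∩ p ⁻¹' {y}) := by
            rw [measure_iUnion (fun i j hij => (hVd hij).mono Set.inter_subset_left Set.inter_subset_left)
              fun k => (hVm k).inter hfm]
        _ = Measure.count (R ∩ p ⁻¹' {y}) := by rw [← Set.iUnion_inter, hVU]
        _ ≤ N := by
            rw [Measure.count_apply (hR.inter hfm)]
            exact_mod_cast hfib y
    · rw [Set.indicator_of_notMem hy]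
      refine le_of_eq (ENNReal.tsum_eq_zero.2 fun k => Set.indicator_of_notMem (fun hyk => hy ?_) _)
      exact hRQ (Set.image_mono Set.inter_subset_left hyk)
  calc μH[m] R = μH[m] (⋃ k, V k) := by rw [hVU]
    _ ≤ ∑' k, μH[m] (V k) := measure_iUnion_le _
    _ ≤ ∑' k, (C : ℝ≥0∞) ^ (m : ℝ) * volume (p '' V k) := by
        refine ENNReal.tsum_le_tsum fun k => ?_
        have := hausdorffMeasure_le_of_edist_le p C (hVexp k) (d := m) (by positivity)
        have e : (μH[m] : Measure (Fin m → ℝ)) = volume := by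
          simpa using hausdorffMeasure_pi_real (ι := Fin m)
        rwa [e] at this
    _ = (C : ℝ≥0∞) ^ (m : ℝ) * ∑' k, ∫⁻ y, (p '' V k).indicator (fun _ => (1 : ℝ≥0∞)) y := by
        rw [ENNReal.tsum_mul_left]
        congr 2 with k
        rw [lintegral_indicator (him k)]; simp
    _ = (C : ℝ≥0∞) ^ (m : ℝ) * ∫⁻ y, ∑' k, (p '' V k).indicator (fun _ => (1 : ℝ≥0∞)) y := by
        rw [lintegral_tsum fun k => (measurable_const.indicator (him k)).aemeasurable]
    _ ≤ (C : ℝ≥0∞) ^ (m : ℝ) * ∫⁻ y, Q.indicator (fun _ => (N : ℝ≥0∞)) y := by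
        gcongr with y
        exact hsum y
    _ = _ := by rw [lintegral_indicator hQ]; simp

lemma HasStrictFDerivAt.exists_nhds_edist_le {E F G : Type*} [NormedAddCommGroup E] [NormedSpace ℝ E]
    [NormedAddCommGroup F] [NormedSpace ℝ F] [NormedAddCommGroup G] [NormedSpace ℝ G]
    {h : E → F} {A : E →L[ℝ] F} {x : E} (hh : HasStrictFDerivAt h A x) (p : E →L[ℝ] G)
    {ε : ℝ} (hε : 0 < ε) {C : ℝ≥0} (hA : ∀ v, ‖A v‖ ≤ ε * ‖v‖ → ‖v‖ ≤ C * ‖p v‖) :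
    ∃ U ∈ 𝓝 x, ∀ y ∈ U, ∀ z ∈ U, h y = h z → edist y z ≤ C * edist (p y) (p z) := by
  have h1 := hh.isLittleO.def hε
  rw [nhds_prod_eq] at h1
  obtain ⟨U, hU, hUU⟩ := Filter.mem_prod_self_iff.1 h1
  refine ⟨U, hU, fun y hy z hz hyz => ?_⟩
  have h2 : ‖h y - h z - A (y - z)‖ ≤ ε * ‖y - z‖ := hUU (Set.mk_mem_prod hy hz)
  simp only [hyz, sub_self, zero_sub, norm_neg] at h2
  have h3 := hA _ h2
  rw [edist_eq_enorm_sub, edist_eq_enorm_sub, ← map_sub]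
  rw [← ENNReal.toReal_le_toReal (by simp) (by finiteness)]
  simpa using h3

lemma abs_le_of_abs_sum_mul_le {m : ℕ} (i : Fin (m + 1)) (a v : Fin (m + 1) → ℝ) (ha : a i ≠ 0)
    (hai : ∀ j, |a j| ≤ |a i|) (hv : |∑ j, a j * v j| ≤ |a i| / 2 * ‖v‖) :
    ‖v‖ ≤ 2 * (m + 1) * ‖fun j => v (i.succAbove j)‖ := by
  set P := ‖fun j => v (i.succAbove j)‖
  have hP : 0 ≤ P := norm_nonneg _
  have hpos : 0 < |a i| := abs_pos.2 ha
  have hj : ∀ j, |v (i.succAbove j)| ≤ P := fun j => norm_le_pi_norm (fun j => v (i.succAbove j)) j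
  have h1 : |∑ j, a (i.succAbove j) * v (i.succAbove j)| ≤ |a i| * (m * P) := by
    refine (Finset.abs_sum_le_sum_abs _ _).trans ?_
    calc ∑ j, |a (i.succAbove j) * v (i.succAbove j)| ≤ ∑ j : Fin m, |a i| * P := by
          refine Finset.sum_le_sum fun j _ => ?_
          rw [abs_mul]
          exact mul_le_mul (hai _) (hj j) (abs_nonneg _) hpos.le
      _ = |a i| * (m * P) := by simp; ring
  rw [Fin.sum_univ_succAbove _ i] at hv
  have h2 : |a i| * |v i| ≤ |a i| * (‖v‖ / 2 + m * P) := by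
    rw [← abs_mul]
    have := abs_sub_abs_le_abs_sub (a i * v i) (-∑ j, a (i.succAbove j) * v (i.succAbove j))
    rw [sub_neg_eq_add, abs_neg] at this
    linarith
  have h3 := le_of_mul_le_mul_left h2 hpos
  by_contra! hlt
  have hm : (0 : ℝ) ≤ m := by positivity
  have h4 : ‖v‖ ≤ max (‖v‖ / 2 + m * P) P := by
    refine (pi_norm_le_iff_of_nonneg (by positivity)).2 fun j => ?_
    rcases Fin.eq_self_or_eq_succAbove i j with rfl | ⟨j, rfl⟩
    · exact le_max_of_le_left h3
    · exact le_max_of_le_right (hj j)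
  rcases le_max_iff.1 h4 with h5 | h5 <;> nlinarith

/-- The projection forgetting the `i`-th coordinate. -/
noncomputable def dropCoord {m : ℕ} (i : Fin (m + 1)) : (Fin (m + 1) → ℝ) →L[ℝ] (Fin m → ℝ) :=
  ContinuousLinearMap.pi fun j => ContinuousLinearMap.proj (i.succAbove j)

lemma dropCoord_apply {m : ℕ} (i : Fin (m + 1)) (x : Fin (m + 1) → ℝ) (j : Fin m) :
    dropCoord i x j = x (i.succAbove j) := rfl

lemma fderiv_apply_eq_sum_pd {n : ℕ} (g : (Fin n → ℝ) → ℝ) (x v : Fin n → ℝ) :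
    fderiv ℝ g x v = ∑ j, pd j g x * v j := by
  conv_lhs => rw [pi_eq_sum_univ' v]
  rw [map_sum]
  refine Finset.sum_congr rfl fun j _ => ?_
  rw [map_smul, pd, smul_eq_mul, mul_comm]

lemma exists_nhds_edist_dropCoord_le {m : ℕ} {g : (Fin (m + 1) → ℝ) → ℝ} (hg : ContDiff ℝ 1 g)
    (i : Fin (m + 1)) {x : Fin (m + 1) → ℝ} (hi : pd i g x ≠ 0) (hij : ∀ j, |pd j g x| ≤ |pd i g x|) :
    ∃ U ∈ 𝓝 x, ∀ y ∈ U, ∀ z ∈ U, g y = g z →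
      edist y z ≤ (2 * (m + 1) : ℝ≥0) * edist (dropCoord i y) (dropCoord i z) := by
  have hs : HasStrictFDerivAt g (fderiv ℝ g x) x := hg.contDiffAt.hasStrictFDerivAt (by simp)
  refine hs.exists_nhds_edist_le (dropCoord i) (ε := |pd i g x| / 2) (by positivity) fun v hv => ?_
  rw [fderiv_apply_eq_sum_pd] at hv
  exact_mod_cast abs_le_of_abs_sum_mul_le i (fun j => pd j g x) v hi hij hv

lemma hausdorffMeasure_pi_eq_zero {ι : Type*} [Fintype ι] {d : ℝ} (hd : Fintype.card ι < d)
    (S : Set (ι → ℝ)) : μH[d] S = 0 := by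
  have h0 : 0 ≤ d := (Nat.cast_nonneg _).trans hd.le
  lift d to ℝ≥0 using h0
  refine hausdorffMeasure_of_dimH_lt ?_
  refine (dimH_mono (Set.subset_univ S)).trans_lt ?_
  rw [Real.dimH_univ_pi]
  exact_mod_cast hd

lemma exists_minor_ne_zero {n : ℕ} (M : Fin n → Fin n → ℝ) (hs : ∀ i j, M i j = M j i)
    (ht : ∑ i, M i i = 0) (hM : ∃ i j, M i j ≠ 0) :
    ∃ i j, i ≠ j ∧ M i i * M j j - M i j * M j i ≠ 0 := by
  by_contra! h
  have h1 : ∀ i j, M i i * M j j = M i j ^ 2 := fun i j => by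
    by_cases hij : i = j
    · subst hij; ring
    · have := h i j hij
      rw [hs j i] at this
      linarith
  have h2 : ∑ i, ∑ j, M i j ^ 2 = 0 := by
    simp_rw [← h1]
    rw [← Finset.sum_mul_sum, ht, zero_mul]
  obtain ⟨i, j, hij⟩ := hM
  rw [Finset.sum_eq_zero_iff_of_nonneg fun i _ => Finset.sum_nonneg fun j _ => sq_nonneg _] at h2
  have h3 := h2 i (Finset.mem_univ i)
  rw [Finset.sum_eq_zero_iff_of_nonneg fun j _ => sq_nonneg _] at h3
  exact hij (pow_eq_zero_iff (two_ne_zero) |>.1 (h3 j (Finset.mem_univ j)))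

lemma hausdorffMeasure_critical_eq_zero {m : ℕ} {g : (Fin (m + 1) → ℝ) → ℝ}
    (hg : ∀ i, ContDiff ℝ 1 (pd i g)) (hsymm : ∀ i j x, pd i (pd j g) x = pd j (pd i g) x)
    (S : Set (Fin (m + 1) → ℝ)) (hS : ∀ x ∈ S, (∀ i, pd i g x = 0) ∧ ∑ i, pd i (pd i g) x = 0 ∧
      ∃ i j, pd i (pd j g) x ≠ 0) : μH[m] S = 0 := by
  refine measure_null_of_locally_null _ fun x hx => ?_
  obtain ⟨-, htr, hne⟩ := hS x hx
  obtain ⟨i, j, hij, hdet⟩ := exists_minor_ne_zero (fun i j => pd i (pd j g) x)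
    (fun i j => hsymm i j x) htr hne
  have hs : ∀ i, HasStrictFDerivAt (pd i g) (fderiv ℝ (pd i g) x) x := fun i =>
    (hg i).contDiffAt.hasStrictFDerivAt (by simp)
  have hs2 := (hs i).prodMk (hs j)
  set A := (fderiv ℝ (pd i g) x).prod (fderiv ℝ (pd j g) x) with hA
  let p : (Fin (m + 1) → ℝ) →L[ℝ] ({a : Fin (m + 1) // a ≠ i ∧ a ≠ j} → ℝ) :=
    ContinuousLinearMap.pi fun a => ContinuousLinearMap.proj a.1
  have hker : LinearMap.ker (A.prod p).toLinearMap = ⊥ := by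
    rw [LinearMap.ker_eq_bot']
    intro v hv
    have hv1 : A v = 0 := congrArg Prod.fst hv
    have hv2 : p v = 0 := congrArg Prod.snd hv
    have hz : ∀ a, a ≠ i → a ≠ j → v a = 0 := fun a h1 h2 => congrFun hv2 ⟨a, h1, h2⟩
    have hsum : ∀ l, fderiv ℝ (pd l g) x v = pd i (pd l g) x * v i + pd j (pd l g) x * v j := by
      intro l
      rw [fderiv_apply_eq_sum_pd, ← Finset.sum_pair hij (f := fun a => pd a (pd l g) x * v a)]
      refine (Finset.sum_subset (Finset.subset_univ _) fun a _ ha => ?_).symm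
      simp only [Finset.mem_insert, Finset.mem_singleton, not_or] at ha
      rw [hz a ha.1 ha.2, mul_zero]
    have e1 : fderiv ℝ (pd i g) x v = 0 := congrArg Prod.fst hv1
    have e2 : fderiv ℝ (pd j g) x v = 0 := congrArg Prod.snd hv1
    rw [hsum] at e1 e2
    have hvi : v i = 0 := by
      refine (mul_eq_zero.1 ?_).resolve_left hdet
      linear_combination pd j (pd j g) x * e1 - pd j (pd i g) x * e2
    have hvj : v j = 0 := by
      refine (mul_eq_zero.1 ?_).resolve_left hdet
      linear_combination pd i (pd i g) x * e2 - pd i (pd j g) x * e1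
    funext a
    by_cases h1 : a = i
    · rw [h1, hvi]; rfl
    by_cases h2 : a = j
    · rw [h2, hvj]; rfl
    exact hz a h1 h2
  obtain ⟨K, hK, hanti⟩ := LinearMap.exists_antilipschitzWith _ hker
  have hK' : (0 : ℝ) < K := hK
  obtain ⟨U, hU, hUU⟩ := hs2.exists_nhds_edist_le p (ε := (2 * K : ℝ)⁻¹) (C := K) (by positivity)
    fun v hv => by
      have h1 : ‖v‖ ≤ K * ‖((A v, p v) : (ℝ × ℝ) × _)‖ := by
        simpa using hanti.le_mul_norm (map_zero _) v
      rw [Prod.norm_mk] at h1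
      rcases le_max_iff.1 (le_refl (max ‖A v‖ ‖p v‖)) with h2 | h2
      · have : K * ‖A v‖ ≤ ‖v‖ / 2 := by
          calc K * ‖A v‖ ≤ K * ((2 * K : ℝ)⁻¹ * ‖v‖) := by gcongr
            _ = ‖v‖ / 2 := by field_simp
        have h3 : K * max ‖A v‖ ‖p v‖ ≤ K * ‖A v‖ := by gcongr
        have h4 : ‖v‖ ≤ 0 := by linarith
        exact h4.trans (by positivity)
      · exact h1.trans (by gcongr)
  refine ⟨U ∩ S, Filter.inter_mem (mem_nhdsWithin_of_mem_nhds hU) self_mem_nhdsWithin, ?_⟩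
  have hle := hausdorffMeasure_le_of_edist_le p K (S := U ∩ S) (d := m)
    (fun y hy z hz => hUU y hy.1 z hz.1 (by simp [(hS y hy.2).1, (hS z hz.2).1])) (by positivity)
  have hcard : Fintype.card {a : Fin (m + 1) // a ≠ i ∧ a ≠ j} < m := by
    have h1 : Fintype.card {a : Fin (m + 1) // a ≠ i ∧ a ≠ j} = ((Finset.univ.erase i).erase j).card := by
      rw [Fintype.card_subtype]
      congr 1
      ext a; simp [and_comm]
    rw [h1, Finset.card_erase_of_mem (by simp [hij.symm]), Finset.card_erase_of_mem (by simp)]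
    have h2 : 1 < Fintype.card (Fin (m + 1)) := Fintype.one_lt_card_iff.2 ⟨i, j, hij⟩
    simp at h2 ⊢
    omega
  rw [hausdorffMeasure_pi_eq_zero (by exact_mod_cast hcard) (p '' (U ∩ S)), mul_zero] at hle
  exact le_antisymm hle zero_le

lemma trig_add_smul_single {n : ℕ} {ι : Type*} (s : Finset ι) (κ : ι → Fin n → ℤ) (a : ι → ℂ)
    (x : Fin n → ℝ) (i : Fin n) (t : ℝ) :
    trig s κ a (x + t • Pi.single i 1) = ∑ j ∈ s, a j * ee (freq (κ j) x) * ee (κ j i * t) := by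
  refine Finset.sum_congr rfl fun j _ => ?_
  rw [freq_add, freq_smul_single, ee_add, mul_assoc]

/-- Iterated partial derivatives along a list of coordinates. -/
noncomputable def listPd {n : ℕ} (g : (Fin n → ℝ) → ℝ) : List (Fin n) → (Fin n → ℝ) → ℝ
  | [] => g
  | i :: l => pd i (listPd g l)

lemma dropCoord_image_unitCube_subset {m : ℕ} (i : Fin (m + 1)) :
    dropCoord i '' unitCube (m + 1) ⊆ unitCube m := by
  rintro _ ⟨x, hx, rfl⟩ j _
  exact hx (i.succAbove j) (Set.mem_univ _)

lemma eq_insertNth_add {m : ℕ} (i : Fin (m + 1)) (x : Fin (m + 1) → ℝ) :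
    x = i.insertNth (0 : ℝ) (dropCoord i x) + x i • Pi.single i 1 := by
  funext j
  rcases Fin.eq_self_or_eq_succAbove i j with rfl | ⟨j, rfl⟩
  · simp
  · simp [dropCoord_apply]

namespace IsTrig

variable {m n : ℕ} {s : Finset (Fin n → ℤ)} {a : (Fin n → ℤ) → ℂ} {g : (Fin n → ℝ) → ℝ}

lemma pd_comm (h : IsTrig s a g) (i j : Fin n) (x : Fin n → ℝ) :
    pd i (pd j g) x = pd j (pd i g) x := by
  have : ((pd i (pd j g) x : ℝ) : ℂ) = pd j (pd i g) x := by
    rw [(h.partialDeriv j).partialDeriv i, (h.partialDeriv i).partialDeriv j]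
    refine Finset.sum_congr rfl fun k _ => ?_
    ring
  exact_mod_cast this

lemma ofListPd (h : IsTrig s a g) (l : List (Fin n)) :
    IsTrig s (fun k => (2 * Real.pi * Complex.I) ^ l.length *
      ((l.map fun i => (k i : ℂ)).prod * a k)) (listPd g l) := by
  induction l with
  | nil => simpa [listPd] using h
  | cons i l ih =>
    have := ih.partialDeriv i
    convert this using 2 with k
    · simp only [List.length_cons, List.map_cons, List.prod_cons]
      ring
    · rfl

lemma eq_zero_of_listPd (h : IsTrig s a g) (x : Fin n → ℝ) (hx : ∀ l, listPd g l x = 0) :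
    g = 0 := by
  refine h.eq_zero_of_moments x fun l => ?_
  have h1 := h.ofListPd l x
  rw [hx l, trig, Complex.ofReal_zero] at h1
  simp only [mul_assoc, ← Finset.mul_sum] at h1
  have h2 : (2 * (Real.pi * Complex.I)) ^ l.length ≠ 0 := by
    simp [Real.pi_ne_zero, Complex.I_ne_zero]
  exact (mul_eq_zero.1 h1.symm).resolve_left h2

end IsTrig

section Upper

variable {m : ℕ} {s : Finset (Fin (m + 1) → ℤ)} {a : (Fin (m + 1) → ℤ) → ℂ}
  {g : (Fin (m + 1) → ℝ) → ℝ}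

/-- Zeros in the unit cube at which the `i`-th partial derivative dominates. -/
def regularZeros (g : (Fin (m + 1) → ℝ) → ℝ) (i : Fin (m + 1)) : Set (Fin (m + 1) → ℝ) :=
  {x ∈ unitCube (m + 1) | g x = 0 ∧ pd i g x ≠ 0 ∧ ∀ j, |pd j g x| ≤ |pd i g x|}

lemma IsTrig.encard_regularZeros_le (h : IsTrig s a g) {d : ℕ} (hd : ∀ k ∈ s, ∀ i, |k i| ≤ d)
    (i : Fin (m + 1)) (y : Fin m → ℝ) :
    (regularZeros g i ∩ dropCoord i ⁻¹' {y}).encard ≤ (2 * d : ℕ) := by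
  rcases (regularZeros g i ∩ dropCoord i ⁻¹' {y}).eq_empty_or_nonempty with he | ⟨x₁, hx₁, hy₁⟩
  · simp [he]
  set x₀ : Fin (m + 1) → ℝ := i.insertNth (0 : ℝ) y
  have hline : ∀ t : ℝ, (g (x₀ + t • Pi.single i 1) : ℂ) =
      ∑ k ∈ s, a k * ee (freq k x₀) * ee (k i * t) := fun t => by
    rw [h, trig_add_smul_single]; rfl
  have hx : ∀ x ∈ regularZeros g i ∩ dropCoord i ⁻¹' {y}, x = x₀ + x i • Pi.single i 1 := by
    rintro x ⟨-, hxy⟩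
    have := eq_insertNth_add i x
    rwa [show dropCoord i x = y from hxy] at this
  have hne : ∃ t : ℝ, ∑ k ∈ s, a k * ee (freq k x₀) * ee (k i * t) ≠ 0 := by
    by_contra! h0
    refine hx₁.2.2.1 ?_
    have h1 := h.contDiff_one.hasDerivAt_add_single i x₀ (x₁ i)
    rw [← hx x₁ ⟨hx₁, hy₁⟩] at h1
    have h2 : (fun s : ℝ => g (x₀ + s • Pi.single i 1)) = fun _ => 0 := by
      funext t
      exact_mod_cast (hline t).trans (h0 t)
    rw [h2] at h1
    exact h1.unique (hasDerivAt_const _ _)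
  have := encard_zeros_trig_le s (fun k => a k * ee (freq k x₀)) (fun k => k i) d
    (fun k hk => hd k hk i) hne
  refine le_trans ?_ (this.trans (by push_cast; exact le_rfl))
  refine Set.encard_le_encard_of_injOn (f := fun x => x i) (fun x hx' => ⟨hx'.1.1 i (Set.mem_univ i), ?_⟩)
    fun x hx' z hz' hxz => ?_
  · rw [← hline, ← hx x hx', hx'.1.2.1, Complex.ofReal_zero]
  · rw [hx x hx', hx z hz']
    simp only at hxz
    rw [hxz]

lemma IsTrig.measurableSet_regularZeros (h : IsTrig s a g) (i : Fin (m + 1)) :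
    MeasurableSet (regularZeros g i) := by
  have hc : ∀ j, Measurable (pd j g) := fun j => (h.partialDeriv j).contDiff.continuous.measurable
  refine (measurableSet_unitCube _).inter ?_
  refine (measurableSet_eq_fun h.contDiff.continuous.measurable measurable_const).inter ?_
  refine (measurableSet_eq_fun (hc i) measurable_const).compl.inter ?_
  have : {x | ∀ j, |pd j g x| ≤ |pd i g x|} = ⋂ j, {x | |pd j g x| ≤ |pd i g x|} := by
    ext; simp
  change MeasurableSet {x | ∀ j, |pd j g x| ≤ |pd i g x|}
  rw [this]
  exact MeasurableSet.iInter fun j => measurableSet_le (hc j).abs (hc i).abs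

lemma IsTrig.hausdorffMeasure_regularZeros_le (h : IsTrig s a g) {d : ℕ}
    (hd : ∀ k ∈ s, ∀ i, |k i| ≤ d) (i : Fin (m + 1)) :
    μH[m] (regularZeros g i) ≤ ((2 * (m + 1) : ℝ≥0) : ℝ≥0∞) ^ (m : ℝ) * (2 * d : ℕ) := by
  have := hausdorffMeasure_le_of_locally_edist_le (dropCoord i) (dropCoord i).continuous
    (2 * (m + 1)) (2 * d) (h.measurableSet_regularZeros i) (measurableSet_unitCube m)
    (fun x hx => ?_) (h.encard_regularZeros_le hd i)
    ((Set.image_mono fun x hx => hx.1).trans (dropCoord_image_unitCube_subset i))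
  · rwa [volume_unitCube, mul_one] at this
  · obtain ⟨U, hU, hUU⟩ := exists_nhds_edist_dropCoord_le h.contDiff_one i hx.2.2.1 hx.2.2.2
    refine ⟨U, hU, fun y hy z hz => ?_⟩
    have := hUU y hy.1 z hz.1 (hy.2.2.1.trans hz.2.2.1.symm)
    exact_mod_cast this

/-- Zeros at which the gradient vanishes but the Hessian does not. -/
def degenerateZeros (g : (Fin (m + 1) → ℝ) → ℝ) : Set (Fin (m + 1) → ℝ) :=
  {x | g x = 0 ∧ (∀ i, pd i g x = 0) ∧ ∃ i j, pd i (pd j g) x ≠ 0}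

lemma IsTrig.hausdorffMeasure_degenerateZeros (h : IsTrig s a g) {lam : ℝ}
    (hs : ∀ k ∈ s, 4 * Real.pi ^ 2 * ∑ i, (k i : ℝ) ^ 2 = lam ^ 2) :
    μH[m] (degenerateZeros g) = 0 :=
  hausdorffMeasure_critical_eq_zero (fun i => (h.partialDeriv i).contDiff_one) h.pd_comm _
    fun x hx => ⟨hx.2.1, by rw [h.sum_pd_pd hs, hx.1, mul_zero], hx.2.2⟩

lemma IsTrig.zeros_subset (h : IsTrig s a g) (hg : g ≠ 0) :
    {x ∈ unitCube (m + 1) | g x = 0} ⊆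
      (⋃ i, regularZeros g i) ∪ ⋃ l, degenerateZeros (listPd g l) := by
  rintro x ⟨hx, hx0⟩
  by_contra hcon
  simp only [Set.mem_union, Set.mem_iUnion, not_or, not_exists] at hcon
  obtain ⟨h1, h2⟩ := hcon
  have hgrad : ∀ j, pd j g x = 0 := by
    obtain ⟨i, hi⟩ := Finite.exists_max fun j => |pd j g x|
    by_cases hi0 : pd i g x = 0
    · intro j
      have := hi j
      rw [hi0, abs_zero] at this
      exact abs_nonpos_iff.1 this
    · exact (h1 i ⟨hx, hx0, hi0, hi⟩).elim
  have hall : ∀ l, listPd g l x = 0 ∧ ∀ i, pd i (listPd g l) x = 0 := by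
    intro l
    induction l with
    | nil => exact ⟨hx0, hgrad⟩
    | cons i l ih =>
      refine ⟨ih.2 i, fun j => ?_⟩
      by_contra hj
      exact h2 l ⟨ih.1, ih.2, j, i, hj⟩
  exact hg (h.eq_zero_of_listPd x fun l => (hall l).1)

lemma IsTrig.hausdorffMeasure_zeros_le (h : IsTrig s a g) (hg : g ≠ 0) {lam : ℝ}
    (hs : ∀ k ∈ s, 4 * Real.pi ^ 2 * ∑ i, (k i : ℝ) ^ 2 = lam ^ 2) {d : ℕ}
    (hd : ∀ k ∈ s, ∀ i, |k i| ≤ d) :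
    μH[m] {x ∈ unitCube (m + 1) | g x = 0} ≤
      (m + 1 : ℕ) * (((2 * (m + 1) : ℝ≥0) : ℝ≥0∞) ^ (m : ℝ) * (2 * d : ℕ)) := by
  calc _ ≤ μH[m] (⋃ i, regularZeros g i) + μH[m] (⋃ l, degenerateZeros (listPd g l)) :=
        (measure_mono (h.zeros_subset hg)).trans (measure_union_le _ _)
    _ = μH[m] (⋃ i, regularZeros g i) := by
        rw [measure_iUnion_null fun l => (h.ofListPd l).hausdorffMeasure_degenerateZeros hs, add_zero]
    _ ≤ ∑ i, μH[m] (regularZeros g i) := measure_iUnion_fintype_le _ _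
    _ ≤ ∑ i : Fin (m + 1), ((2 * (m + 1) : ℝ≥0) : ℝ≥0∞) ^ (m : ℝ) * (2 * d : ℕ) :=
        Finset.sum_le_sum fun i _ => h.hausdorffMeasure_regularZeros_le hd i
    _ = _ := by simp

end Upper

lemma lipschitzWith_dropCoord {m : ℕ} (i : Fin (m + 1)) : LipschitzWith 1 (dropCoord i) :=
  LipschitzWith.of_dist_le_mul fun x y => by
    rw [NNReal.coe_one, one_mul]
    exact (dist_pi_le_iff dist_nonneg).2 fun j => dist_le_pi_dist x y (i.succAbove j)

/-- The set of points from which a segment of length at most `r` in a coordinate direction hits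
the zero set has volume controlled by the measure of the zero set. -/
lemma volume_exists_zero_le {m : ℕ} {g : (Fin (m + 1) → ℝ) → ℝ} (hg : Continuous g)
    (hper : PiPeriodic g) (i : Fin (m + 1)) {r : ℝ} (hr : 0 < r) (L : ℕ) (hL : r + 1 ≤ L) :
    volume {x ∈ unitCube (m + 1) | ∃ t, |t| ≤ r ∧ g (x + t • Pi.single i 1) = 0} ≤
      ENNReal.ofReal ((2 * L + 1) * (4 * r)) * μH[m] {x ∈ unitCube (m + 1) | g x = 0} := by
  set Z := {x ∈ unitCube (m + 1) | g x = 0} with hZ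
  have hZm : MeasurableSet Z := (measurableSet_unitCube _).inter
    (measurableSet_eq_fun hg.measurable measurable_const)
  set V : ℤ → Set (Fin (m + 1) → ℝ) := fun j => Z ∩ {w | ⌊w i / r⌋ = j} with hV
  have hVm : ∀ j, MeasurableSet (V j) := fun j => hZm.inter <|
    ((show Measurable fun w : Fin (m + 1) → ℝ => w i by fun_prop).div_const r).floor
      (measurableSet_singleton j)
  have hVd : Pairwise (Function.onFun Disjoint V) := fun j k hjk =>
    Set.disjoint_left.2 fun w hw hw' => hjk (hw.2.symm.trans hw'.2)
  set Tset : ℤ → Set ℝ := fun j => ⋃ l ∈ Finset.Icc (-(L : ℤ)) L,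
    Set.Icc (j * r + l - 2 * r) (j * r + l + 2 * r) with hT
  have hTv : ∀ j, volume (Tset j) ≤ ENNReal.ofReal ((2 * L + 1) * (4 * r)) := fun j => by
    refine (measure_biUnion_finset_le _ _).trans ?_
    have : ∀ l : ℤ, volume (Set.Icc (j * r + l - 2 * r) (j * r + l + 2 * r)) = ENNReal.ofReal (4 * r) :=
      fun l => by rw [Real.volume_Icc]; congr 1; ring
    simp only [this, Finset.sum_const, nsmul_eq_mul]
    have hc : ((Finset.Icc (-(L : ℤ)) L).card : ℤ) = 2 * L + 1 := by
      rw [Int.card_Icc, Int.toNat_of_nonneg (by omega)]; ring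
    have hc' : ((Finset.Icc (-(L : ℤ)) L).card : ℝ) = 2 * L + 1 := by exact_mod_cast hc
    rw [← hc', ENNReal.ofReal_mul (Nat.cast_nonneg _), ENNReal.ofReal_natCast]
  let e := MeasurableEquiv.piFinSuccAbove (fun _ : Fin (m + 1) => ℝ) i
  have he : MeasurePreserving e := volume_preserving_piFinSuccAbove (fun _ : Fin (m + 1) => ℝ) i
  have hsub : {x ∈ unitCube (m + 1) | ∃ t, |t| ≤ r ∧ g (x + t • Pi.single i 1) = 0} ⊆
      ⋃ j, e ⁻¹' (Tset j ×ˢ (dropCoord i '' V j)) := by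
    rintro x ⟨hx, t, ht, hxt⟩
    set z := x + t • Pi.single i (1 : ℝ) with hz
    have hzi : z i = x i + t := by simp [hz]
    have hzj : ∀ j, z (i.succAbove j) = x (i.succAbove j) := fun j => by simp [hz]
    set l := ⌊z i⌋ with hl
    set w : Fin (m + 1) → ℝ := z + fun j => ((Pi.single i (-l) : Fin (m + 1) → ℤ) j : ℝ) with hw
    have hwi : w i = Int.fract (z i) := by simp [hw, Int.fract, sub_eq_add_neg, hl]
    have hwj : ∀ j, w (i.succAbove j) = x (i.succAbove j) := fun j => by simp [hw, hzj]
    have hwZ : w ∈ Z := by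
      refine ⟨fun j _ => ?_, ?_⟩
      · rcases Fin.eq_self_or_eq_succAbove i j with rfl | ⟨j, rfl⟩
        · rw [hwi]; exact ⟨Int.fract_nonneg _, Int.fract_lt_one _⟩
        · rw [hwj]; exact hx _ (Set.mem_univ _)
      · rw [hw, hper]; exact hxt
    refine Set.mem_iUnion.2 ⟨⌊w i / r⌋, ?_, w, ⟨hwZ, rfl⟩, ?_⟩
    · have hxi := hx i (Set.mem_univ i)
      have h1 := Int.floor_le (w i / r)
      have h2 := Int.lt_floor_add_one (w i / r)
      rw [le_div_iff₀ hr] at h1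
      rw [div_lt_iff₀ hr] at h2
      have h3 : w i = x i + t - l := by rw [hwi, Int.fract, ← hzi]
      have h4 : (l : ℝ) ≤ x i + t := hzi ▸ Int.floor_le (z i)
      have h5 : x i + t < l + 1 := hzi ▸ Int.lt_floor_add_one (z i)
      obtain ⟨ht1, ht2⟩ := abs_le.1 ht
      have hi0 : 0 ≤ x i := hxi.1
      have hi1 : x i < 1 := hxi.2
      refine Set.mem_iUnion₂.2 ⟨l, ?_, ?_⟩
      · have h6 : (l : ℝ) ≤ L := by linarith
        have h7 : -(L : ℝ) ≤ l := by linarith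
        rw [Finset.mem_Icc]
        exact ⟨by exact_mod_cast h7, by exact_mod_cast h6⟩
      · change x i ∈ _
        constructor <;> linarith
    · funext j
      exact hwj j
  calc _ ≤ ∑' j, volume (e ⁻¹' (Tset j ×ˢ (dropCoord i '' V j))) :=
        (measure_mono hsub).trans (measure_iUnion_le _)
    _ = ∑' j, volume (Tset j) * volume (dropCoord i '' V j) := by
        refine tsum_congr fun j => ?_
        rw [he.measure_preimage_equiv, Measure.volume_eq_prod, Measure.prod_prod]
    _ ≤ ∑' j, ENNReal.ofReal ((2 * L + 1) * (4 * r)) * μH[m] (V j) := by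
        refine ENNReal.tsum_le_tsum fun j => mul_le_mul' (hTv j) ?_
        have e' : (μH[m] : Measure (Fin m → ℝ)) = volume := by
          simpa using hausdorffMeasure_pi_real (ι := Fin m)
        rw [← e']
        simpa using (lipschitzWith_dropCoord i).hausdorffMeasure_image_le (d := m) (by positivity) (V j)
    _ = ENNReal.ofReal ((2 * L + 1) * (4 * r)) * μH[m] (⋃ j, V j) := by
        rw [ENNReal.tsum_mul_left, measure_iUnion hVd hVm]
    _ ≤ _ := by
        gcongr
        exact Set.iUnion_subset fun j => Set.inter_subset_left

lemma isClosed_exists_zero {n : ℕ} {g : (Fin n → ℝ) → ℝ} (hg : Continuous g) (v : Fin n → ℝ) (r : ℝ) :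
    IsClosed {x | ∃ t, |t| ≤ r ∧ g (x + t • v) = 0} := by
  have h1 : IsClosed {p : (Fin n → ℝ) × Set.Icc (-r) r | g (p.1 + (p.2 : ℝ) • v) = 0} :=
    isClosed_eq (by fun_prop) continuous_const
  have h2 := isClosedMap_fst_of_compactSpace _ h1
  convert h2 using 1
  ext x
  constructor
  · rintro ⟨t, ht, hx⟩
    exact ⟨(x, ⟨t, abs_le.1 ht⟩), hx, rfl⟩
  · rintro ⟨⟨y, t⟩, hy, rfl⟩
    exact ⟨t, abs_le.2 t.2, hy⟩

/-- Periodic sets have translation-invariant volume in the unit cube. -/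
lemma volume_unitCube_preimage_add {n : ℕ} {S : Set (Fin n → ℝ)} (hS : MeasurableSet S)
    (hper : ∀ x (k : Fin n → ℤ), (x + fun i => (k i : ℝ)) ∈ S ↔ x ∈ S) (h : Fin n → ℝ) :
    volume {x ∈ unitCube n | x + h ∈ S} = volume {x ∈ unitCube n | x ∈ S} := by
  have hF : PiPeriodic (S.indicator fun _ => (1 : ℝ≥0∞)) := fun x k => by
    classical
    simp only [Set.indicator_apply, hper x k]
  have h1 := hF.setLIntegral_add h
  have h2 : ∀ h : Fin n → ℝ, ∫⁻ x in unitCube n, S.indicator (fun _ => (1 : ℝ≥0∞)) (x + h) =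
      volume {x ∈ unitCube n | x + h ∈ S} := fun h => by
    have hm : MeasurableSet {x | x + h ∈ S} := (measurable_add_const h) hS
    have : (fun x => S.indicator (fun _ => (1 : ℝ≥0∞)) (x + h)) = {x | x + h ∈ S}.indicator fun _ => 1 :=
      rfl
    rw [this, lintegral_indicator hm, Measure.restrict_restrict hm, setLIntegral_one, Set.inter_comm]
    rfl
  have h3 := h2 0
  simp only [add_zero] at h3
  rw [← h2 h, h1, h3]

/-- `h` with the coordinates from `k` on replaced by zero. -/
noncomputable def truncateFrom {n : ℕ} (h : Fin n → ℝ) (k : ℕ) : Fin n → ℝ :=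
  fun j => if (j : ℕ) < k then h j else 0

lemma truncateFrom_succ {n : ℕ} (h : Fin n → ℝ) (i : Fin n) :
    truncateFrom h (i + 1) = truncateFrom h i + h i • Pi.single i 1 := by
  funext j
  simp only [truncateFrom, Pi.add_apply, Pi.smul_apply, Pi.single_apply, smul_eq_mul, mul_ite, mul_one,
    mul_zero]
  by_cases hj : j = i
  · subst hj; simp
  · have h1 : (j : ℕ) ≠ i := fun e => hj (Fin.ext e)
    have h2 : (j : ℕ) < i + 1 ↔ (j : ℕ) < i := by omega
    simp [hj, h2]

lemma exists_zero_of_mul_neg {n : ℕ} {g : (Fin n → ℝ) → ℝ} (hg : Continuous g) {h : Fin n → ℝ} {r : ℝ}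
    (hr : ∀ i, |h i| ≤ r) {x : Fin n → ℝ} (hx : g x * g (x + h) < 0) :
    ∃ i : Fin n, ∃ t, |t| ≤ r ∧ g (x + truncateFrom h i + t • Pi.single i 1) = 0 := by
  by_contra! hcon
  have hx0 : g x ≠ 0 := fun e => by simp [e] at hx
  have key : ∀ k ≤ n, 0 < g x * g (x + truncateFrom h k) := by
    intro k hk
    induction k with
    | zero =>
      have : truncateFrom h 0 = 0 := by funext j; simp [truncateFrom]
      rw [this, add_zero]
      exact mul_self_pos.2 hx0
    | succ k ih =>
      have ih := ih (by omega)
      let i : Fin n := ⟨k, by omega⟩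
      have e := truncateFrom_succ h i
      change truncateFrom h (k + 1) = truncateFrom h k + _ at e
      rw [e, ← add_assoc]
      by_contra! hneg
      have hc : ContinuousOn (fun t : ℝ => g x * g (x + truncateFrom h k + (t * h i) • Pi.single i 1))
          (Set.Icc 0 1) := by fun_prop
      have := intermediate_value_Icc' zero_le_one hc
      obtain ⟨t, ht, ht0⟩ := this (show (0 : ℝ) ∈ Set.Icc _ _ from
        ⟨by simpa using hneg, by simpa using ih.le⟩)
      refine hcon i (t * h i) ?_ ((mul_eq_zero.1 ht0).resolve_left hx0)
      rw [abs_mul, abs_of_nonneg ht.1]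
      exact (mul_le_of_le_one_left (abs_nonneg _) ht.2).trans (hr i)
  have h1 := key n le_rfl
  have : truncateFrom h n = h := by funext j; simp [truncateFrom]
  rw [this] at h1
  exact lt_asymm h1 hx

lemma volume_mul_neg_le {m : ℕ} {g : (Fin (m + 1) → ℝ) → ℝ} (hg : Continuous g) (hper : PiPeriodic g)
    {h : Fin (m + 1) → ℝ} {r : ℝ} (hr0 : 0 < r) (hr : ∀ i, |h i| ≤ r) (L : ℕ) (hL : r + 1 ≤ L) :
    volume {x ∈ unitCube (m + 1) | g x * g (x + h) < 0} ≤
      (m + 1 : ℕ) * (ENNReal.ofReal ((2 * L + 1) * (4 * r)) *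
        μH[m] {x ∈ unitCube (m + 1) | g x = 0}) := by
  set S : Fin (m + 1) → Set (Fin (m + 1) → ℝ) := fun i => {x | ∃ t, |t| ≤ r ∧ g (x + t • Pi.single i 1) = 0}
    with hS
  have hsub : {x ∈ unitCube (m + 1) | g x * g (x + h) < 0} ⊆
      ⋃ i, {x ∈ unitCube (m + 1) | x + truncateFrom h i ∈ S i} := by
    rintro x ⟨hx, hneg⟩
    obtain ⟨i, t, ht, h0⟩ := exists_zero_of_mul_neg hg hr hneg
    exact Set.mem_iUnion.2 ⟨i, hx, t, ht, h0⟩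
  calc _ ≤ ∑ i, volume {x ∈ unitCube (m + 1) | x + truncateFrom h i ∈ S i} :=
        (measure_mono hsub).trans (measure_iUnion_fintype_le _ _)
    _ = ∑ i, volume {x ∈ unitCube (m + 1) | x ∈ S i} := by
        refine Finset.sum_congr rfl fun i _ => volume_unitCube_preimage_add
          (isClosed_exists_zero hg _ r).measurableSet (fun x k => ?_) _
        refine exists_congr fun t => and_congr_right fun _ => ?_
        rw [add_right_comm, hper]
    _ ≤ ∑ i : Fin (m + 1), ENNReal.ofReal ((2 * L + 1) * (4 * r)) *
          μH[m] {x ∈ unitCube (m + 1) | g x = 0} :=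
        Finset.sum_le_sum fun i _ => volume_exists_zero_le hg hper i hr0 L hL
    _ = _ := by simp

lemma continuous_trig {n : ℕ} {ι : Type*} (s : Finset ι) (κ : ι → Fin n → ℤ) (a : ι → ℂ) :
    Continuous (trig s κ a) := (contDiff_trig s κ a).continuous

/-- The points of the unit cube from which `P` grows by more than the factor `A` along a segment of
length at most `r` in the `i`-th direction. -/
def growthSet {n : ℕ} (P : (Fin n → ℝ) → ℂ) (i : Fin n) (A r : ℝ) : Set (Fin n → ℝ) :=
  {x ∈ unitCube n | ∃ σ, |σ| ≤ r ∧ A * ‖P x‖ < ‖P (x + σ • Pi.single i 1)‖}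

lemma measurableSet_growthSet {n : ℕ} {P : (Fin n → ℝ) → ℂ} (hP : Continuous P) (i : Fin n) (A r : ℝ) :
    MeasurableSet (growthSet P i A r) := by
  refine (measurableSet_unitCube n).inter (IsOpen.measurableSet ?_)
  have : {x | ∃ σ, |σ| ≤ r ∧ A * ‖P x‖ < ‖P (x + σ • Pi.single i 1)‖} =
      ⋃ σ, ⋃ _ : |σ| ≤ r, {x | A * ‖P x‖ < ‖P (x + σ • Pi.single i 1)‖} := by
    ext; simp
  change IsOpen {x | ∃ σ, |σ| ≤ r ∧ A * ‖P x‖ < ‖P (x + σ • Pi.single i 1)‖}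
  rw [this]
  exact isOpen_iUnion fun σ => isOpen_iUnion fun _ => isOpen_lt (by fun_prop) (by fun_prop)

lemma insertNth_eq_add {m : ℕ} (i : Fin (m + 1)) (t : ℝ) (y : Fin m → ℝ) :
    (i.insertNth t y : Fin (m + 1) → ℝ) = i.insertNth (0 : ℝ) y + t • Pi.single i 1 := by
  funext j
  rcases Fin.eq_self_or_eq_succAbove i j with rfl | ⟨j, rfl⟩ <;> simp

lemma exists_volume_growthSet_le {ε ρ : ℝ} (hε : 0 < ε) (hρ : 0 < ρ) : ∃ A > (0 : ℝ),
    ∀ {m : ℕ} {ι : Type} (s : Finset ι) (κ : ι → Fin (m + 1) → ℤ) (a : ι → ℂ) (d : ℕ) (_ : 1 ≤ d)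
      (_ : ∀ j ∈ s, ∀ i, |κ j i| ≤ d) (i : Fin (m + 1)),
      volume (growthSet (trig s κ a) i A (ρ / d)) ≤ ENNReal.ofReal ε := by
  obtain ⟨A, hA, h⟩ := exists_volume_trig_lt_le hε hρ
  refine ⟨A, hA, fun {m ι} s κ a d hd hκ i => ?_⟩
  set U := growthSet (trig s κ a) i A (ρ / d)
  have hU : MeasurableSet U := measurableSet_growthSet (continuous_trig s κ a) i _ _
  let e := MeasurableEquiv.piFinSuccAbove (fun _ : Fin (m + 1) => ℝ) i
  have he : MeasurePreserving e.symm :=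
    (volume_preserving_piFinSuccAbove (fun _ : Fin (m + 1) => ℝ) i).symm
  rw [← he.measure_preimage_equiv, Measure.volume_eq_prod, Measure.prod_apply_symm (e.symm.measurable hU)]
  calc _ ≤ ∫⁻ y, (unitCube m).indicator (fun _ => ENNReal.ofReal ε) y := by
        refine lintegral_mono fun y => ?_
        by_cases hy : y ∈ unitCube m
        · rw [Set.indicator_of_mem hy]
          refine (measure_mono ?_).trans (h s (fun j => a j * ee (freq (κ j) (i.insertNth (0 : ℝ) y)))
            (fun j => κ j i) d hd fun j hj => hκ j hj i)
          rintro t ⟨ht, σ, hσ, hlt⟩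
          have h1 : e.symm (t, y) = i.insertNth (0 : ℝ) y + t • Pi.single i 1 := insertNth_eq_add i t y
          rw [h1, add_assoc, ← add_smul, trig_add_smul_single, trig_add_smul_single] at hlt
          refine ⟨?_, σ, hσ, hlt⟩
          have h2 := ht i (Set.mem_univ i)
          rw [h1] at h2
          simpa using h2
        · rw [Set.indicator_of_notMem hy]
          refine le_of_eq ?_
          have hempty : (fun t : ℝ => (t, y)) ⁻¹' (e.symm ⁻¹' U) = ∅ := by
            refine Set.eq_empty_of_forall_notMem fun t ht => hy fun j _ => ?_
            have h1 : e.symm (t, y) = i.insertNth (0 : ℝ) y + t • Pi.single i 1 := insertNth_eq_add i t y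
            have h2 := ht.1 (i.succAbove j) (Set.mem_univ _)
            rw [h1] at h2
            simpa using h2
          rw [hempty, measure_empty]
    _ = _ := by rw [lintegral_indicator (measurableSet_unitCube m)]; simp [volume_unitCube]

lemma setIntegral_trig_add {n : ℕ} {ι : Type*} (s : Finset ι) (κ : ι → Fin n → ℤ) (a : ι → ℂ)
    (x : Fin n → ℝ) (i : Fin n) (r : ℝ) :
    ∫ t in Set.Icc (-r) r, trig s κ a (x + t • Pi.single i 1) =
      trig s κ (fun j => (∫ t in Set.Icc (-r) r, ee (κ j i * t)) * a j) x := by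
  have hc : ∀ j, Continuous fun t : ℝ => ee (κ j i * t) := fun j => continuous_ee.comp (by fun_prop)
  simp only [trig_add_smul_single]
  rw [integral_finsetSum _ fun j _ => ((hc j).const_mul _).continuousOn.integrableOn_Icc]
  refine Finset.sum_congr rfl fun j _ => ?_
  rw [integral_const_mul]
  ring

lemma setIntegral_pi_trig_add {n : ℕ} {ι : Type*} (s : Finset ι) (κ : ι → Fin n → ℤ) (a : ι → ℂ)
    (x : Fin n → ℝ) (r : ℝ) :
    ∫ h in Set.univ.pi fun _ => Set.Icc (-r) r, trig s κ a (x + h) =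
      trig s κ (fun j => (∏ i, ∫ t in Set.Icc (-r) r, ee (κ j i * t)) * a j) x := by
  have hc : ∀ j, Continuous fun h : Fin n → ℝ => ee (freq (κ j) h) := fun j =>
    contDiff_ee.continuous.comp (contDiff_freq _).continuous
  have hK : IsCompact (Set.univ.pi fun _ : Fin n => Set.Icc (-r) r) := isCompact_univ_pi fun _ => isCompact_Icc
  have hint : ∀ j, ∫ h in Set.univ.pi fun _ : Fin n => Set.Icc (-r) r, ee (freq (κ j) h) =
      ∏ i, ∫ t in Set.Icc (-r) r, ee (κ j i * t) := fun j => by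
    rw [volume_pi, Measure.restrict_pi_pi, ← integral_fintype_prod_eq_prod]
    refine integral_congr_ae (Filter.Eventually.of_forall fun h => ?_)
    simp only [freq, ee, ← Complex.exp_sum]
    congr 1
    push_cast
    rw [Finset.mul_sum, Finset.sum_mul]
  simp only [trig, freq_add, ee_add, ← mul_assoc]
  rw [integral_finsetSum _ fun j _ => ((hc j).const_mul _).continuousOn.integrableOn_compact hK]
  refine Finset.sum_congr rfl fun j _ => ?_
  rw [integral_const_mul, hint]
  ring

lemma norm_setIntegral_trig_add_le {n : ℕ} {ι : Type*} (s : Finset ι) (κ : ι → Fin n → ℤ) (a : ι → ℂ)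
    (i : Fin n) {A r : ℝ} (hr : 0 ≤ r) {x : Fin n → ℝ} (hx : x ∈ unitCube n)
    (hxg : x ∉ growthSet (trig s κ a) i A r) :
    ‖trig s κ (fun j => (∫ t in Set.Icc (-r) r, ee (κ j i * t)) * a j) x‖ ≤
      2 * r * A * ‖trig s κ a x‖ := by
  rw [← setIntegral_trig_add]
  have h1 : ∀ t ∈ Set.Icc (-r) r, ‖trig s κ a (x + t • Pi.single i 1)‖ ≤ A * ‖trig s κ a x‖ := by
    intro t ht
    by_contra! hlt
    exact hxg ⟨hx, t, abs_le.2 ht, hlt⟩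
  refine (norm_setIntegral_le_of_norm_le_const (by simp) h1).trans (le_of_eq ?_)
  rw [measureReal_def, Real.volume_Icc, ENNReal.toReal_ofReal (by linarith)]
  ring

lemma exists_good_set (m : ℕ) {ρ : ℝ} (hρ : 0 < ρ) : ∃ B > (0 : ℝ),
    ∀ (s : Finset (Fin (m + 1) → ℤ)) (a : (Fin (m + 1) → ℤ) → ℂ) (g : (Fin (m + 1) → ℝ) → ℝ) (d : ℕ),
      1 ≤ d → IsTrig s a g → (∀ k ∈ s, ∀ i, |k i| ≤ d) →
      ∃ G ⊆ unitCube (m + 1), MeasurableSet G ∧ 1 / 2 ≤ volume G ∧ ∀ x ∈ G,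
        ∫ h in Set.univ.pi fun _ => Set.Icc (-(ρ / d)) (ρ / d), g (x + h) ^ 2 ≤
          B / d ^ (m + 1) * g x ^ 2 := by
  obtain ⟨A, hA, hbad⟩ := exists_volume_growthSet_le (ε := 1 / (2 * (m + 1))) (ρ := 2 * ρ)
    (by positivity) (by positivity)
  refine ⟨(2 * ρ * A) ^ (m + 1), by positivity, fun s a g d hd hg hk => ?_⟩
  have hd0 : (0 : ℝ) < d := by exact_mod_cast hd
  set r := ρ / d with hr
  have hr0 : 0 < r := by positivity
  set κ : (Fin (m + 1) → ℤ) × (Fin (m + 1) → ℤ) → Fin (m + 1) → ℤ := fun p => p.1 + p.2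
  set b : (Fin (m + 1) → ℤ) × (Fin (m + 1) → ℤ) → ℂ := fun p => a p.1 * a p.2
  have hsq : ∀ x, ((g x ^ 2 : ℝ) : ℂ) = trig (s ×ˢ s) κ b x := fun x => by
    push_cast
    rw [hg x, sq, trig, Finset.sum_mul_sum, ← Finset.sum_product', trig]
    refine Finset.sum_congr rfl fun p _ => ?_
    have : freq (κ p) x = freq p.1 x + freq p.2 x := by
      simp only [κ, freq, Pi.add_apply, ← Finset.sum_add_distrib]
      refine Finset.sum_congr rfl fun i _ => ?_
      push_cast
      ring
    rw [this, ee_add]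
    simp only [b, id]
    ring
  have hκ : ∀ p ∈ s ×ˢ s, ∀ i, |κ p i| ≤ (2 * d : ℕ) := fun p hp i => by
    rw [Finset.mem_product] at hp
    have h1 := hk _ hp.1 i
    have h2 := hk _ hp.2 i
    push_cast
    calc |p.1 i + p.2 i| ≤ |p.1 i| + |p.2 i| := abs_add_le _ _
      _ ≤ 2 * d := by linarith
  have hrr : 2 * ρ / (2 * d : ℕ) = r := by
    rw [hr]; push_cast; field_simp
  set c : (Fin (m + 1) → ℤ) × (Fin (m + 1) → ℤ) → Fin (m + 1) → ℂ :=
    fun p i => ∫ t in Set.Icc (-r) r, ee (κ p i * t) with hc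
  have hind : ∀ T : Finset (Fin (m + 1)), ∃ W, MeasurableSet W ∧
      volume W ≤ T.card * ENNReal.ofReal (1 / (2 * (m + 1))) ∧
      ∀ x ∈ unitCube (m + 1), x ∉ W → ‖trig (s ×ˢ s) κ (fun p => (∏ i ∈ T, c p i) * b p) x‖ ≤
        (2 * r * A) ^ T.card * ‖trig (s ×ˢ s) κ b x‖ := by
    intro T
    induction T using Finset.induction_on with
    | empty => exact ⟨∅, MeasurableSet.empty, by simp, fun x _ _ => by simp⟩
    | insert i T hi ih =>
      obtain ⟨W, hWm, hW, hWx⟩ := ih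
      set P := trig (s ×ˢ s) κ (fun p => (∏ i ∈ T, c p i) * b p) with hP
      refine ⟨W ∪ growthSet P i A r, hWm.union (measurableSet_growthSet (continuous_trig _ _ _) _ _ _),
        ?_, fun x hx hxW => ?_⟩
      · refine (measure_union_le _ _).trans ?_
        have := hbad (s ×ˢ s) κ (fun p => (∏ i ∈ T, c p i) * b p) (2 * d) (by omega) hκ i
        rw [hrr] at this
        rw [Finset.card_insert_of_notMem hi]
        push_cast
        rw [add_mul, one_mul]
        exact add_le_add hW this
      · simp only [Set.mem_union, not_or] at hxW
        have h1 := norm_setIntegral_trig_add_le (s ×ˢ s) κ (fun p => (∏ i ∈ T, c p i) * b p) i hr0.le hx hxW.2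
        simp only [Finset.prod_insert hi, Finset.card_insert_of_notMem hi, mul_assoc (c _ i)]
        refine h1.trans ?_
        rw [pow_succ', mul_assoc (2 * r * A) (_ ^ _)]
        exact mul_le_mul_of_nonneg_left (hWx x hx hxW.1) (by positivity)
  obtain ⟨W, hWm, hW, hWx⟩ := hind Finset.univ
  have hWhalf : volume W ≤ 1 / 2 := by
    refine hW.trans (le_of_eq ?_)
    rw [Finset.card_univ, Fintype.card_fin, ← ENNReal.ofReal_natCast, ← ENNReal.ofReal_mul (by positivity)]
    have : ((m + 1 : ℕ) : ℝ) * (1 / (2 * (m + 1))) = 1 / 2 := by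
      push_cast; field_simp
    rw [this, ENNReal.ofReal_div_of_pos (by norm_num)]
    simp
  refine ⟨unitCube (m + 1) \ W, Set.sdiff_subset, (measurableSet_unitCube _).diff hWm, ?_, ?_⟩
  · refine le_trans ?_ le_measure_sdiff
    rw [volume_unitCube]
    refine le_trans (le_of_eq ?_) (tsub_le_tsub_left hWhalf 1)
    rw [one_div, ENNReal.one_sub_inv_two]
  · rintro x ⟨hx, hxW⟩
    have h1 := hWx x hx hxW
    have h2 := setIntegral_pi_trig_add (s ×ˢ s) κ b x r
    rw [← h2, Finset.card_univ, Fintype.card_fin] at h1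
    simp only [← hsq] at h1
    rw [integral_complex_ofReal, Complex.norm_real, Complex.norm_real] at h1
    refine (le_abs_self _).trans (h1.trans (le_of_eq ?_))
    rw [Real.norm_of_nonneg (sq_nonneg _), hr, ← div_pow]
    congr 2
    ring

section Kernel

open scoped RealInnerProductSpace

variable {V : Type*} [NormedAddCommGroup V] [InnerProductSpace ℝ V] [FiniteDimensional ℝ V]
  [MeasurableSpace V] [BorelSpace V]

lemma integrable_gaussian_mul_cexp {b : ℝ} (hb : 0 < b) (u : V) :
    Integrable fun v : V => (Real.exp (-b * ‖v‖ ^ 2) : ℂ) * Complex.exp (Complex.I * ⟪u, v⟫) := by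
  have := GaussianFourier.integrable_cexp_neg_mul_sq_norm_add (b := (b : ℂ)) (by simpa using hb) Complex.I u
  refine this.congr (Filter.Eventually.of_forall fun v => ?_)
  simp only [Complex.exp_add]
  push_cast
  rfl

lemma integral_gaussian_mul_cexp {b : ℝ} (hb : 0 < b) {u : V} (hu : ‖u‖ = 1) :
    ∫ v : V, (Real.exp (-b * ‖v‖ ^ 2) : ℂ) * Complex.exp (Complex.I * ⟪u, v⟫) =
      (((Real.pi / b) ^ ((Module.finrank ℝ V : ℝ) / 2) * Real.exp (-(1 / (4 * b))) : ℝ) : ℂ) := by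
  have := GaussianFourier.integral_cexp_neg_mul_sq_norm_add (b := (b : ℂ)) (by simpa using hb) Complex.I u
  simp only [Complex.exp_add] at this
  push_cast
  refine this.trans ?_
  rw [hu, Complex.I_sq, Complex.ofReal_cpow (by positivity)]
  push_cast
  congr 2
  ring

lemma exists_gaussian_lt (n : ℕ) : ∃ b > (0 : ℝ), b < 1 ∧
    (Real.pi / b) ^ ((n : ℝ) / 2) * Real.exp (-(1 / (4 * b))) <
      (Real.pi / 1) ^ ((n : ℝ) / 2) * Real.exp (-(1 / (4 * 1))) := by
  have h1 := (tendsto_rpow_mul_exp_neg_mul_atTop_nhds_zero ((n : ℝ) / 2) (1 / 4) (by norm_num)).const_mul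
    (Real.pi ^ ((n : ℝ) / 2))
  rw [mul_zero] at h1
  have hpos : 0 < (Real.pi / 1) ^ ((n : ℝ) / 2) * Real.exp (-(1 / (4 * 1))) := by positivity
  obtain ⟨x, hx, hx1⟩ := ((h1.eventually_lt_const hpos).and (Filter.eventually_gt_atTop 1)).exists
  have hx0 : 0 < x := by linarith
  refine ⟨x⁻¹, by positivity, inv_lt_one_of_one_lt₀ hx1, ?_⟩
  refine lt_of_eq_of_lt ?_ hx
  rw [div_inv_eq_mul, Real.mul_rpow Real.pi_pos.le hx0.le, mul_assoc]
  congr 3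
  field_simp

lemma integral_radial_mul_cexp_eq (D : ℝ → ℝ) {u v : V} (huv : ‖u‖ = ‖v‖) :
    ∫ h : V, (D ‖h‖ : ℂ) * Complex.exp (Complex.I * ⟪u, h⟫) =
      ∫ h : V, (D ‖h‖ : ℂ) * Complex.exp (Complex.I * ⟪v, h⟫) := by
  set T : V ≃ₗᵢ[ℝ] V := (ℝ ∙ (u - v))ᗮ.reflection with hT
  have hTu : T u = v := Submodule.reflection_sub huv
  have h1 := T.measurePreserving.integral_comp T.toHomeomorph.measurableEmbedding
    fun h => (D ‖h‖ : ℂ) * Complex.exp (Complex.I * ⟪v, h⟫)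
  rw [← h1]
  congr 1
  funext h
  rw [T.norm_map, ← hTu, T.inner_map_map]

lemma integral_radial_mul_cexp_im (D : ℝ → ℝ) (u : V) :
    (∫ h : V, (D ‖h‖ : ℂ) * Complex.exp (Complex.I * ⟪u, h⟫)).im = 0 := by
  rw [← Complex.conj_eq_iff_im, ← integral_conj,
    integral_radial_mul_cexp_eq D (u := u) (v := -u) (norm_neg u).symm]
  congr 1
  funext h
  rw [map_mul, ← Complex.exp_conj, map_mul, Complex.conj_I, Complex.conj_ofReal, Complex.conj_ofReal,
    inner_neg_left]
  push_cast
  ring_nf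

/-- There is a radial, compactly supported, nonnegative profile whose Fourier transform is negative
on the unit sphere. -/
lemma exists_radial_profile (u₀ : V) (hu₀ : ‖u₀‖ = 1) : ∃ R > (0 : ℝ), ∃ c > (0 : ℝ), ∃ D : ℝ → ℝ,
    Measurable D ∧ (∀ t, 0 ≤ D t ∧ D t ≤ 1) ∧ (∀ t, R < t → D t = 0) ∧
    ∀ u : V, ‖u‖ = 1 → ∫ h : V, (D ‖h‖ : ℂ) * Complex.exp (Complex.I * ⟪u, h⟫) = ((-c : ℝ) : ℂ) := by
  obtain ⟨b, hb, hb1, hlt⟩ := exists_gaussian_lt (Module.finrank ℝ V)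
  set f : V → ℂ := fun v => ((Real.exp (-b * ‖v‖ ^ 2) - Real.exp (-1 * ‖v‖ ^ 2) : ℝ) : ℂ) *
    Complex.exp (Complex.I * ⟪u₀, v⟫) with hf
  have hfe : f = fun v => (Real.exp (-b * ‖v‖ ^ 2) : ℂ) * Complex.exp (Complex.I * ⟪u₀, v⟫) -
      (Real.exp (-1 * ‖v‖ ^ 2) : ℂ) * Complex.exp (Complex.I * ⟪u₀, v⟫) := by
    funext v; simp only [hf]; push_cast; ring
  have hfi : Integrable f := by
    rw [hfe]
    exact (integrable_gaussian_mul_cexp hb u₀).sub (integrable_gaussian_mul_cexp one_pos u₀)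
  have hneg : (∫ v, f v).re < 0 := by
    rw [hfe, integral_sub (integrable_gaussian_mul_cexp hb u₀) (integrable_gaussian_mul_cexp one_pos u₀),
      integral_gaussian_mul_cexp hb hu₀, integral_gaussian_mul_cexp one_pos hu₀,
      Complex.sub_re, Complex.ofReal_re, Complex.ofReal_re]
    linarith
  have hlim := (aecover_closedBall (μ := (volume : Measure V)) (x := 0)
    (Filter.tendsto_id (α := ℝ) (x := Filter.atTop))).integral_tendsto_of_countably_generated hfi
  obtain ⟨R, hR, hR0⟩ := ((((Complex.continuous_re.tendsto _).comp hlim).eventually_lt_const hneg).and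
    (Filter.eventually_gt_atTop 0)).exists
  set D : ℝ → ℝ := (Set.Iic R).indicator
    fun t => Real.exp (-b * |t| ^ 2) - Real.exp (-1 * |t| ^ 2) with hD
  have hDf : ∀ h : V, (D ‖h‖ : ℂ) * Complex.exp (Complex.I * ⟪u₀, h⟫) =
      (Metric.closedBall (0 : V) (id R)).indicator f h := by
    intro h
    by_cases hh : ‖h‖ ≤ R
    · rw [Set.indicator_of_mem (by simpa using hh)]
      simp only [hD, Set.indicator_of_mem (show ‖h‖ ∈ Set.Iic R from hh), abs_norm, hf]
    · rw [Set.indicator_of_notMem (by simpa using hh)]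
      simp only [hD, Set.indicator_of_notMem (show ‖h‖ ∉ Set.Iic R from hh), Complex.ofReal_zero, zero_mul]
  have hI : ∫ h : V, (D ‖h‖ : ℂ) * Complex.exp (Complex.I * ⟪u₀, h⟫) =
      ∫ h in Metric.closedBall (0 : V) (id R), f h := by
    simp only [hDf]
    exact integral_indicator Metric.isClosed_closedBall.measurableSet
  refine ⟨R, hR0, -(∫ h in Metric.closedBall (0 : V) (id R), f h).re, neg_pos.2 hR, D, ?_, ?_, ?_, ?_⟩
  · exact Measurable.indicator (by fun_prop) measurableSet_Iic
  · intro t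
    refine ⟨Set.indicator_nonneg (fun t _ => ?_) t, ?_⟩
    · rw [sub_nonneg, Real.exp_le_exp]
      nlinarith [sq_nonneg |t|]
    · refine Set.indicator_le' (s := Set.Iic R) (g := fun _ => (1 : ℝ)) (fun t _ => ?_) (fun _ _ => zero_le_one) t
      have h1 : Real.exp (-b * |t| ^ 2) ≤ 1 := Real.exp_le_one_iff.2 (by nlinarith [sq_nonneg |t|])
      linarith [Real.exp_pos (-1 * |t| ^ 2)]
  · intro t ht
    exact Set.indicator_of_notMem (by simpa using ht) _
  · intro u hu
    rw [integral_radial_mul_cexp_eq D (hu.trans hu₀.symm)]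
    refine Complex.ext ?_ ?_
    · rw [neg_neg, Complex.ofReal_re, hI]
    · rw [integral_radial_mul_cexp_im, Complex.ofReal_im]

end Kernel

lemma exists_kernel (m : ℕ) : ∃ R > (0 : ℝ), ∃ c > (0 : ℝ), ∃ K : (Fin (m + 1) → ℝ) → ℝ,
    Measurable K ∧ (∀ h, 0 ≤ K h ∧ K h ≤ 1) ∧ (∀ h i, R < |h i| → K h = 0) ∧
    ∀ u : Fin (m + 1) → ℝ, ∑ i, u i ^ 2 = 1 →
      ∫ h, (K h : ℂ) * Complex.exp (Complex.I * (∑ i, u i * h i : ℝ)) = ((-c : ℝ) : ℂ) := by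
  obtain ⟨R, hR, c, hc, D, hDm, hD01, hD0, hD⟩ := exists_radial_profile
    (EuclideanSpace.single (0 : Fin (m + 1)) (1 : ℝ)) (by simp)
  refine ⟨R, hR, c, hc, fun h => D ‖WithLp.toLp 2 h‖, ?_, fun h => hD01 _, fun h i hi => hD0 _ ?_, ?_⟩
  · exact hDm.comp ((PiLp.continuous_toLp 2 _).measurable.norm)
  · exact hi.trans_le (PiLp.norm_apply_le (WithLp.toLp 2 h) i)
  · intro u hu
    have h1 := hD (WithLp.toLp 2 u) (by rw [EuclideanSpace.norm_eq]; simp [hu])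
    rw [← h1, ← (PiLp.volume_preserving_toLp (Fin (m + 1))).integral_comp
      (MeasurableEquiv.toLp 2 _).measurableEmbedding]
    congr 1
    funext h
    congr 4
    simp [PiLp.inner_apply, mul_comm]

/-- The cube centred at the origin with half-side `r`. -/
def centredCube (n : ℕ) (r : ℝ) : Set (Fin n → ℝ) := Set.univ.pi fun _ => Set.Icc (-r) r

lemma measurableSet_centredCube (n : ℕ) (r : ℝ) : MeasurableSet (centredCube n r) :=
  MeasurableSet.univ_pi fun _ => measurableSet_Icc

lemma isCompact_centredCube (n : ℕ) (r : ℝ) : IsCompact (centredCube n r) :=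
  isCompact_univ_pi fun _ => isCompact_Icc

lemma volume_centredCube (n : ℕ) (r : ℝ) :
    volume (centredCube n r) = ENNReal.ofReal (2 * r) ^ n := by
  rw [centredCube, volume_pi_pi]
  simp [Real.volume_Icc, two_mul]

lemma exists_lt_abs_of_notMem_centredCube {n : ℕ} {r : ℝ} {h : Fin n → ℝ} (hh : h ∉ centredCube n r) :
    ∃ i, r < |h i| := by
  by_contra! H
  exact hh fun i _ => ⟨(abs_le.1 (H i)).1, (abs_le.1 (H i)).2⟩

section MeanValue

variable {n : ℕ} {K : (Fin n → ℝ) → ℝ} {R c lam r : ℝ}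

lemma integral_kernel_mul_ee
    (hK : ∀ u : Fin n → ℝ, ∑ i, u i ^ 2 = 1 →
      ∫ h, (K h : ℂ) * Complex.exp (Complex.I * (∑ i, u i * h i : ℝ)) = ((-c : ℝ) : ℂ))
    (hlam : 0 < lam) {k : Fin n → ℤ} (hk : 4 * Real.pi ^ 2 * ∑ i, (k i : ℝ) ^ 2 = lam ^ 2) :
    ∫ h, (K (lam • h) : ℂ) * ee (freq k h) = ((-(c / lam ^ n) : ℝ) : ℂ) := by
  set f : (Fin n → ℝ) → ℂ := fun h =>
    (K h : ℂ) * Complex.exp (Complex.I * (∑ i, (2 * Real.pi * k i / lam) * h i : ℝ)) with hf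
  have h1 : ∀ h, (K (lam • h) : ℂ) * ee (freq k h) = f (lam • h) := by
    intro h
    simp only [hf, ee, freq, Pi.smul_apply, smul_eq_mul]
    congr 2
    push_cast
    rw [Finset.mul_sum, Finset.mul_sum, Finset.sum_mul]
    refine Finset.sum_congr rfl fun i _ => ?_
    have : (lam : ℂ) ≠ 0 := by exact_mod_cast hlam.ne'
    field_simp
  simp only [h1]
  rw [Measure.integral_comp_smul_of_nonneg (μ := volume) f lam (hR := hlam.le), hK]
  · simp [div_eq_inv_mul, mul_comm]
  · simp only [div_pow, mul_pow, ← Finset.sum_div, ← Finset.mul_sum]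
    rw [div_eq_one_iff_eq (by positivity), ← hk]
    norm_num

lemma IsTrig.setIntegral_kernel_mul {s : Finset (Fin n → ℤ)} {a : (Fin n → ℤ) → ℂ}
    {g : (Fin n → ℝ) → ℝ} (hg : IsTrig s a g)
    (hKm : Measurable K) (hK01 : ∀ h, 0 ≤ K h ∧ K h ≤ 1) (hKR : ∀ h i, R < |h i| → K h = 0)
    (hK : ∀ u : Fin n → ℝ, ∑ i, u i ^ 2 = 1 →
      ∫ h, (K h : ℂ) * Complex.exp (Complex.I * (∑ i, u i * h i : ℝ)) = ((-c : ℝ) : ℂ))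
    (hlam : 0 < lam) (hs : ∀ k ∈ s, 4 * Real.pi ^ 2 * ∑ i, (k i : ℝ) ^ 2 = lam ^ 2)
    (hr : R ≤ lam * r) (x : Fin n → ℝ) :
    ∫ h in centredCube n r, K (lam • h) * g (x + h) = -(c / lam ^ n * g x) := by
  have hK0 : ∀ h, h ∉ centredCube n r → K (lam • h) = 0 := fun h hh => by
    obtain ⟨i, hi⟩ := exists_lt_abs_of_notMem_centredCube hh
    refine hKR _ i (hr.trans_lt ?_)
    rw [Pi.smul_apply, smul_eq_mul, abs_mul, abs_of_pos hlam]
    exact mul_lt_mul_of_pos_left hi hlam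
  have hint : ∀ k : Fin n → ℤ, ∫ h in centredCube n r, (K (lam • h) : ℂ) * ee (freq k h) =
      ∫ h, (K (lam • h) : ℂ) * ee (freq k h) := fun k =>
    setIntegral_eq_integral_of_forall_compl_eq_zero fun h hh => by simp [hK0 h hh]
  have hi : ∀ k : Fin n → ℤ, IntegrableOn (fun h => (K (lam • h) : ℂ) * ee (freq k h))
      (centredCube n r) := fun k => by
    refine Measure.integrableOn_of_bounded (M := 1) (isCompact_centredCube n r).measure_lt_top.ne ?_ ?_
    · refine (Measurable.mul ?_ ?_).aestronglyMeasurable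
      · exact (hKm.comp (measurable_const_smul lam)).complex_ofReal
      · exact (contDiff_ee.comp (contDiff_freq k)).continuous.measurable
    · refine Filter.Eventually.of_forall fun h => ?_
      rw [norm_mul, norm_ee, mul_one, Complex.norm_real, Real.norm_of_nonneg (hK01 _).1]
      exact (hK01 _).2
  apply Complex.ofReal_injective
  rw [← integral_complex_ofReal]
  have h2 : ∀ h, ((K (lam • h) * g (x + h) : ℝ) : ℂ) =
      ∑ k ∈ s, (a k * ee (freq k x)) * ((K (lam • h) : ℂ) * ee (freq k h)) := fun h => by
    rw [Complex.ofReal_mul, hg, trig, Finset.mul_sum]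
    refine Finset.sum_congr rfl fun k _ => ?_
    rw [id, freq_add, ee_add]
    ring
  refine (integral_congr_ae (Filter.Eventually.of_forall h2)).trans ?_
  rw [integral_finsetSum _ fun k _ => (hi k).const_mul _]
  simp only [integral_const_mul, hint]
  rw [Finset.sum_congr rfl fun k hk => by rw [integral_kernel_mul_ee hK hlam (hs k hk)],
    ← Finset.sum_mul]
  have h3 := hg x
  simp only [trig, id] at h3
  rw [← h3, ← Complex.ofReal_mul]
  congr 1
  ring

end MeanValue

lemma div_le_volume_mul_neg {n : ℕ} {g w : (Fin n → ℝ) → ℝ} (hg : Continuous g) (hw : Measurable w)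
    (hw01 : ∀ h, 0 ≤ w h ∧ w h ≤ 1) {r C B : ℝ} (hC : 0 < C) (hB : 0 < B) {x : Fin n → ℝ}
    (hx : g x ≠ 0) (hmean : ∫ h in centredCube n r, w h * g (x + h) = -(C * g x))
    (hsq : ∫ h in centredCube n r, g (x + h) ^ 2 ≤ B * g x ^ 2) :
    ENNReal.ofReal (C ^ 2 / B) ≤ volume {h ∈ centredCube n r | g x * g (x + h) < 0} := by
  set Q := centredCube n r with hQ
  set N : Set (Fin n → ℝ) := {h | g x * g (x + h) < 0} with hN
  have hNm : MeasurableSet N := (isOpen_lt (by fun_prop) continuous_const).measurableSet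
  have hQc : IsCompact Q := isCompact_centredCube n r
  have hvol : volume (N ∩ Q) ≠ ⊤ := (measure_mono Set.inter_subset_right).trans_lt hQc.measure_lt_top |>.ne
  have hi1 : IntegrableOn (fun h => g (x + h)) Q :=
    (by fun_prop : Continuous fun h => g (x + h)).continuousOn.integrableOn_compact hQc
  have hi2 : IntegrableOn (fun h => g (x + h) ^ 2) Q :=
    (by fun_prop : Continuous fun h => g (x + h) ^ 2).continuousOn.integrableOn_compact hQc
  have hi3 : IntegrableOn (fun h => w h * g (x + h)) Q := by
    refine Integrable.bdd_mul (c := 1) hi1 hw.aestronglyMeasurable (Filter.Eventually.of_forall fun h => ?_)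
    rw [Real.norm_of_nonneg (hw01 h).1]
    exact (hw01 h).2
  have hi4 : IntegrableOn (N.indicator fun _ => (1 : ℝ)) Q :=
    (integrableOn_const hQc.measure_lt_top.ne).indicator hNm
  have hpt : ∀ h, -g x * (w h * g (x + h)) ≤
      C / (2 * B) * g (x + h) ^ 2 + g x ^ 2 * B / (2 * C) * N.indicator (fun _ => (1 : ℝ)) h := by
    intro h
    by_cases hh : h ∈ N
    · rw [Set.indicator_of_mem hh]
      have h1 : -g x * (w h * g (x + h)) ≤ -(g x * g (x + h)) := by
        have : g x * g (x + h) < 0 := hh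
        nlinarith [(hw01 h).2]
      refine h1.trans ?_
      have h2 : C / (2 * B) * g (x + h) ^ 2 + g x ^ 2 * B / (2 * C) * 1 - -(g x * g (x + h)) =
        (C * g (x + h) + B * g x) ^ 2 / (2 * B * C) := by field_simp; ring
      have h3 : 0 ≤ (C * g (x + h) + B * g x) ^ 2 / (2 * B * C) := by positivity
      linarith
    · rw [Set.indicator_of_notMem hh]
      have : 0 ≤ g x * g (x + h) := not_lt.1 hh
      have h1 : 0 ≤ C / (2 * B) * g (x + h) ^ 2 := by positivity
      nlinarith [mul_nonneg (hw01 h).1 this]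
  have hI : ∫ h in Q, -g x * (w h * g (x + h)) ≤ ∫ h in Q, (C / (2 * B) * g (x + h) ^ 2 +
      g x ^ 2 * B / (2 * C) * N.indicator (fun _ => (1 : ℝ)) h) :=
    integral_mono (hi3.const_mul _) ((hi2.const_mul _).add (hi4.const_mul _)) hpt
  rw [integral_add (hi2.const_mul _) (hi4.const_mul _), integral_const_mul, integral_const_mul,
    integral_const_mul, hmean, integral_indicator_const _ hNm, measureReal_restrict_apply hNm] at hI
  have hset : {h ∈ Q | g x * g (x + h) < 0} = N ∩ Q := Set.inter_comm _ _
  rw [hset, ← ENNReal.ofReal_toReal hvol]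
  refine ENNReal.ofReal_le_ofReal ?_
  change C ^ 2 / B ≤ volume.real (N ∩ Q)
  set V := volume.real (N ∩ Q)
  have hgx : 0 < g x ^ 2 := by positivity
  have h5 : C / (2 * B) * ∫ h in Q, g (x + h) ^ 2 ≤ C / (2 * B) * (B * g x ^ 2) :=
    mul_le_mul_of_nonneg_left hsq (by positivity)
  have h6 : C / (2 * B) * (B * g x ^ 2) = g x ^ 2 * (C / 2) := by field_simp
  have h7 : g x ^ 2 * (C / 2) ≤ g x ^ 2 * (B / (2 * C) * V) := by
    have : g x ^ 2 * B / (2 * C) * (V • 1) = g x ^ 2 * (B / (2 * C) * V) := by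
      rw [smul_eq_mul]; ring
    nlinarith
  have h8 := le_of_mul_le_mul_left h7 hgx
  rw [div_le_iff₀ hB]
  have h9 : B / (2 * C) * V = V * B / (2 * C) := by ring
  rw [h9, le_div_iff₀ (by positivity)] at h8
  nlinarith

lemma volume_zeros_eq_zero {m : ℕ} {g : (Fin (m + 1) → ℝ) → ℝ}
    (hfin : μH[m] {x ∈ unitCube (m + 1) | g x = 0} ≠ ⊤) :
    volume {x ∈ unitCube (m + 1) | g x = 0} = 0 := by
  have h := (Measure.hausdorffMeasure_zero_or_top (X := Fin (m + 1) → ℝ) (d₁ := m) (d₂ := (m + 1 : ℕ))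
    (by push_cast; linarith) {x ∈ unitCube (m + 1) | g x = 0}).resolve_right hfin
  rw [← hausdorffMeasure_pi_real]
  simpa using h

lemma exists_volume_mul_neg_ge {n : ℕ} {g : (Fin n → ℝ) → ℝ} (hg : Continuous g) {r : ℝ} (hr : 0 < r)
    {η : ℝ} (hη : 0 < η) {G : Set (Fin n → ℝ)} (hG : G ⊆ unitCube n) (hGm : MeasurableSet G)
    (hGv : 1 / 2 ≤ volume G) (hGh : ∀ x ∈ G, ENNReal.ofReal η * volume (centredCube n r) ≤
      volume {h ∈ centredCube n r | g x * g (x + h) < 0}) :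
    ∃ h ∈ centredCube n r, ENNReal.ofReal (η / 4) ≤ volume {x ∈ unitCube n | g x * g (x + h) < 0} := by
  by_contra! H
  set Q := centredCube n r with hQ
  have hQ0 : volume Q ≠ 0 := by rw [hQ, volume_centredCube]; simp [hr]
  have hQt : volume Q ≠ ⊤ := (isCompact_centredCube n r).measure_lt_top.ne
  set F : (Fin n → ℝ) → (Fin n → ℝ) → ℝ≥0∞ := fun x h =>
    Set.indicator {p : (Fin n → ℝ) × (Fin n → ℝ) | g p.1 * g (p.1 + p.2) < 0} 1 (x, h) with hF
  have hFm : Measurable (Function.uncurry F) :=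
    measurable_one.indicator (isOpen_lt (by fun_prop) continuous_const).measurableSet
  have e1 : ∀ x, ∫⁻ h in Q, F x h = volume {h ∈ Q | g x * g (x + h) < 0} := by
    intro x
    have hm : MeasurableSet {h | g x * g (x + h) < 0} :=
      (isOpen_lt (by fun_prop) continuous_const).measurableSet
    have : ∀ h, F x h = Set.indicator {h | g x * g (x + h) < 0} 1 h := fun h => rfl
    simp only [this]
    rw [lintegral_indicator_one hm, Measure.restrict_apply hm, Set.inter_comm]
    rfl
  have e2 : ∀ h, ∫⁻ x in unitCube n, F x h = volume {x ∈ unitCube n | g x * g (x + h) < 0} := by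
    intro h
    have hm : MeasurableSet {x | g x * g (x + h) < 0} :=
      (isOpen_lt (by fun_prop) continuous_const).measurableSet
    have : ∀ x, F x h = Set.indicator {x | g x * g (x + h) < 0} 1 x := fun h => rfl
    simp only [this]
    rw [lintegral_indicator_one hm, Measure.restrict_apply hm, Set.inter_comm]
    rfl
  have h1 : ENNReal.ofReal η * volume Q * (1 / 2) ≤ ENNReal.ofReal (η / 4) * volume Q := calc
    _ ≤ ENNReal.ofReal η * volume Q * volume G := by gcongr
    _ = ∫⁻ _ in G, ENNReal.ofReal η * volume Q := by rw [setLIntegral_const]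
    _ ≤ ∫⁻ x in G, ∫⁻ h in Q, F x h := setLIntegral_mono' hGm fun x hx => by
      rw [e1]; exact hGh x hx
    _ ≤ ∫⁻ x in unitCube n, ∫⁻ h in Q, F x h := lintegral_mono_set hG
    _ = ∫⁻ h in Q, ∫⁻ x in unitCube n, F x h := lintegral_lintegral_swap hFm.aemeasurable
    _ ≤ ∫⁻ _ in Q, ENNReal.ofReal (η / 4) := setLIntegral_mono' (measurableSet_centredCube n r)
      fun h hh => by rw [e2]; exact (H h hh).le
    _ = _ := by rw [setLIntegral_const]
  have h2 : ENNReal.ofReal (η / 2) * volume Q ≤ ENNReal.ofReal (η / 4) * volume Q := by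
    refine le_trans (le_of_eq ?_) h1
    rw [ENNReal.ofReal_div_of_pos two_pos]
    simp [div_eq_mul_inv, mul_right_comm]
  rw [ENNReal.mul_le_mul_iff_left hQ0 hQt, ENNReal.ofReal_le_ofReal_iff (by positivity)] at h2
  linarith

namespace IsTrig

lemma exists_degree {n : ℕ} {s : Finset (Fin n → ℤ)} {a : (Fin n → ℤ) → ℂ}
    {g : (Fin n → ℝ) → ℝ} (h : IsTrig s a g) (hg : g ≠ 0) {lam : ℝ} (hlam : 0 < lam)
    (hs : ∀ k ∈ s, 4 * Real.pi ^ 2 * ∑ i, (k i : ℝ) ^ 2 = lam ^ 2) :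
    ∃ d : ℕ, 1 ≤ d ∧ (∀ k ∈ s, ∀ i, |k i| ≤ d) ∧ lam ≤ 2 * Real.pi * d ∧ Real.pi * d ≤ lam := by
  have hpi := Real.pi_pos
  have hl : 2 * Real.pi ≤ lam := by
    obtain ⟨k, hk⟩ : s.Nonempty := by
      by_contra! hs0
      refine hg (funext fun x => Complex.ofReal_injective ?_)
      simp [h x, hs0, trig]
    have h1 := hs k hk
    have h2 : (0 : ℝ) < ∑ i, (k i : ℝ) ^ 2 := by
      by_contra! h0
      have : 0 < lam ^ 2 := by positivity
      nlinarith [sq_nonneg Real.pi]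
    have h3 : (1 : ℝ) ≤ ∑ i, (k i : ℝ) ^ 2 := by
      have : 0 < ∑ i, k i ^ 2 := by exact_mod_cast h2
      exact_mod_cast Int.add_one_le_iff.2 this
    refine abs_le_of_sq_le_sq' ?_ hlam.le |>.2
    nlinarith [sq_nonneg Real.pi]
  refine ⟨⌈lam / (2 * Real.pi)⌉₊, ?_, fun k hk i => ?_, ?_, ?_⟩
  · exact Nat.one_le_ceil_iff.2 (by positivity)
  · have h1 : (k i : ℝ) ^ 2 ≤ ∑ i, (k i : ℝ) ^ 2 :=
      Finset.single_le_sum (f := fun i => (k i : ℝ) ^ 2) (fun i _ => sq_nonneg _) (Finset.mem_univ i)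
    have h2 : (2 * Real.pi * |(k i : ℝ)|) ^ 2 ≤ lam ^ 2 := by
      rw [mul_pow, sq_abs, ← hs k hk]
      nlinarith [sq_nonneg Real.pi]
    have h3 := abs_le_of_sq_le_sq' h2 hlam.le |>.2
    have h4 : |(k i : ℝ)| ≤ lam / (2 * Real.pi) := by
      rw [le_div_iff₀ (by positivity)]
      linarith
    exact_mod_cast h4.trans (Nat.le_ceil _)
  · have := Nat.le_ceil (lam / (2 * Real.pi))
    rw [div_le_iff₀ (by positivity)] at this
    linarith
  · have := (Nat.ceil_lt_add_one (show 0 ≤ lam / (2 * Real.pi) by positivity)).le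
    have h1 : Real.pi * (lam / (2 * Real.pi) + 1) = lam / 2 + Real.pi := by field_simp
    nlinarith

lemma exists_le_hausdorffMeasure_zeros (m : ℕ) : ∃ c₀ > (0 : ℝ),
    ∀ (s : Finset (Fin (m + 1) → ℤ)) (a : (Fin (m + 1) → ℤ) → ℂ) (g : (Fin (m + 1) → ℝ) → ℝ) (lam : ℝ),
      IsTrig s a g → g ≠ 0 → 0 < lam → (∀ k ∈ s, 4 * Real.pi ^ 2 * ∑ i, (k i : ℝ) ^ 2 = lam ^ 2) →
      ENNReal.ofReal (c₀ * lam) ≤ μH[m] {x ∈ unitCube (m + 1) | g x = 0} := by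
  obtain ⟨R, hR, c, hc, K, hKm, hK01, hKR, hK⟩ := exists_kernel m
  obtain ⟨B, hB, hgood⟩ := exists_good_set m hR
  set L : ℕ := ⌈R⌉₊ + 1 with hL
  have hpi := Real.pi_pos
  set η : ℝ := c ^ 2 / (B * (2 * R) ^ (m + 1) * ((2 * Real.pi) ^ (m + 1)) ^ 2) with hη
  have hη0 : 0 < η := by positivity
  refine ⟨η / (32 * Real.pi * (m + 1) * (2 * L + 1) * R), by positivity, fun s a g lam h hg hlam hs => ?_⟩
  obtain ⟨d, hd1, hd, hld, hdl⟩ := h.exists_degree hg hlam hs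
  by_cases hfin : μH[m] {x ∈ unitCube (m + 1) | g x = 0} = ⊤
  · rw [hfin]; exact le_top
  have hd0 : (1 : ℝ) ≤ d := by exact_mod_cast hd1
  have hdpos : (0 : ℝ) < d := by linarith
  obtain ⟨G, hG, hGm, hGv, hGi⟩ := hgood s a g d hd1 h hd
  set r : ℝ := R / d with hr
  have hr0 : 0 < r := by positivity
  have hgc : Continuous g := h.contDiff.continuous
  have hmean := h.setIntegral_kernel_mul (r := r) hKm hK01 hKR hK hlam hs (by
    rw [hr, mul_div_assoc', le_div_iff₀ hdpos, mul_comm lam]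
    exact mul_le_mul_of_nonneg_left (by nlinarith [Real.pi_gt_three]) hR.le)
  have hZm : MeasurableSet {x : Fin (m + 1) → ℝ | g x = 0} :=
    (isClosed_eq hgc continuous_const).measurableSet
  obtain ⟨v, hv, hvol⟩ := exists_volume_mul_neg_ge hgc hr0 hη0 (G := G \ {x | g x = 0})
    (Set.sdiff_subset.trans hG) (hGm.diff hZm)
    (by
      have h0 : volume (G ∩ {x | g x = 0}) = 0 :=
        measure_mono_null (Set.inter_subset_inter_left _ hG) (volume_zeros_eq_zero hfin)
      rw [measure_sdiff_null' h0]
      exact hGv)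
    (fun x hx => by
      refine le_trans ?_ (div_le_volume_mul_neg (C := c / lam ^ (m + 1)) (B := B / d ^ (m + 1)) hgc
        (hKm.comp (measurable_const_smul lam)) (fun _ => hK01 _) (by positivity) (by positivity)
        hx.2 (hmean x) (hGi x hx.1))
      rw [volume_centredCube, ← ENNReal.ofReal_pow (by positivity), ← ENNReal.ofReal_mul hη0.le]
      refine ENNReal.ofReal_le_ofReal ?_
      have e1 : η * (2 * r) ^ (m + 1) = c ^ 2 / (B * ((2 * Real.pi) ^ (m + 1)) ^ 2 * d ^ (m + 1)) := by
        rw [hη, hr, ← mul_div_assoc 2 R, div_pow]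
        field_simp
      have e2 : (c / lam ^ (m + 1)) ^ 2 / (B / d ^ (m + 1)) =
          c ^ 2 / (B * (lam ^ (m + 1)) ^ 2 / d ^ (m + 1)) := by
        field_simp
      rw [e1, e2]
      refine div_le_div_of_nonneg_left (by positivity) (by positivity) ?_
      rw [div_le_iff₀ (by positivity)]
      have h1 : (lam ^ (m + 1)) ^ 2 ≤ ((2 * Real.pi * d) ^ (m + 1)) ^ 2 := by gcongr
      calc B * (lam ^ (m + 1)) ^ 2 ≤ B * ((2 * Real.pi * d) ^ (m + 1)) ^ 2 := by gcongr
        _ = _ := by rw [mul_pow _ (d : ℝ)]; ring)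
  have hper : PiPeriodic g := h.periodic
  have hup := hvol.trans (volume_mul_neg_le hgc hper hr0
    (fun i => abs_le.2 ⟨(hv i trivial).1, (hv i trivial).2⟩) L (by
      have h1 : r ≤ R := div_le_self hR.le hd0
      have h2 := Nat.le_ceil R
      rw [hL]; push_cast; linarith))
  rw [← ENNReal.ofReal_toReal hfin] at hup ⊢
  set M := (μH[m] {x ∈ unitCube (m + 1) | g x = 0}).toReal
  have hM : 0 ≤ M := ENNReal.toReal_nonneg
  rw [← ENNReal.ofReal_natCast, ← ENNReal.ofReal_mul (by positivity),
    ← ENNReal.ofReal_mul (by positivity), ENNReal.ofReal_le_ofReal_iff (by positivity)] at hup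
  refine ENNReal.ofReal_le_ofReal ?_
  rw [div_mul_eq_mul_div, div_le_iff₀ (by positivity)]
  have h3 : ((m + 1 : ℕ) : ℝ) * ((2 * L + 1) * (4 * r) * M) * d = (m + 1) * ((2 * L + 1) * (4 * R) * M) := by
    rw [hr]; push_cast; field_simp
  have h4 : η * lam ≤ η * (2 * Real.pi * d) := by gcongr
  have h5 : η / 4 * d ≤ (m + 1) * ((2 * L + 1) * (4 * R) * M) := by
    rw [← h3]; gcongr
  nlinarith

end IsTrig

lemma image_ofLp_zeros {n : ℕ} (φ : EuclideanSpace ℝ (Fin n) → ℝ) :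
    WithLp.ofLp '' {x ∈ fund n | φ x = 0} = {x ∈ unitCube n | φ (WithLp.toLp 2 x) = 0} := by
  ext x
  constructor
  · rintro ⟨y, ⟨hy, hy0⟩, rfl⟩
    exact ⟨fun i _ => hy i, hy0⟩
  · rintro ⟨hx, hx0⟩
    exact ⟨WithLp.toLp 2 x, ⟨fun i => hx i trivial, hx0⟩, rfl⟩

lemma image_toLp_zeros {n : ℕ} (φ : EuclideanSpace ℝ (Fin n) → ℝ) :
    WithLp.toLp 2 '' {x ∈ unitCube n | φ (WithLp.toLp 2 x) = 0} = {x ∈ fund n | φ x = 0} := by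
  rw [← image_ofLp_zeros, Set.image_image]
  simp

lemma hausdorffMeasure_unitCube_zeros_le {n : ℕ} {d : ℝ} (hd : 0 ≤ d) (φ : EuclideanSpace ℝ (Fin n) → ℝ) :
    μH[d] {x ∈ unitCube n | φ (WithLp.toLp 2 x) = 0} ≤ μH[d] {x ∈ fund n | φ x = 0} := by
  rw [← image_ofLp_zeros]
  simpa using (PiLp.lipschitzWith_ofLp 2 fun _ : Fin n => ℝ).hausdorffMeasure_image_le hd
    {x ∈ fund n | φ x = 0}

lemma exists_hausdorffMeasure_fund_zeros_le (n : ℕ) {d : ℝ} (hd : 0 ≤ d) : ∃ A : ℝ≥0,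
    ∀ φ : EuclideanSpace ℝ (Fin n) → ℝ,
      μH[d] {x ∈ fund n | φ x = 0} ≤ A * μH[d] {x ∈ unitCube n | φ (WithLp.toLp 2 x) = 0} := by
  refine ⟨((Fintype.card (Fin n) : ℝ≥0) ^ (1 / (2 : ℝ≥0∞)).toReal) ^ d, fun φ => ?_⟩
  rw [← image_toLp_zeros, ENNReal.coe_rpow_of_nonneg _ hd]
  exact (PiLp.lipschitzWith_toLp 2 fun _ : Fin n => ℝ).hausdorffMeasure_image_le hd _

/-- **The Donnelly–Fefferman two-sided nodal volume bound, on the flat torus.**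
There are constants c₁, C₂ > 0 depending only on n such that every torus
eigenfunction with frequency λ > 0 satisfies c₁λ ≤ H^{n-1}(Z_φ) ≤ C₂λ. -/
theorem torus_donnelly_fefferman {n : ℕ} (hn : 2 ≤ n) :
    ∃ c₁ > (0 : ℝ), ∃ C₂ > (0 : ℝ), ∀ lam : ℝ, 0 < lam →
      ∀ φ : EuclideanSpace ℝ (Fin n) → ℝ, IsTorusEigenfunction lam φ →
        ENNReal.ofReal (c₁ * lam) ≤ μH[(n:ℝ)-1] {x ∈ fund n | φ x = 0} ∧
          μH[(n:ℝ)-1] {x ∈ fund n | φ x = 0} ≤ ENNReal.ofReal (C₂ * lam) := by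
  obtain ⟨m, rfl⟩ : ∃ m, n = m + 1 := ⟨n - 1, by omega⟩
  have hm : ((m + 1 : ℕ) : ℝ) - 1 = m := by push_cast; ring
  rw [hm]
  obtain ⟨c₀, hc₀, hlow⟩ := IsTrig.exists_le_hausdorffMeasure_zeros m
  obtain ⟨A, hA⟩ := exists_hausdorffMeasure_fund_zeros_le (m + 1) (d := (m : ℝ)) (by positivity)
  refine ⟨c₀, hc₀, (A + 1) * ((m + 1) * ((2 * (m + 1)) ^ (m : ℝ) * 2)), by positivity,
    fun lam hlam φ hφ => ?_⟩
  obtain ⟨s, a, hs, ha⟩ := hφ.exists_eq_trig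
  set g : (Fin (m + 1) → ℝ) → ℝ := fun x => φ (WithLp.toLp 2 x) with hg
  have h : IsTrig s a g := ha
  have hg0 : g ≠ 0 := fun h0 => hφ.2.2.1 (funext fun x => congrFun h0 (WithLp.ofLp x))
  refine ⟨(hlow s a g lam h hg0 hlam hs).trans (hausdorffMeasure_unitCube_zeros_le (by positivity) φ), ?_⟩
  obtain ⟨d, -, hd, -, hdl⟩ := h.exists_degree hg0 hlam hs
  refine (hA φ).trans ((mul_le_mul_right (h.hausdorffMeasure_zeros_le hg0 hs hd) _).trans ?_)
  have hdl' : (d : ℝ) ≤ lam := by nlinarith [Real.pi_gt_three, (Nat.cast_nonneg d : (0 : ℝ) ≤ d)]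
  calc _ = ENNReal.ofReal (A * ((m + 1) * ((2 * (m + 1)) ^ (m : ℝ) * (2 * d)))) := by
        rw [ENNReal.ofReal_mul (by positivity), ENNReal.ofReal_mul (by positivity),
          ENNReal.ofReal_mul (by positivity), ← ENNReal.ofReal_rpow_of_nonneg (by positivity) (by positivity)]
        congr 2
        · simp
        · norm_cast
        · simp [ENNReal.ofReal_mul, ENNReal.ofReal_add]
    _ ≤ _ := by
      refine ENNReal.ofReal_le_ofReal ?_
      calc _ ≤ (A + 1 : ℝ) * ((m + 1) * ((2 * (m + 1)) ^ (m : ℝ) * (2 * lam))) := by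
            gcongr
            linarith
        _ = _ := by ring
end

section
/- Let N ≥ 1 and let p, q : ℝ³ → ℝ be nonzero harmonic homogeneous polynomials of degree N which are orthogonal on the unit sphere, ∫_{S²} p q dσ = 0, where σ is the surface measure on S². Then the nodal sets of p and q on the sphere intersect: there exists x ∈ S² with p(x) = 0 and q(x) = 0. -/
open MeasureTheory
open scoped ENNReal

/-- The evaluation of a real polynomial in 3 variables at a point of ℝ³. -/
noncomputable def evalAt (p : MvPolynomial (Fin 3) ℝ) (x : EuclideanSpace ℝ (Fin 3)) : ℝ :=
  MvPolynomial.eval (fun i => x i) p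

section

open Set Filter Topology

lemma hasDerivAt_max_zero_sq (t : ℝ) :
    HasDerivAt (fun s : ℝ => max s 0 ^ 2) (2 * max t 0) t := by
  rcases lt_trichotomy t 0 with h | rfl | h
  · rw [max_eq_right h.le, mul_zero]
    refine (hasDerivAt_const t (0 : ℝ)).congr_of_eventuallyEq ?_
    filter_upwards [eventually_lt_nhds h] with s hs
    simp [max_eq_right hs.le]
  · rw [hasDerivAt_iff_isLittleO_nhds_zero]
    simp only [zero_add, max_self, mul_zero, smul_zero, sub_zero, ne_eq, OfNat.ofNat_ne_zero,
      not_false_eq_true, zero_pow]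
    refine (Asymptotics.IsBigO.of_bound 1 (Eventually.of_forall fun s => ?_)).trans_isLittleO
      (Asymptotics.isLittleO_pow_id (one_lt_two))
    rw [one_mul, norm_pow, norm_pow]
    gcongr
    rw [Real.norm_eq_abs, Real.norm_eq_abs, abs_of_nonneg (le_max_right _ _)]
    exact max_le (le_abs_self s) (abs_nonneg s)
  · rw [max_eq_left h.le]
    refine HasDerivAt.congr_of_eventuallyEq (by simpa using hasDerivAt_pow 2 t) ?_
    filter_upwards [eventually_gt_nhds h] with s hs
    simp [max_eq_left hs.le]

/-- The truncated paraboloid, a compactly supported radial weight. -/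
noncomputable def radialBump {n : ℕ} (y : EuclideanSpace ℝ (Fin n)) : ℝ := max (1 - ‖y‖ ^ 2) 0

section radialBump

variable {n : ℕ}

lemma continuous_radialBump : Continuous (radialBump (n := n)) := by
  unfold radialBump; fun_prop

lemma radialBump_nonneg (y : EuclideanSpace ℝ (Fin n)) : 0 ≤ radialBump y := le_max_right _ _

lemma radialBump_eq_zero {y : EuclideanSpace ℝ (Fin n)} (hy : 1 ≤ ‖y‖) : radialBump y = 0 :=
  max_eq_right (by nlinarith)

lemma radialBump_pos {y : EuclideanSpace ℝ (Fin n)} (hy : ‖y‖ < 1) : 0 < radialBump y :=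
  lt_max_of_lt_left (by nlinarith [norm_nonneg y])

lemma hasCompactSupport_radialBump : HasCompactSupport (radialBump (n := n)) :=
  HasCompactSupport.intro (isCompact_closedBall 0 1) fun y hy =>
    radialBump_eq_zero (by simpa using (not_le.mp fun h => hy (by simpa using h)).le)

lemma hasCompactSupport_radialBump_sq :
    HasCompactSupport fun y : EuclideanSpace ℝ (Fin n) => radialBump y ^ 2 :=
  hasCompactSupport_radialBump.comp_left (g := fun t => t ^ 2) (by simp)

lemma hasFDerivAt_radialBump_sq (y : EuclideanSpace ℝ (Fin n)) :
    HasFDerivAt (fun z => radialBump z ^ 2) ((-4 * radialBump y) • innerSL ℝ y) y := by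
  have h := (hasDerivAt_max_zero_sq (1 - ‖y‖ ^ 2)).comp_hasFDerivAt y
    ((hasStrictFDerivAt_norm_sq y).hasFDerivAt.const_sub 1)
  refine h.congr_fderiv ?_
  ext z
  simp [radialBump]
  ring

lemma integral_mul_radialBump_mul_coord {h : EuclideanSpace ℝ (Fin n) → ℝ}
    (hh : ContDiff ℝ 1 h) (i : Fin n) :
    4 * ∫ y, h y * (radialBump y * y i) =
      ∫ y, fderiv ℝ h y (EuclideanSpace.single i 1) * radialBump y ^ 2 := by
  have hc := hasCompactSupport_radialBump_sq (n := n)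
  have hd : ∀ y : EuclideanSpace ℝ (Fin n),
      fderiv ℝ (fun z => radialBump z ^ 2) y (EuclideanSpace.single i 1) =
        -4 * (radialBump y * y i) := fun y => by
    rw [(hasFDerivAt_radialBump_sq y).fderiv]
    simp [mul_assoc, EuclideanSpace.inner_single_right]
  have hcont := continuous_radialBump (n := n)
  have hfd : Continuous fun y => fderiv ℝ h y (EuclideanSpace.single i 1) :=
    (hh.continuous_fderiv one_ne_zero).clm_apply continuous_const
  have hcoord : Continuous fun y : EuclideanSpace ℝ (Fin n) => y i := by fun_prop
  have key := integral_mul_fderiv_eq_neg_fderiv_mul_of_integrable (μ := volume)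
    (f := h) (g := fun z => radialBump z ^ 2) (v := EuclideanSpace.single i 1)
    ((hfd.mul (hcont.pow 2)).integrable_of_hasCompactSupport hc.mul_left)
    (by
      simp_rw [hd]
      refine (hh.continuous.mul (continuous_const.mul
        (hcont.mul hcoord))).integrable_of_hasCompactSupport ?_
      exact (hasCompactSupport_radialBump.mul_right.mul_left).mul_left)
    ((hh.continuous.mul (hcont.pow 2)).integrable_of_hasCompactSupport hc.mul_left)
    (fun y _ => (hh.differentiable one_ne_zero).differentiableAt)
    (fun y _ => (hasFDerivAt_radialBump_sq y).differentiableAt)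
  simp_rw [hd] at key
  rw [← neg_eq_iff_eq_neg] at key
  rw [← key, ← integral_const_mul, ← integral_neg]
  congr 1 with y
  ring

lemma integral_fderiv_mul_radialBump_eq_zero {v : EuclideanSpace ℝ (Fin n) → ℝ}
    (hv : ContDiff ℝ 2 v) (hl : ∀ x, lap v x = 0) (a : EuclideanSpace ℝ (Fin n)) (ρ : ℝ) :
    ∫ y, fderiv ℝ v (a + ρ • y) y * radialBump y = 0 := by
  have hf : ∀ i : Fin n, ContDiff ℝ 1 fun x => fderiv ℝ v x (EuclideanSpace.single i 1) :=
    fun i => (hv.fderiv_right (m := 1) (by norm_num)).clm_apply contDiff_const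
  have hg : ContDiff ℝ 1 fun y : EuclideanSpace ℝ (Fin n) => a + ρ • y := by fun_prop
  have hgd : ∀ y : EuclideanSpace ℝ (Fin n), HasFDerivAt (fun y => a + ρ • y)
      (ρ • ContinuousLinearMap.id ℝ _) y := fun y =>
    ((hasFDerivAt_id y).const_smul ρ).const_add a
  have hcont := continuous_radialBump (n := n)
  have hc := hasCompactSupport_radialBump_sq (n := n)
  have hsum : ∀ y : EuclideanSpace ℝ (Fin n), fderiv ℝ v (a + ρ • y) y * radialBump y =
      ∑ i, fderiv ℝ v (a + ρ • y) (EuclideanSpace.single i 1) * (radialBump y * y i) := by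
    intro y
    have hy : y = ∑ i, y i • EuclideanSpace.single i (1 : ℝ) := by
      ext j
      simp [Pi.single_apply]
    conv_lhs => rw [hy, map_sum]
    rw [← hy, Finset.sum_mul]
    refine Finset.sum_congr rfl fun i _ => ?_
    rw [map_smul, smul_eq_mul]
    ring
  have hcoord : ∀ i : Fin n, Continuous fun y : EuclideanSpace ℝ (Fin n) => y i := by
    intro i; fun_prop
  simp_rw [hsum]
  have hint : ∀ i ∈ Finset.univ, Integrable (fun y : EuclideanSpace ℝ (Fin n) =>
      fderiv ℝ v (a + ρ • y) (EuclideanSpace.single i 1) * (radialBump y * y i)) := fun i _ =>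
    (((hf i).continuous.comp hg.continuous).mul
      (hcont.mul (hcoord i))).integrable_of_hasCompactSupport
      hasCompactSupport_radialBump.mul_right.mul_left
  rw [integral_finsetSum _ hint]
  rw [← mul_right_inj' (four_ne_zero (α := ℝ)), mul_zero, Finset.mul_sum]
  have hstep : ∀ i : Fin n,
      4 * ∫ y, fderiv ℝ v (a + ρ • y) (EuclideanSpace.single i 1) * (radialBump y * y i) =
      ∫ y, ρ * fderiv ℝ (fun x => fderiv ℝ v x (EuclideanSpace.single i 1)) (a + ρ • y)
        (EuclideanSpace.single i 1) * radialBump y ^ 2 := by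
    intro i
    refine (integral_mul_radialBump_mul_coord ((hf i).comp hg) i).trans ?_
    congr 1 with y
    have := ((((hf i).differentiable one_ne_zero).differentiableAt
      (x := a + ρ • y)).hasFDerivAt.comp y (hgd y)).fderiv
    rw [this]
    simp
  simp_rw [hstep]
  rw [← integral_finsetSum _ fun i _ => ?_]
  · simp_rw [← Finset.sum_mul, ← Finset.mul_sum]
    have : ∀ y : EuclideanSpace ℝ (Fin n), ∑ i, fderiv ℝ (fun x => fderiv ℝ v x
      (EuclideanSpace.single i 1)) (a + ρ • y) (EuclideanSpace.single i 1) = 0 := fun y => hl _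
    simp [this]
  · refine ((continuous_const.mul ?_).mul (hcont.pow 2)).integrable_of_hasCompactSupport hc.mul_left
    exact (((hf i).continuous_fderiv one_ne_zero).comp hg.continuous).clm_apply continuous_const

/-- The mean value property of harmonic functions, for the weight `radialBump`. -/
lemma integral_harmonic_mul_radialBump {v : EuclideanSpace ℝ (Fin n) → ℝ}
    (hv : ContDiff ℝ 2 v) (hl : ∀ x, lap v x = 0) (a : EuclideanSpace ℝ (Fin n)) (ρ : ℝ) :
    ∫ y, v (a + ρ • y) * radialBump y = v a * ∫ y, radialBump (n := n) y := by
  have hcont := continuous_radialBump (n := n)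
  have hF : ∀ ρ : ℝ, Continuous fun y : EuclideanSpace ℝ (Fin n) =>
      v (a + ρ • y) * radialBump y := fun ρ =>
    (hv.continuous.comp (by fun_prop)).mul hcont
  have hF' : Continuous fun z : ℝ × EuclideanSpace ℝ (Fin n) =>
      fderiv ℝ v (a + z.1 • z.2) z.2 * radialBump z.2 :=
    (((hv.continuous_fderiv two_ne_zero).comp (by fun_prop)).clm_apply continuous_snd).mul
      (hcont.comp continuous_snd)
  have hderiv : ∀ ρ₀ : ℝ, HasDerivAt
      (fun ρ : ℝ => ∫ y, v (a + ρ • y) * radialBump y) 0 ρ₀ := by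
    intro ρ₀
    obtain ⟨C, hC⟩ := ((isCompact_closedBall ρ₀ 1).prod
      (isCompact_closedBall (0 : EuclideanSpace ℝ (Fin n)) 1)).exists_bound_of_continuousOn
      hF'.continuousOn
    rw [← integral_fderiv_mul_radialBump_eq_zero hv hl a ρ₀]
    refine (hasDerivAt_integral_of_dominated_loc_of_deriv_le (μ := volume)
      (F := fun (ρ : ℝ) y => v (a + ρ • y) * radialBump y)
      (F' := fun (ρ : ℝ) y => fderiv ℝ v (a + ρ • y) y * radialBump y)
      (bound := (Metric.closedBall 0 1).indicator fun _ => C)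
      (Metric.closedBall_mem_nhds ρ₀ one_pos)
      (Eventually.of_forall fun ρ => (hF ρ).aestronglyMeasurable)
      ((hF ρ₀).integrable_of_hasCompactSupport hasCompactSupport_radialBump.mul_left)
      (hF'.comp (by fun_prop : Continuous fun y => (ρ₀, y))).aestronglyMeasurable
      (ae_of_all _ fun y ρ hρ => ?_) ?_ (ae_of_all _ fun y ρ _ => ?_)).2
    · by_cases hy : y ∈ Metric.closedBall 0 1
      · rw [indicator_of_mem hy]
        exact hC (ρ, y) ⟨hρ, hy⟩
      · rw [indicator_of_notMem hy, radialBump_eq_zero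
          (le_of_lt (by simpa using hy)), mul_zero, norm_zero]
    · exact (integrable_indicator_iff measurableSet_closedBall).2
        (integrableOn_const (measure_closedBall_lt_top.ne))
    · have h1 : HasDerivAt (fun ρ : ℝ => a + ρ • y) y ρ := by
        simpa using ((hasDerivAt_id ρ).smul_const y).const_add a
      exact (((hv.differentiable two_ne_zero).differentiableAt.hasFDerivAt).comp_hasDerivAt ρ
        h1).mul_const _
  have := is_const_of_deriv_eq_zero (fun ρ => (hderiv ρ).differentiableAt)
    (fun ρ => (hderiv ρ).deriv) ρ 0
  rw [this]
  simp [integral_const_mul]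

/-- The strong maximum principle at an interior maximum with value zero. -/
lemma harmonic_eventually_eq_zero {v : EuclideanSpace ℝ (Fin n) → ℝ}
    (hv : ContDiff ℝ 2 v) (hl : ∀ x, lap v x = 0) {a : EuclideanSpace ℝ (Fin n)}
    (ha : v a = 0) (hle : ∀ᶠ x in 𝓝 a, v x ≤ 0) : ∀ᶠ x in 𝓝 a, v x = 0 := by
  obtain ⟨r, hr, hball⟩ := Metric.nhds_basis_closedBall.eventually_iff.1 hle
  have hcont := continuous_radialBump (n := n)
  have hF : Continuous fun y : EuclideanSpace ℝ (Fin n) => -(v (a + r • y) * radialBump y) :=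
    ((hv.continuous.comp (by fun_prop)).mul hcont).neg
  have hnonneg : ∀ y : EuclideanSpace ℝ (Fin n), 0 ≤ -(v (a + r • y) * radialBump y) := by
    intro y
    rcases le_or_gt 1 ‖y‖ with hy | hy
    · simp [radialBump_eq_zero hy]
    · have : v (a + r • y) ≤ 0 := hball (by
        rw [mem_closedBall_iff_norm, add_sub_cancel_left, norm_smul, Real.norm_of_nonneg hr.le]
        nlinarith)
      nlinarith [radialBump_nonneg y]
  have hint : ∫ y : EuclideanSpace ℝ (Fin n), -(v (a + r • y) * radialBump y) = 0 := by
    rw [integral_neg, integral_harmonic_mul_radialBump hv hl, ha, zero_mul, neg_zero]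
  rw [integral_eq_zero_iff_of_nonneg hnonneg (hF.integrable_of_hasCompactSupport
    (hasCompactSupport_radialBump.mul_left.neg)), hF.ae_eq_iff_eq volume continuous_zero] at hint
  filter_upwards [Metric.ball_mem_nhds a hr] with x hx
  have hx' : ‖r⁻¹ • (x - a)‖ < 1 := by
    rw [norm_smul, norm_inv, Real.norm_of_nonneg hr.le, inv_mul_lt_one₀ hr]
    simpa [dist_eq_norm] using hx
  have := congrFun hint (r⁻¹ • (x - a))
  rw [smul_inv_smul₀ hr.ne', add_sub_cancel] at this
  simpa [(radialBump_pos hx').ne'] using this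

end radialBump

/-- A continuous map from the plane to `ℝ³ ∖ {0}` which maps the closed unit disc onto the unit
sphere, injectively apart from collapsing the unit circle to a pole. -/
noncomputable def discToSphere (z : ℂ) : EuclideanSpace ℝ (Fin 3) :=
  !₂[2 * √(1 - ‖z‖ ^ 2) * z.re, 2 * √(1 - ‖z‖ ^ 2) * z.im, 1 - 2 * ‖z‖ ^ 2]

lemma continuous_discToSphere : Continuous discToSphere := by
  unfold discToSphere
  refine (PiLp.continuous_toLp 2 _).comp (continuous_pi fun i => ?_)
  fin_cases i <;> simp <;> fun_prop

lemma discToSphere_ne_zero (z : ℂ) : discToSphere z ≠ 0 := by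
  intro h
  have h0 := congrArg (fun x => x 0) h
  have h1 := congrArg (fun x => x 1) h
  have h2 := congrArg (fun x => x 2) h
  simp [discToSphere] at h0 h1 h2
  have hz : ‖z‖ ^ 2 = 1 / 2 := by linarith
  have hs : √(1 - ‖z‖ ^ 2) ≠ 0 := by
    rw [hz]; exact (Real.sqrt_pos.2 (by norm_num)).ne'
  have hre : z.re = 0 := h0.resolve_left hs
  have him : z.im = 0 := h1.resolve_left hs
  have : z = 0 := Complex.ext hre him
  simp [this] at hz

lemma norm_discToSphere {z : ℂ} (hz : ‖z‖ ≤ 1) : ‖discToSphere z‖ = 1 := by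
  have h : 0 ≤ 1 - ‖z‖ ^ 2 := by nlinarith [norm_nonneg z]
  have hn : z.re ^ 2 + z.im ^ 2 = ‖z‖ ^ 2 := by
    rw [Complex.sq_norm, Complex.normSq_apply]; ring
  rw [EuclideanSpace.norm_eq, Real.sqrt_eq_one]
  simp [discToSphere, Fin.sum_univ_three, mul_pow, Real.sq_sqrt h]
  linear_combination 4 * (1 - ‖z‖ ^ 2) * hn

lemma exists_discToSphere_eq {x : EuclideanSpace ℝ (Fin 3)} (hx : ‖x‖ = 1) :
    ∃ z : ℂ, ‖z‖ ≤ 1 ∧ discToSphere z = x := by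
  rw [EuclideanSpace.norm_eq, Real.sqrt_eq_one] at hx
  simp only [Real.norm_eq_abs, sq_abs, Fin.sum_univ_three] at hx
  have hc : -1 ≤ x 2 := by nlinarith [sq_nonneg (x 0), sq_nonneg (x 1)]
  have hc' : x 2 ≤ 1 := by nlinarith [sq_nonneg (x 0), sq_nonneg (x 1)]
  rcases hc.eq_or_lt with h | h
  · have h0 : x 0 = 0 := by nlinarith [sq_nonneg (x 0), sq_nonneg (x 1)]
    have h1 : x 1 = 0 := by nlinarith [sq_nonneg (x 0), sq_nonneg (x 1)]
    refine ⟨1, by simp, ?_⟩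
    ext i
    fin_cases i <;> simp [discToSphere, h0, h1, ← h]
    norm_num
  · set s := √((1 + x 2) / 2) with hs
    have hs0 : 0 < s := Real.sqrt_pos.2 (by linarith)
    have hs2 : s ^ 2 = (1 + x 2) / 2 := Real.sq_sqrt (by linarith)
    have hn : ‖(⟨x 0 / (2 * s), x 1 / (2 * s)⟩ : ℂ)‖ ^ 2 = (1 - x 2) / 2 := by
      rw [Complex.sq_norm, Complex.normSq_apply]
      field_simp
      rw [hs2]
      linear_combination hx
    have hs' : √(1 - ‖(⟨x 0 / (2 * s), x 1 / (2 * s)⟩ : ℂ)‖ ^ 2) = s := by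
      rw [hn, hs]; congr 1; ring
    refine ⟨⟨x 0 / (2 * s), x 1 / (2 * s)⟩, ?_, ?_⟩
    · rw [← sq_le_one_iff₀ (norm_nonneg _), hn]; linarith
    · rw [discToSphere, hs', hn]
      ext i
      fin_cases i <;> simp <;> field_simp
      ring

lemma eq_or_norm_eq_one_of_discToSphere_eq {z w : ℂ} (hz : ‖z‖ ≤ 1)
    (h : discToSphere z = discToSphere w) : z = w ∨ ‖z‖ = 1 ∧ ‖w‖ = 1 := by
  have h0 := congrArg (fun x => x 0) h
  have h1 := congrArg (fun x => x 1) h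
  have h2 := congrArg (fun x => x 2) h
  simp [discToSphere] at h0 h1 h2
  have hzw : ‖z‖ = ‖w‖ := h2
  rw [← hzw] at h0 h1 ⊢
  rcases hz.eq_or_lt with hz | hz
  · exact Or.inr ⟨hz, hz⟩
  · have hs : √(1 - ‖z‖ ^ 2) ≠ 0 := (Real.sqrt_pos.2 (by nlinarith [norm_nonneg z])).ne'
    exact Or.inl (Complex.ext (by simpa [hs] using h0) (by simpa [hs] using h1))

lemma eqOn_of_exp_eqOn {s : Set ℂ} (hs : IsPreconnected s) {L : ℂ → ℂ} (hL : Continuous L)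
    {c : ℂ} (hc : ∀ z ∈ s, Complex.exp (L z) = c) {z w : ℂ} (hz : z ∈ s) (hw : w ∈ s) :
    L z = L w := by
  have hdisc : DiscreteTopology (range ((↑) : ℤ → ℝ)) :=
    Int.isClosedEmbedding_coe_real.isEmbedding.toHomeomorph.symm.isEmbedding.discreteTopology
  have key : ∀ u ∈ s, ∃ m : ℤ, L u = L w + m * (2 * Real.pi * Complex.I) := fun u hu =>
    Complex.exp_eq_exp_iff_exists_int.1 ((hc u hu).trans (hc w hw).symm)
  have hmaps : MapsTo (fun u => ((L u - L w) / (2 * Real.pi * Complex.I)).re) s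
      (range ((↑) : ℤ → ℝ)) := by
    intro u hu
    obtain ⟨m, hm⟩ := key u hu
    refine ⟨m, ?_⟩
    simp only [hm, add_sub_cancel_left]
    rw [mul_div_cancel_right₀ _ Complex.two_pi_I_ne_zero, Complex.intCast_re]
  have heq := hs.constant_of_mapsTo ⟨hdisc⟩ (by fun_prop : Continuous fun u =>
    ((L u - L w) / (2 * Real.pi * Complex.I)).re).continuousOn hmaps hz hw
  obtain ⟨m, hm⟩ := key z hz
  simp only [hm, add_sub_cancel_left, sub_self, zero_div, Complex.zero_re] at heq
  rw [mul_div_cancel_right₀ _ Complex.two_pi_I_ne_zero, Complex.intCast_re, Int.cast_eq_zero] at heq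
  simp [hm, heq]

/-- A continuous nonvanishing function on the sphere has a continuous argument, hence one which
attains its maximum `M` at some point `a`; rotating by `-M` makes the imaginary part of the
function locally maximal at `a` with value zero. -/
lemma exists_sphere_arg_isMax {F : EuclideanSpace ℝ (Fin 3) → ℂ} (hF : Continuous F)
    (h0 : ∀ x, x ≠ 0 → F x ≠ 0) :
    ∃ (M : ℝ) (a : EuclideanSpace ℝ (Fin 3)), ‖a‖ = 1 ∧
      (F a * Complex.exp (-(M * Complex.I))).im = 0 ∧
      ∀ᶠ x in 𝓝 a, ‖x‖ = 1 → (F x * Complex.exp (-(M * Complex.I))).im ≤ 0 := by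
  have hU : IsSimplyConnected (univ : Set ℂ) :=
    (Homeomorph.Set.univ ℂ).toHomotopyEquiv.simplyConnectedSpace
  obtain ⟨L, hLc, hL⟩ := Complex.exists_continuousOn_eqOn_exp_comp hU isOpen_univ
    (g := F ∘ discToSphere) (hF.comp continuous_discToSphere).continuousOn (by
      rintro ⟨z, -, hz⟩
      exact h0 _ (discToSphere_ne_zero z) hz)
  have hLc : Continuous L := continuousOn_univ.1 hLc
  have hL : ∀ z, Complex.exp (L z) = F (discToSphere z) := fun z => hL (mem_univ z)
  have hfib : ∀ z w : ℂ, ‖z‖ ≤ 1 → discToSphere z = discToSphere w → L z = L w := by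
    intro z w hz hzw
    rcases eq_or_norm_eq_one_of_discToSphere_eq hz hzw with rfl | ⟨hz, hw⟩
    · rfl
    · refine eqOn_of_exp_eqOn (s := Metric.sphere 0 1)
        (isPreconnected_sphere (by simp) 0 1) hLc (c := F (discToSphere 1))
        (fun u hu => ?_) (by simpa using hz) (by simpa using hw)
      rw [hL]
      congr 1
      have hu : ‖u‖ = 1 := by simpa using hu
      ext i
      fin_cases i <;> simp [discToSphere, hu]
  obtain ⟨b, hb, hmax⟩ := (isCompact_closedBall (0 : ℂ) 1).exists_isMaxOn ⟨0, by simp⟩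
    (Complex.continuous_im.comp hLc).continuousOn
  have hb : ‖b‖ ≤ 1 := by simpa using hb
  set M := (L b).im with hM
  have him : ∀ z, (F (discToSphere z) * Complex.exp (-(M * Complex.I))).im =
      Real.exp (L z).re * Real.sin ((L z).im - M) := by
    intro z
    rw [← hL, ← Complex.exp_add, Complex.exp_im]
    simp [sub_eq_add_neg]
  refine ⟨M, discToSphere b, norm_discToSphere hb, by
    rw [him, ← hM, sub_self, Real.sin_zero, mul_zero], ?_⟩
  set K := discToSphere '' (Metric.closedBall 0 1 ∩ {z | (L z).im ≤ M - Real.pi}) with hK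
  have hKc : IsClosed K := (((isCompact_closedBall (0 : ℂ) 1).inter_right
    (isClosed_le (by fun_prop) continuous_const)).image continuous_discToSphere).isClosed
  have hbK : discToSphere b ∉ K := by
    rintro ⟨z, ⟨hz, hz'⟩, hzb⟩
    have := hfib z b (by simpa using hz) hzb
    rw [mem_ofPred_eq, this] at hz'
    linarith [Real.pi_pos]
  filter_upwards [hKc.isOpen_compl.mem_nhds hbK] with x hxK hx
  obtain ⟨z, hz, rfl⟩ := exists_discToSphere_eq hx
  have hzb : z ∈ Metric.closedBall (0 : ℂ) 1 := by simpa using hz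
  have hle : (L z).im ≤ M := hmax hzb
  have hgt : M - Real.pi < (L z).im := lt_of_not_ge fun h => hxK ⟨z, ⟨hzb, h⟩, rfl⟩
  rw [him]
  exact mul_nonpos_of_nonneg_of_nonpos (Real.exp_pos _).le
    (Real.sin_nonpos_of_nonpos_of_neg_pi_le (by linarith) (by linarith))

lemma analyticOnNhd_evalAt (p : MvPolynomial (Fin 3) ℝ) : AnalyticOnNhd ℝ (evalAt p) univ :=
  AnalyticOnNhd.eval_continuousLinearMap'
    (fun i : Fin 3 => (EuclideanSpace.proj i : EuclideanSpace ℝ (Fin 3) →L[ℝ] ℝ)) p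

lemma evalAt_smul {N : ℕ} {p : MvPolynomial (Fin 3) ℝ} (hp : p.IsHomogeneous N) (t : ℝ)
    (x : EuclideanSpace ℝ (Fin 3)) : evalAt p (t • x) = t ^ N * evalAt p x := by
  simp only [evalAt, MvPolynomial.eval_eq, Finset.mul_sum]
  refine Finset.sum_congr rfl fun s hs => ?_
  simp only [PiLp.smul_apply, smul_eq_mul, mul_pow, Finset.prod_mul_distrib,
    Finset.prod_pow_eq_pow_sum, ← hp.degree_eq_sum_deg_support hs]
  ring

lemma lap_const_mul_add_const_mul {n : ℕ} {f g : EuclideanSpace ℝ (Fin n) → ℝ}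
    (hf : ContDiff ℝ 2 f) (hg : ContDiff ℝ 2 g) (a b : ℝ) (x : EuclideanSpace ℝ (Fin n)) :
    lap (fun y => a * f y + b * g y) x = a * lap f x + b * lap g x := by
  have hd : ∀ {h : EuclideanSpace ℝ (Fin n) → ℝ}, ContDiff ℝ 2 h → ∀ e : EuclideanSpace ℝ (Fin n),
      Differentiable ℝ fun y => fderiv ℝ h y e := fun hh e =>
    ((hh.fderiv_right (m := 1) (by norm_num)).clm_apply contDiff_const).differentiable one_ne_zero
  have h1 : ∀ {h k : EuclideanSpace ℝ (Fin n) → ℝ}, Differentiable ℝ h → Differentiable ℝ k →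
      ∀ y e, fderiv ℝ (fun z => a * h z + b * k z) y e =
        a * fderiv ℝ h y e + b * fderiv ℝ k y e := by
    intro h k hh hk y e
    have : HasFDerivAt (fun z => a * h z + b * k z) (a • fderiv ℝ h y + b • fderiv ℝ k y) y :=
      ((hh y).hasFDerivAt.const_mul a).add ((hk y).hasFDerivAt.const_mul b)
    simp [this.fderiv]
  simp only [lap, h1 (hf.differentiable two_ne_zero) (hg.differentiable two_ne_zero),
    h1 (hd hf _) (hd hg _), Finset.sum_add_distrib, Finset.mul_sum]

/-- The strong maximum principle for real analytic harmonic functions. -/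
lemma harmonic_eq_zero_of_eventually_nonpos {n : ℕ} {v : EuclideanSpace ℝ (Fin n) → ℝ}
    (hv : AnalyticOnNhd ℝ v univ) (hl : ∀ x, lap v x = 0) {a : EuclideanSpace ℝ (Fin n)}
    (ha : v a = 0) (hle : ∀ᶠ x in 𝓝 a, v x ≤ 0) : v = 0 :=
  hv.eq_of_eventuallyEq (fun _ _ => analyticAt_const)
    (harmonic_eventually_eq_zero hv.contDiff hl ha hle)

/-- A homogeneous function of positive degree that is analytic and harmonic has a zero on the
sphere. -/
lemma exists_sphere_zero {N : ℕ} (hN : 1 ≤ N) {u : EuclideanSpace ℝ (Fin 3) → ℝ}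
    (hu : AnalyticOnNhd ℝ u univ) (hl : ∀ x, lap u x = 0)
    (hh : ∀ (t : ℝ) x, u (t • x) = t ^ N * u x) : ∃ x, ‖x‖ = 1 ∧ u x = 0 := by
  have hzero : u 0 = 0 := by
    rw [← zero_smul ℝ (0 : EuclideanSpace ℝ (Fin 3)), hh, zero_pow (by omega), zero_mul]
  have key : ∀ w : EuclideanSpace ℝ (Fin 3) → ℝ, AnalyticOnNhd ℝ w univ → (∀ x, lap w x = 0) →
      (∀ (t : ℝ) x, w (t • x) = t ^ N * w x) → w 0 = 0 → (∀ x, ‖x‖ = 1 → w x < 0) → False := by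
    intro w hw hwl hwh hw0 hneg
    have h0 : w = 0 := harmonic_eq_zero_of_eventually_nonpos hw hwl hw0 <|
      Eventually.of_forall fun x => by
        rcases eq_or_ne x 0 with rfl | hx
        · exact hw0.le
        · have hx' : 0 < ‖x‖ := norm_pos_iff.2 hx
          rw [← smul_inv_smul₀ hx'.ne' x, hwh]
          exact mul_nonpos_of_nonneg_of_nonpos (by positivity)
            (hneg _ (by rw [norm_smul, norm_inv, norm_norm, inv_mul_cancel₀ hx'.ne'])).le
    simpa [h0] using hneg (EuclideanSpace.single 0 1) (by simp)
  by_contra! hne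
  have hpre : IsPreconnected (Metric.sphere (0 : EuclideanSpace ℝ (Fin 3)) 1) :=
    isPreconnected_sphere (Module.one_lt_rank_of_one_lt_finrank (by simp)) 0 1
  have hcont : Continuous u := continuousOn_univ.1 hu.continuousOn
  by_cases hneg : ∀ x, ‖x‖ = 1 → u x < 0
  · exact key u hu hl hh hzero hneg
  push Not at hneg
  obtain ⟨b, hb, hub⟩ := hneg
  refine key (fun x => -1 * u x + 0 * u x) (fun x hx => ?_) (fun x => ?_) (fun t x => ?_)
    (by simp [hzero]) fun x hx => ?_
  · exact (analyticAt_const.mul (hu x hx)).add (analyticAt_const.mul (hu x hx))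
  · rw [lap_const_mul_add_const_mul hu.contDiff hu.contDiff, hl]; simp
  · simp only [hh]; ring
  · have hpos : 0 < u x := by
      by_contra! hle
      obtain ⟨y, hy, hy0⟩ := hpre.intermediate_value (a := x) (b := b) (by simpa using hx)
        (by simpa using hb) hcont.continuousOn ⟨hle, hub⟩
      exact hne y (by simpa using hy) hy0
    linarith

end

/-- **Gichev's theorem on S².** If p, q are nonzero harmonic homogeneous
polynomials of degree N ≥ 1 on ℝ³ which are orthogonal in L²(S², σ) (σ the
surface measure, i.e. 2-dimensional Hausdorff measure on the unit sphere),
then their nodal sets on the sphere intersect. -/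
theorem spherical_harmonics_nodal_sets_intersect
    (N : ℕ) (hN : 1 ≤ N) (p q : MvPolynomial (Fin 3) ℝ)
    (hp0 : p ≠ 0) (hq0 : q ≠ 0)
    (hpH : p.IsHomogeneous N) (hqH : q.IsHomogeneous N)
    (hpharm : ∀ x, lap (evalAt p) x = 0)
    (hqharm : ∀ x, lap (evalAt q) x = 0)
    (horth : (∫ x in Metric.sphere (0 : EuclideanSpace ℝ (Fin 3)) 1,
        evalAt p x * evalAt q x ∂μH[(2:ℝ)]) = 0) :
    ∃ x : EuclideanSpace ℝ (Fin 3), ‖x‖ = 1 ∧ evalAt p x = 0 ∧ evalAt q x = 0 := by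
  by_contra! hne
  have hpa := analyticOnNhd_evalAt p
  have hqa := analyticOnNhd_evalAt q
  have hpc : Continuous (evalAt p) := continuousOn_univ.1 hpa.continuousOn
  have hqc : Continuous (evalAt q) := continuousOn_univ.1 hqa.continuousOn
  have hlin : ∀ a b : ℝ,
      AnalyticOnNhd ℝ (fun x => a * evalAt p x + b * evalAt q x) Set.univ ∧
      (∀ x, lap (fun x => a * evalAt p x + b * evalAt q x) x = 0) ∧
      ∀ (t : ℝ) x, a * evalAt p (t • x) + b * evalAt q (t • x) =
        t ^ N * (a * evalAt p x + b * evalAt q x) := by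
    refine fun a b => ⟨fun x hx => ?_, fun x => ?_, fun t x => ?_⟩
    · exact (analyticAt_const.mul (hpa x hx)).add (analyticAt_const.mul (hqa x hx))
    · rw [lap_const_mul_add_const_mul hpa.contDiff hqa.contDiff, hpharm, hqharm]; simp
    · rw [evalAt_smul hpH, evalAt_smul hqH]; ring
  obtain ⟨M, a, ha, ha0, hloc⟩ := exists_sphere_arg_isMax
    (F := fun x => (evalAt p x : ℂ) + evalAt q x * Complex.I) (by fun_prop) (by
      intro x hx h
      have hx' : ‖x‖ ≠ 0 := norm_ne_zero_iff.2 hx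
      have hre : evalAt p x = 0 := by simpa using congrArg Complex.re h
      have him : evalAt q x = 0 := by simpa using congrArg Complex.im h
      refine hne (‖x‖⁻¹ • x) ?_ ?_ ?_
      · rw [norm_smul, norm_inv, norm_norm, inv_mul_cancel₀ hx']
      · rw [evalAt_smul hpH, hre, mul_zero]
      · rw [evalAt_smul hqH, him, mul_zero])
  have him : ∀ x, (((evalAt p x : ℂ) + evalAt q x * Complex.I) *
      Complex.exp (-(M * Complex.I))).im =
      -Real.sin M * evalAt p x + Real.cos M * evalAt q x := by
    intro x
    simp [Complex.mul_im, Complex.exp_re, Complex.exp_im]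
    ring
  simp only [him] at ha0 hloc
  obtain ⟨hva, hvl, hvh⟩ := hlin (-Real.sin M) (Real.cos M)
  obtain ⟨hua, hul, huh⟩ := hlin (Real.cos M) (Real.sin M)
  have ha' : a ≠ 0 := fun h => by simp [h] at ha
  have hnormalize : Filter.Tendsto (fun x => ‖x‖⁻¹ • x) (nhds a) (nhds a) := by
    have : ContinuousAt (fun x : EuclideanSpace ℝ (Fin 3) => ‖x‖⁻¹ • x) a :=
      (continuousAt_id.norm.inv₀ (norm_ne_zero_iff.2 ha')).smul continuousAt_id
    simpa [ContinuousAt, ha] using this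
  have hv0 := harmonic_eq_zero_of_eventually_nonpos hva hvl ha0 (by
    filter_upwards [hnormalize.eventually hloc, eventually_ne_nhds ha'] with x hx hx0
    have hx' : 0 < ‖x‖ := norm_pos_iff.2 hx0
    have := hx (by rw [norm_smul, norm_inv, norm_norm, inv_mul_cancel₀ hx'.ne'])
    rw [← smul_inv_smul₀ hx'.ne' x, hvh]
    exact mul_nonpos_of_nonneg_of_nonpos (by positivity) this)
  obtain ⟨x, hx, hux⟩ := exists_sphere_zero hN hua hul huh
  have hvx : -Real.sin M * evalAt p x + Real.cos M * evalAt q x = 0 := congrFun hv0 x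
  refine hne x hx ?_ ?_
  · linear_combination Real.cos M * hux - Real.sin M * hvx -
      evalAt p x * Real.sin_sq_add_cos_sq M
  · linear_combination Real.sin M * hux + Real.cos M * hvx -
      evalAt q x * Real.sin_sq_add_cos_sq M
end
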